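/- arXiv:math/0507051 — 2 statements merged into one kernel-verified Lean document; each statement's English description precedes it below -/
import Mathlib

section
/- Let f6 = x^2(x-1)^2(x^2+2x) - x^2(x-1)^2(y^2-1) + (1/3)(x^2-1)(y^2-1)^2 - (1/27)(y^2-1)^3, regarded as a polynomial in ℂ[x,y]. Then f6 is irreducible in ℂ[x,y] and f6 is of non-torus type, i.e., there do not exist polynomials p, q ∈ ℂ[x,y] with total degree of p at most 2 and total degree of q at most 3 such that f6 = p^3 + q^2. -/
open MvPolynomial

noncomputable section

def x : MvPolynomial (Fin 2) ℂ := X 0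
def y : MvPolynomial (Fin 2) ℂ := X 1
def c (q : ℚ) : MvPolynomial (Fin 2) ℂ := C (q : ℂ)

/-- Oka's six-cuspidal sextic, over `ℂ`. -/
def f6 : MvPolynomial (Fin 2) ℂ :=
  x ^ 2 * (x - 1) ^ 2 * (x ^ 2 + 2 * x) - x ^ 2 * (x - 1) ^ 2 * (y ^ 2 - 1)
    + c (1/3) * (x ^ 2 - 1) * (y ^ 2 - 1) ^ 2 - c (1/27) * (y ^ 2 - 1) ^ 3

namespace Polynomial

/-- Univariate torus decompositions of the cube of a quadratic with simple roots are trivial. -/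
theorem torus_line_shared (P Q : ℂ[X]) (r : ℂ) (hr : r ≠ 0) (hP : P.natDegree ≤ 2) (hQ : Q.natDegree ≤ 3)
    (h : P ^ 3 + Q ^ 2 = ((X - C r) * (X + C r)) ^ 3) (h0 : P.eval r = 0) :
    ∃ a : ℂ, a ^ 3 = 1 ∧ P = C a * ((X - C r) * (X + C r)) := by
  obtain ⟨M, rfl⟩ := dvd_iff_isRoot.mpr h0
  have hq : Q.eval r = 0 := by
    have := congrArg (eval r) h
    simpa using this
  obtain ⟨N, rfl⟩ := dvd_iff_isRoot.mpr hq
  have hX : (X - C r) ≠ 0 := X_sub_C_ne_zero r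
  have h1 : (X - C r) * M ^ 3 + N ^ 2 = (X - C r) * (X + C r) ^ 3 := by
    apply mul_left_cancel₀ (pow_ne_zero 2 hX)
    linear_combination h
  have hn : N.eval r = 0 := by
    have := congrArg (eval r) h1
    simpa using this
  obtain ⟨n, rfl⟩ := dvd_iff_isRoot.mpr hn
  have h2 : M ^ 3 + (X - C r) * n ^ 2 = (X + C r) ^ 3 := by
    apply mul_left_cancel₀ hX
    linear_combination h1
  have hM : M.natDegree ≤ 1 := by
    by_cases hM0 : M = 0
    · simp [hM0]
    · rw [natDegree_mul hX hM0, natDegree_X_sub_C] at hP; omega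
  have hn : n.natDegree ≤ 1 := by
    by_cases hM0 : n = 0
    · simp [hM0]
    · rw [natDegree_mul hX (mul_ne_zero hX hM0), natDegree_mul hX hM0, natDegree_X_sub_C] at hQ
      omega
  obtain ⟨a, m, rfl⟩ := exists_eq_X_add_C_of_natDegree_le_one hM
  obtain ⟨c, d, rfl⟩ := exists_eq_X_add_C_of_natDegree_le_one hn
  have ev : ∀ t : ℂ, (a * t + m) ^ 3 + (t - r) * (c * t + d) ^ 2 = (t + r) ^ 3 := by
    intro t
    have := congrArg (eval t) h2
    simpa using this
  have e0 : (a * r + m) ^ 3 = 8 * r ^ 3 := by linear_combination ev r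
  have p1 := ev (r + 1)
  have p2 := ev (r - 1)
  have p3 := ev (r + 2)
  have E2 : 3 * a ^ 2 * (a * r + m) + 2 * c * (c * r + d) = 6 * r := by
    linear_combination (1/2) * p1 + (1/2) * p2 - e0
  have E3 : a ^ 3 + c ^ 2 = 1 := by
    linear_combination (1/6) * p3 - (1/2) * p1 - (1/6) * p2 + (1/2) * e0
  have E1 : 3 * a * (a * r + m) ^ 2 + (c * r + d) ^ 2 = 12 * r ^ 2 := by
    linear_combination p1 - E2 - E3 - e0
  generalize hb : a * r + m = b at *
  generalize c * r + d = D at *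
  have hη : ∃ η, b = η * (2 * r) := ⟨b / (2 * r), by field_simp⟩
  obtain ⟨η, rfl⟩ := hη
  have η3 : η ^ 3 = 1 := by
    have : 8 * r ^ 3 ≠ 0 := by simp [hr]
    apply mul_left_cancel₀ this
    linear_combination e0
  have k : (2 * r) ^ 2 * (3 * (1 - a ^ 2 * η) ^ 2 - 4 * (1 - a ^ 3) * (1 - a * η ^ 2)) = 0 := by
    have : (6 * r - 3 * a ^ 2 * (η * (2 * r))) ^ 2 = 4 * (1 - a ^ 3) * (12 * r ^ 2 - 3 * a * (η * (2 * r)) ^ 2) := by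
      rw [← E2, ← E3, ← E1]; ring
    linear_combination (1/3) * this
  have k2 := (mul_eq_zero.mp k).resolve_left (by simp [hr])
  have k3 : (1 - a * η ^ 2) ^ 4 = 0 := by
    obtain ⟨A, rfl⟩ : ∃ A, a = A * η := ⟨a * η ^ 2, by linear_combination -a * η3⟩
    have u1 : A * η * η ^ 2 = A := by linear_combination A * η3
    have u2 : (A * η) ^ 2 * η = A ^ 2 := by linear_combination A ^ 2 * η3
    have u3 : (A * η) ^ 3 = A ^ 3 := by linear_combination A ^ 3 * η3
    rw [u1, u2, u3] at k2
    rw [u1]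
    linear_combination -k2
  have k4 : a * η ^ 2 = 1 := by
    have := pow_eq_zero_iff (by norm_num) |>.mp k3
    linear_combination -this
  have k5 : a = η := by linear_combination η * k4 - a * η3
  refine ⟨a, by rw [k5, η3], ?_⟩
  have hm : m = a * r := by rw [← k5] at hb; linear_combination hb
  rw [hm, C_mul]; ring

theorem torus_line (P Q : ℂ[X]) (r : ℂ) (hr : r ≠ 0) (hP : P.natDegree ≤ 2) (hQ : Q.natDegree ≤ 3)
    (h : P ^ 3 + Q ^ 2 = ((X - C r) * (X + C r)) ^ 3) :
    ∃ a : ℂ, a ^ 3 = 1 ∧ P = C a * ((X - C r) * (X + C r)) := by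
  by_cases h0 : P.eval r = 0
  · exact torus_line_shared P Q r hr hP hQ h h0
  by_cases h1 : P.eval (-r) = 0
  · obtain ⟨a, ha, hh⟩ := torus_line_shared P Q (-r) (neg_ne_zero.mpr hr) hP hQ (by rw [h, C_neg]; ring) h1
    exact ⟨a, ha, by rw [hh, C_neg]; ring⟩
  exfalso
  have cop1 : ∀ s, P.eval s ≠ 0 → IsCoprime (X - C s) P := fun s hs =>
    (irreducible_X_sub_C s).coprime_iff_not_dvd.mpr (by rwa [dvd_iff_isRoot])
  have copS : IsCoprime ((X - C r) * (X + C r)) P := by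
    apply IsCoprime.mul_left (cop1 r h0)
    simpa using cop1 (-r) h1
  set S := (X - C r) * (X + C r) with hS
  have copQ : IsCoprime Q P := by
    have : IsCoprime (Q ^ 2) P := by
      have e : Q ^ 2 = S ^ 3 + P * (-P ^ 2) := by linear_combination h
      rw [e]
      exact IsCoprime.add_mul_left_left copS.pow_left _
    exact (IsCoprime.pow_left_iff (by norm_num)).mp this
  have dh := congrArg derivative h
  simp only [derivative_add, derivative_pow] at dh
  have dW : Q ∣ derivative P * S - P * derivative S := by
    have : Q ∣ P ^ 2 * (derivative P * S - P * derivative S) := by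
      have : Q ∣ C 3 * (P ^ 2 * (derivative P * S - P * derivative S)) := by
        refine ⟨3 * Q * derivative S - 2 * derivative Q * S, ?_⟩
        simp at dh
        have : (C 3 : ℂ[X]) = 3 := rfl
        have t2 : (C 2 : ℂ[X]) = 2 := rfl
        rw [this, t2] at dh
        rw [this]
        linear_combination S * dh - 3 * derivative S * h
      exact (IsUnit.dvd_mul_left (by simp)).mp this
    exact copQ.pow_right.dvd_of_dvd_mul_left this
  obtain ⟨a, b, c, rfl⟩ : ∃ a b c : ℂ, P = C a * X ^ 2 + C b * X + C c := by
    refine ⟨P.coeff 2, P.coeff 1, P.coeff 0, ?_⟩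
    conv_lhs => rw [P.as_sum_range_C_mul_X_pow' (n := 3) (by omega)]
    simp [Finset.sum_range_succ]; ring
  have hW : derivative (C a * X ^ 2 + C b * X + C c) * S - (C a * X ^ 2 + C b * X + C c) * derivative S
      = C (-b) * X ^ 2 + C (-2 * (a * r ^ 2 + c)) * X + C (- b * r ^ 2) := by
    simp [hS]
    have : (C 2 : ℂ[X]) = 2 := rfl
    try rw [this]
    ring
  rw [hW] at dW
  have h6 : Q ^ 2 = C (1 - a ^ 3) * X ^ 6 + C (-3 * a ^ 2 * b) * X ^ 5 + C (-3*r^2-3*a^2*c-3*a*b^2) * X ^ 4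
     + C (-6*a*b*c - b^3) * X ^ 3 + C (3*r^4 - 3*a*c^2-3*b^2*c) * X ^ 2 + C (-3*b*c^2) * X + C (-r^6-c^3) := by
    have : (C 3 : ℂ[X]) = 3 := rfl
    have t6 : (C 6 : ℂ[X]) = 6 := rfl
    simp [hS, this, t6] at h ⊢
    linear_combination h
  have ne : a * r ^ 2 + c ≠ 0 ∨ b ≠ 0 := by
    by_contra! hh
    apply h0
    simp [hh.2]; exact hh.1
  have d2 : Q.natDegree ≤ 2 := by
    refine (natDegree_le_of_dvd dW ?_).trans (natDegree_quadratic_le)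
    intro z
    have z1 := congrArg (coeff · 1) z
    have z2 := congrArg (coeff · 2) z
    simp only [coeff_add, coeff_C_mul, coeff_X_pow, coeff_X, coeff_C, coeff_zero] at z1 z2
    norm_num at z1 z2
    tauto
  have d4 : (Q ^ 2).natDegree ≤ 4 := natDegree_pow_le.trans (by omega)
  have c6 : (Q^2).coeff 6 = 0 := coeff_eq_zero_of_natDegree_lt (by omega)
  have c5 : (Q^2).coeff 5 = 0 := coeff_eq_zero_of_natDegree_lt (by omega)
  rw [h6] at c6 c5
  simp only [coeff_add, coeff_C_mul, coeff_X_pow, coeff_X, coeff_C, coeff_zero] at c6 c5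
  norm_num at c6 c5
  have ha : a ≠ 0 := by rintro rfl; simp at c6
  have hb : b = 0 := by tauto
  subst hb
  simp only [ne_eq, not_true_eq_false, or_false] at ne
  have d1 : Q.natDegree ≤ 1 := by
    have e : C (-0) * X ^ 2 + C (-2 * (a * r ^ 2 + c)) * X + C (-0 * r ^ 2) = C (-2 * (a * r ^ 2 + c)) * X := by simp
    rw [e] at dW
    refine (natDegree_le_of_dvd dW ?_).trans ((natDegree_C_mul_le _ _).trans natDegree_X_le)
    intro z
    have z1 := congrArg (coeff · 1) z
    simp only [coeff_C_mul, coeff_X, coeff_zero] at z1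
    norm_num at z1
    tauto
  have d3 : (Q ^ 2).natDegree ≤ 3 := natDegree_pow_le.trans (by omega)
  have c4 : (Q^2).coeff 4 = 0 := coeff_eq_zero_of_natDegree_lt (by omega)
  rw [h6] at c4
  simp only [coeff_add, coeff_C_mul, coeff_X_pow, coeff_X, coeff_C, coeff_zero] at c4
  norm_num at c4
  apply ne
  have : a ^ 2 * (a * r ^ 2 + c) = 0 := by linear_combination (-1/3) * c4 - r^2 * c6
  exact (mul_eq_zero.mp this).resolve_left (by simp [ha])

end Polynomial

theorem quad_form (p : MvPolynomial (Fin 2) ℂ) (hp : p.totalDegree ≤ 2) :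
    ∃ c00 c10 c01 c20 c11 c02 : ℂ, p = C c00 + C c10 * X 0 + C c01 * X 1 + C c20 * X 0 ^ 2
      + C c11 * X 0 * X 1 + C c02 * X 1 ^ 2 := by
  rw [p.as_sum]
  apply Finset.sum_induction _ (fun p : MvPolynomial (Fin 2) ℂ =>
    ∃ c00 c10 c01 c20 c11 c02 : ℂ, p = C c00 + C c10 * X 0 + C c01 * X 1 + C c20 * X 0 ^ 2
      + C c11 * X 0 * X 1 + C c02 * X 1 ^ 2)
  · rintro _ _ ⟨a, b, c, d, e, f, rfl⟩ ⟨a', b', c', d', e', f', rfl⟩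
    refine ⟨a + a', b + b', c + c', d + d', e + e', f + f', ?_⟩
    simp only [C_add]; ring
  · exact ⟨0, 0, 0, 0, 0, 0, by simp⟩
  · intro d hd
    have h := (le_totalDegree hd).trans hp
    rw [monomial_eq, Finsupp.prod_fintype _ _ (by simp), Fin.prod_univ_two]
    rw [Finsupp.sum_fintype _ _ (by simp), Fin.sum_univ_two] at h
    generalize coeff d p = k
    generalize d 0 = i at *
    generalize d 1 = j at *
    have hi : i ≤ 2 := by omega
    have hj : j ≤ 2 := by omega
    interval_cases i <;> interval_cases j <;> first | omega | skip
    · exact ⟨k, 0, 0, 0, 0, 0, by simp⟩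
    · exact ⟨0, 0, k, 0, 0, 0, by simp⟩
    · exact ⟨0, 0, 0, 0, 0, k, by simp⟩
    · exact ⟨0, k, 0, 0, 0, 0, by simp⟩
    · exact ⟨0, 0, 0, 0, k, 0, by simp [mul_assoc]⟩
    · exact ⟨0, 0, 0, k, 0, 0, by simp⟩

theorem f6_eq : f6 = (X 0 ^ 2 - C (1/3) * X 1 ^ 2 - C (2/3)) ^ 3
    + X 1 ^ 2 * (X 0 - 1) ^ 2 * (2 * X 0 + 1) := by
  have e1 : c (1/3) = C (1/3) := by simp [c]
  have e2 : c (1/27) = C (1/3) ^ 3 := by simp only [c, ← C_pow]; norm_num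
  have e3 : (C (2/3) : MvPolynomial (Fin 2) ℂ) = 2 * C (1/3) := by
    rw [show (2 : MvPolynomial (Fin 2) ℂ) = C 2 from rfl, ← C_mul]; norm_num
  have e4 : 3 * (C (1/3) : MvPolynomial (Fin 2) ℂ) = 1 := by
    rw [show (3 : MvPolynomial (Fin 2) ℂ) = C 3 from rfl, ← C_mul]; norm_num
  rw [f6, e1, e2, e3, x, y]
  generalize (C (1/3) : MvPolynomial (Fin 2) ℂ) = k at *
  grind

theorem f6_non_torus (p q : MvPolynomial (Fin 2) ℂ) (hp : p.totalDegree ≤ 2)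
    (hq : q.totalDegree ≤ 3) (h : f6 = p ^ 3 + q ^ 2) : False := by
  obtain ⟨c00, c10, c01, c20, c11, c02, rfl⟩ := quad_form p hp
  rw [f6_eq] at h
  have deg : ∀ F G : Polynomial ℂ, F.natDegree ≤ 1 → G.natDegree ≤ 1 →
      (aeval ![F, G] q).natDegree ≤ 3 := fun F G hF hG =>
    aeval_natDegree_le (n := 1) q hq _ (by intro i; fin_cases i <;> simpa)
  have k3 : (Polynomial.C 3 : Polynomial ℂ) = 3 := rfl
  -- the line y = 0
  have L0 : c10 = 0 ∧ c00 = -(2/3) * c20 ∧ c20 ^ 3 = 1 := by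
    obtain ⟨r, hr⟩ := IsAlgClosed.exists_pow_nat_eq (2/3 : ℂ) (n := 2) (by norm_num)
    have hr0 : r ≠ 0 := by rintro rfl; norm_num at hr
    have h' := congrArg (aeval ![(Polynomial.X : Polynomial ℂ), 0]) h
    have d := deg Polynomial.X 0 (by simp) (by simp)
    simp only [map_add, map_mul, map_sub, map_pow, aeval_X, algHom_C, Matrix.cons_val_zero, Matrix.cons_val_one, Polynomial.algebraMap_eq] at h'
    generalize aeval ![(Polynomial.X : Polynomial ℂ), 0] q = Q at *
    obtain ⟨a, ha, h2⟩ := Polynomial.torus_line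
      (Polynomial.C c20 * Polynomial.X ^ 2 + Polynomial.C c10 * Polynomial.X + Polynomial.C c00) Q r hr0
      Polynomial.natDegree_quadratic_le d (by
        have : Polynomial.C (2/3) = Polynomial.C r ^ 2 := by rw [← Polynomial.C_pow, hr]
        rw [this] at h'
        linear_combination -h')
    have h2 : Polynomial.C c20 * Polynomial.X ^ 2 + Polynomial.C c10 * Polynomial.X + Polynomial.C c00
        = Polynomial.C a * Polynomial.X ^ 2 + Polynomial.C (- a * r ^ 2) := by
      rw [h2]; simp; ring
    have z0 := congrArg (Polynomial.coeff · 0) h2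
    have z1 := congrArg (Polynomial.coeff · 1) h2
    have z2 := congrArg (Polynomial.coeff · 2) h2
    simp only [Polynomial.coeff_add, Polynomial.coeff_C_mul, Polynomial.coeff_X_pow, Polynomial.coeff_X, Polynomial.coeff_C] at z0 z1 z2
    norm_num at z0 z1 z2
    refine ⟨z1, ?_, by rw [z2, ha]⟩
    rw [z0, hr, z2]; ring
  -- the line x = 1
  have L1 : c01 + c11 = 0 ∧ c00 + c10 + c20 = - c02 := by
    obtain ⟨s, hs⟩ := IsAlgClosed.exists_pow_nat_eq (-27 : ℂ) (n := 2) (by norm_num)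
    have h' := congrArg (aeval ![1, (Polynomial.X : Polynomial ℂ)]) h
    have d := deg 1 Polynomial.X (by simp) (by simp)
    simp only [map_add, map_mul, map_sub, map_pow, map_one, aeval_X, algHom_C, Matrix.cons_val_zero, Matrix.cons_val_one, Polynomial.algebraMap_eq] at h'
    generalize aeval ![1, (Polynomial.X : Polynomial ℂ)] q = Q at *
    obtain ⟨a, ha, h2⟩ := Polynomial.torus_line
      (Polynomial.C (-3 * c02) * Polynomial.X ^ 2 + Polynomial.C (-3 * (c01 + c11)) * Polynomial.X + Polynomial.C (-3 * (c00 + c10 + c20)))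
      (Polynomial.C s * Q) 1 one_ne_zero
      Polynomial.natDegree_quadratic_le ((Polynomial.natDegree_C_mul_le _ _).trans d) (by
        have e1 : Polynomial.C s ^ 2 = -27 := by rw [← Polynomial.C_pow, hs]; simp; rfl
        have e3 : 3 * Polynomial.C (2/3 : ℂ) = 2 := by
          rw [← k3, ← Polynomial.C_mul]; norm_num; rfl
        have e4 : 3 * Polynomial.C (1/3 : ℂ) = 1 := by
          rw [← k3, ← Polynomial.C_mul]; norm_num
        have e5 : (Polynomial.X - Polynomial.C (1:ℂ)) * (Polynomial.X + Polynomial.C 1)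
          = -3 * (1 ^ 2 - Polynomial.C (1/3) * Polynomial.X ^ 2 - Polynomial.C (2/3)) := by
          simp only [Polynomial.C_1]
          linear_combination (-Polynomial.X ^ 2) * e4 - e3
        rw [e5, mul_pow (Polynomial.C s), e1]
        simp only [Polynomial.C_mul, Polynomial.C_add, Polynomial.C_neg, k3]
        linear_combination 27 * h')
    have h2 : Polynomial.C (-3 * c02) * Polynomial.X ^ 2 + Polynomial.C (-3 * (c01 + c11)) * Polynomial.X + Polynomial.C (-3 * (c00 + c10 + c20))
        = Polynomial.C a * Polynomial.X ^ 2 + Polynomial.C (- a) := by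
      rw [h2]; simp; ring
    have z0 := congrArg (Polynomial.coeff · 0) h2
    have z1 := congrArg (Polynomial.coeff · 1) h2
    have z2 := congrArg (Polynomial.coeff · 2) h2
    simp only [Polynomial.coeff_add, Polynomial.coeff_C_mul, Polynomial.coeff_X_pow, Polynomial.coeff_X, Polynomial.coeff_C] at z0 z1 z2
    norm_num at z0 z1 z2
    refine ⟨z1, ?_⟩
    linear_combination (1/3) * z0 - (1/3) * z2
  obtain ⟨rfl, rfl, h20⟩ := L0
  obtain ⟨L1a, L1b⟩ := L1
  have h02 : c02 = -(1/3) * c20 := by linear_combination L1b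
  subst h02
  have h01 : c01 = -c11 := by linear_combination L1a
  subst h01
  -- the line x = 2
  have h11 : c11 = 0 := by
    have h' := congrArg (aeval ![2, (Polynomial.X : Polynomial ℂ)]) h
    simp only [map_add, map_mul, map_sub, map_pow, map_one, map_ofNat, aeval_X, algHom_C, Matrix.cons_val_zero, Matrix.cons_val_one, Polynomial.algebraMap_eq] at h'
    generalize aeval ![2, (Polynomial.X : Polynomial ℂ)] q = Q at *
    have v := congrArg (Polynomial.eval 0) h'
    have dv := congrArg (fun F => Polynomial.eval 0 (Polynomial.derivative F)) h'
    simp [Polynomial.derivative_pow] at v dv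
    have hQ : Polynomial.eval 0 Q = 0 := by
      have : Polynomial.eval 0 Q ^ 2 = 0 := by linear_combination (-1) * v - (10/3)^3 * h20
      exact pow_eq_zero_iff (by norm_num) |>.mp this
    rw [hQ] at dv
    have : c20 ≠ 0 := by rintro rfl; norm_num at h20
    have e : c20 ^ 2 * c11 = 0 := by linear_combination (-3/100) * dv
    simpa [this] using e
  subst h11
  have h' := congrArg (aeval ![(Polynomial.X : Polynomial ℂ), 1]) h
  simp only [map_add, map_mul, map_sub, map_pow, map_one, map_ofNat, map_neg, map_zero, aeval_X, algHom_C, Matrix.cons_val_zero, Matrix.cons_val_one, Polynomial.algebraMap_eq, Polynomial.C_mul, Polynomial.C_neg] at h'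
  generalize aeval ![(Polynomial.X : Polynomial ℂ), 1] q = Q at *
  have h20' : Polynomial.C c20 ^ 3 = 1 := by rw [← Polynomial.C_pow, h20, Polynomial.C_1]
  have e : Q ^ 2 = (Polynomial.X - Polynomial.C 1) ^ 2 * (Polynomial.C 2 * Polynomial.X + Polynomial.C 1) := by
    rw [show (Polynomial.C 2 : Polynomial ℂ) = 2 from rfl, Polynomial.C_1]
    linear_combination -h' + (-(Polynomial.X ^ 2 - Polynomial.C (1/3) - Polynomial.C (2/3)) ^ 3) * h20'
  have e' := congrArg Polynomial.natDegree e
  rw [Polynomial.natDegree_mul (pow_ne_zero 2 (Polynomial.X_sub_C_ne_zero 1)), Polynomial.natDegree_pow, Polynomial.natDegree_pow,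
    Polynomial.natDegree_X_sub_C, Polynomial.natDegree_linear two_ne_zero] at e'
  · omega
  · intro z
    have := congrArg Polynomial.natDegree z
    rw [Polynomial.natDegree_linear two_ne_zero] at this
    simp at this

namespace Polynomial

/-- `-27 * f6` as a polynomial in `y` over `ℂ[x]`. -/
def sexticG : Polynomial (Polynomial ℂ) :=
  (X ^ 2 + C (2 - 3 * X ^ 2)) ^ 3 - C (27 * (X - 1) ^ 2 * (2 * X + 1)) * X ^ 2

theorem sexticG_aux : ((X ^ 2 + C (2 - 3 * X ^ 2)) ^ 3 : Polynomial (Polynomial ℂ)).Monic ∧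
    ((X ^ 2 + C (2 - 3 * X ^ 2)) ^ 3 : Polynomial (Polynomial ℂ)).natDegree = 6 := by
  have m : (X ^ 2 + C (2 - 3 * X ^ 2) : Polynomial (Polynomial ℂ)).Monic :=
    monic_X_pow_add_C _ two_ne_zero
  refine ⟨m.pow 3, ?_⟩
  rw [m.natDegree_pow, natDegree_X_pow_add_C]

theorem sexticG_lt : (C (27 * (X - 1) ^ 2 * (2 * X + 1)) * X ^ 2 : Polynomial (Polynomial ℂ)).natDegree
    < ((X ^ 2 + C (2 - 3 * X ^ 2)) ^ 3 : Polynomial (Polynomial ℂ)).natDegree := by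
  rw [sexticG_aux.2]
  exact (natDegree_C_mul_X_pow_le _ _).trans_lt (by norm_num)

theorem sexticG_monic : sexticG.Monic :=
  sexticG_aux.1.sub_of_left (degree_lt_degree sexticG_lt)

theorem sexticG_natDegree : sexticG.natDegree = 6 := by
  rw [sexticG, natDegree_sub_eq_left_of_natDegree_lt sexticG_lt, sexticG_aux.2]

theorem sexticG_unit (a : Polynomial (Polynomial ℂ)) (h : a ∣ sexticG) (h0 : a.natDegree = 0) :
    IsUnit a := by
  rw [natDegree_eq_zero] at h0
  obtain ⟨k, rfl⟩ := h0
  have := (C_dvd_iff_dvd_coeff _ _).mp h sexticG.natDegree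
  rw [coeff_natDegree, sexticG_monic.leadingCoeff] at this
  exact (isUnit_of_dvd_one this).map C

/-- Two complementary factors do not both vanish at the flexes on `x = -1/2`. -/
theorem sexticG_flex (a b : Polynomial (Polynomial ℂ)) (h : a * b = sexticG) (s : ℂ)
    (hs : s ^ 2 = -(5/4)) (ha : a.evalEval (-1/2) s = 0) : b.evalEval (-1/2) s ≠ 0 := by
  intro hb
  have h1 := congrArg (eval (C s)) h
  rw [eval_mul] at h1
  rw [evalEval] at ha hb
  have h2 := congrArg (fun F => eval (-1/2) (derivative F)) h1
  simp only [derivative_mul, eval_add, eval_mul, ha, hb] at h2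
  simp [sexticG, derivative_pow, hs] at h2
  norm_num at h2

theorem sexticG_map : sexticG.map (evalRingHom (-1/2 : ℂ)) = (X ^ 2 + C (5/4)) ^ 3 := by
  have e1 : (evalRingHom (-1/2 : ℂ)) (2 - 3 * X ^ 2) = 5/4 := by
    simp; norm_num
  have e2 : (evalRingHom (-1/2 : ℂ)) (27 * (X - 1) ^ 2 * (2 * X + 1)) = 0 := by
    simp; norm_num
  rw [sexticG, Polynomial.map_sub, Polynomial.map_pow, Polynomial.map_add, Polynomial.map_mul,
    map_C, map_C, e1, e2]
  simp

theorem sexticG_natDegree_map (a b : Polynomial (Polynomial ℂ)) (h : a * b = sexticG) :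
    (a.map (evalRingHom (-1/2 : ℂ))).natDegree = a.natDegree := by
  apply natDegree_map_of_leadingCoeff_ne_zero
  have := congrArg leadingCoeff h
  rw [leadingCoeff_mul, sexticG_monic.leadingCoeff] at this
  exact ((IsUnit.of_mul_eq_one _ this).map (evalRingHom (-1/2 : ℂ))).ne_zero

/-- A nonunit factor acquires a triple root over `x = -1/2`. -/
theorem sexticG_factor (a b : Polynomial (Polynomial ℂ)) (h : a * b = sexticG) (ha : ¬ IsUnit a) :
    ∃ s : ℂ, s ^ 2 = -(5/4) ∧ a.evalEval (-1/2) s = 0 ∧ 3 ≤ a.natDegree := by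
  have hd := sexticG_natDegree_map a b h
  have hm := congrArg (map (evalRingHom (-1/2 : ℂ))) h
  rw [Polynomial.map_mul, sexticG_map] at hm
  have ev : ∀ (F : Polynomial (Polynomial ℂ)) t, eval t (F.map (evalRingHom (-1/2 : ℂ))) = F.evalEval (-1/2) t :=
    fun F t => map_evalRingHom_eval _ _ _
  have hdeg : a.natDegree ≠ 0 := fun h0 => ha (sexticG_unit a ⟨b, h.symm⟩ h0)
  obtain ⟨s, hs⟩ := IsAlgClosed.exists_root (a.map (evalRingHom (-1/2 : ℂ)))
    (fun h0 => hdeg (by rw [← hd]; exact natDegree_eq_of_degree_eq_some h0))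
  have hs2 : s ^ 2 = -(5/4) := by
    have := congrArg (eval s) hm
    rw [eval_mul, hs.eq_zero, zero_mul] at this
    simp only [eval_pow, eval_add, eval_X, eval_C] at this
    have := pow_eq_zero_iff (by norm_num) |>.mp this.symm
    linear_combination this
  have has : a.evalEval (-1/2) s = 0 := by rw [← ev]; exact hs
  have hb := sexticG_flex a b h s hs2 has
  refine ⟨s, hs2, has, ?_⟩
  have cop : IsCoprime (X - C s) (b.map (evalRingHom (-1/2 : ℂ))) :=
    (irreducible_X_sub_C s).coprime_iff_not_dvd.mpr (by rwa [dvd_iff_isRoot, IsRoot, ev])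
  have dv : (X - C s) ^ 3 ∣ a.map (evalRingHom (-1/2 : ℂ)) := by
    apply (cop.pow_left (m := 3)).dvd_of_dvd_mul_right
    rw [hm]
    apply pow_dvd_pow_of_dvd
    refine ⟨X + C s, ?_⟩
    have : (C (5/4) : Polynomial ℂ) = - C s ^ 2 := by rw [← C_pow, hs2, ← C_neg]; norm_num
    rw [this]; ring
  have := natDegree_le_of_dvd dv (by
    intro z
    rw [z, natDegree_zero] at hd
    exact hdeg hd.symm)
  rwa [natDegree_pow, natDegree_X_sub_C, hd] at this

theorem sexticG_irreducible : Irreducible sexticG := by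
  have hnu : ¬ IsUnit sexticG := fun h => by
    have := natDegree_eq_zero_of_isUnit h
    rw [sexticG_natDegree] at this; omega
  obtain ⟨g, hg, h, hgh⟩ := WfDvdMonoid.exists_irreducible_factor hnu sexticG_monic.ne_zero
  by_cases hu : IsUnit h
  · rw [hgh]
    exact (irreducible_mul_isUnit hu).mpr hg
  exfalso
  obtain ⟨s, hs, gs, dg⟩ := sexticG_factor g h hgh.symm hg.not_isUnit
  obtain ⟨t, ht, hht, dh⟩ := sexticG_factor h g (by rw [hgh, mul_comm]) hu
  have g0 : g ≠ 0 := hg.ne_zero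
  have h0 : h ≠ 0 := by rintro rfl; exact sexticG_monic.ne_zero (by rw [hgh, mul_zero])
  have dsum : g.natDegree + h.natDegree = 6 := by
    rw [← natDegree_mul g0 h0, ← hgh, sexticG_natDegree]
  have hts : t = -s := by
    have : (t - s) * (t + s) = 0 := by linear_combination ht - hs
    rcases mul_eq_zero.mp this with e | e
    · exfalso
      have : t = s := by linear_combination e
      subst this
      exact sexticG_flex g h hgh.symm t ht gs hht
    · linear_combination e
  subst hts
  have gns : g.evalEval (-1/2) (-s) ≠ 0 :=
    sexticG_flex h g (by rw [hgh, mul_comm]) (-s) ht hht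
  let σ := algEquivAevalNegX (R := Polynomial ℂ)
  have hσ : ∀ F, σ F = F.comp (-X) := fun F => by simp [σ, comp_eq_aeval]
  have hG : σ sexticG = sexticG := by
    rw [hσ]; simp [sexticG]; ring
  have hgi : Irreducible (σ g) := (MulEquiv.irreducible_iff σ).mpr hg
  have hdvd : σ g ∣ g * h := by
    rw [← hgh, ← hG, hgh, map_mul]; exact dvd_mul_right _ _
  have hz : (σ g).evalEval (-1/2) (-s) = 0 := by
    rw [hσ, evalEval, eval_comp]
    simpa [evalEval] using gs
  rcases hgi.prime.dvd_or_dvd hdvd with hd | hd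
  · have := evalEval_dvd (-1/2) (-s) hd
    rw [hz, zero_dvd_iff] at this
    exact gns this
  obtain ⟨u, rfl⟩ := hd
  have dσ : (σ g).natDegree = g.natDegree := by
    rw [hσ, natDegree_comp]; simp
  have u0 : u ≠ 0 := by rintro rfl; simp at h0
  have du : u.natDegree = 0 := by
    rw [natDegree_mul hgi.ne_zero u0] at dsum dh
    omega
  have uu : IsUnit u := sexticG_unit u ⟨g * σ g, by rw [hgh]; ring⟩ du
  have key := congrArg (eval 0) hgh
  rw [eval_mul, eval_mul, hσ, eval_comp] at key
  simp only [eval_neg, eval_X, neg_zero] at key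
  have ku : IsUnit (eval 0 u) := uu.map (evalRingHom 0)
  generalize eval 0 u = k at *
  generalize eval 0 g = g0 at *
  simp [sexticG] at key
  obtain ⟨r, hr⟩ := IsAlgClosed.exists_pow_nat_eq (2/3 : ℂ) (n := 2) (by norm_num)
  have hr0 : r ≠ 0 := by rintro rfl; norm_num at hr
  have kr : eval r k ≠ 0 := (ku.map (evalRingHom r)).ne_zero
  have e2 : (2 : Polynomial ℂ) = 3 * C r ^ 2 := by
    rw [← C_pow, hr, show (3 : Polynomial ℂ) = C 3 from rfl, ← C_mul]; norm_num; rfl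
  rw [e2] at key
  have hX : (X - C r) ≠ 0 := X_sub_C_ne_zero r
  have z1 : eval r g0 = 0 := by
    have := congrArg (eval r) key
    simpa [kr] using this
  obtain ⟨g1, rfl⟩ := dvd_iff_isRoot.mpr z1
  have key1 : -27 * ((X - C r) * (X + C r) ^ 3) = g1 ^ 2 * k := by
    apply mul_left_cancel₀ (pow_ne_zero 2 hX)
    linear_combination key
  have z2 : eval r g1 = 0 := by
    have := congrArg (eval r) key1
    simpa [kr] using this
  obtain ⟨g2, rfl⟩ := dvd_iff_isRoot.mpr z2
  have key2 : -27 * ((X + C r) ^ 3) = (X - C r) * g2 ^ 2 * k := by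
    apply mul_left_cancel₀ hX
    linear_combination key1
  have := congrArg (eval r) key2
  simp at this
  exact hr0 this

end Polynomial

theorem f6_irreducible : Irreducible f6 := by
  have e : Polynomial.Bivariate.equivMvPolynomial ℂ Polynomial.sexticG = C (-27) * f6 := by
    have k1 : 3 * (C (1/3) : MvPolynomial (Fin 2) ℂ) = 1 := by
      rw [show (3 : MvPolynomial (Fin 2) ℂ) = C 3 from rfl, ← C_mul]; norm_num
    have k2 : 3 * (C (2/3) : MvPolynomial (Fin 2) ℂ) = 2 := by
      rw [show (3 : MvPolynomial (Fin 2) ℂ) = C 3 from rfl, ← C_mul]; norm_num; rfl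
    have k3 : (C (-27) : MvPolynomial (Fin 2) ℂ) = -27 := by
      rw [C_neg]; rfl
    have k4 : X 1 ^ 2 + (2 - 3 * X 0 ^ 2) = -3 * (X 0 ^ 2 - C (1/3) * X 1 ^ 2 - C (2/3) : MvPolynomial (Fin 2) ℂ) := by
      linear_combination -X 1 ^ 2 * k1 - k2
    rw [f6_eq, k3, Polynomial.sexticG]
    simp only [map_sub, map_add, map_mul, map_pow, map_ofNat, map_one, Polynomial.Bivariate.equivMvPolynomial_X,
      Polynomial.Bivariate.equivMvPolynomial_C_X]
    rw [k4]; ring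
  have h := (MulEquiv.irreducible_iff (Polynomial.Bivariate.equivMvPolynomial ℂ)).mpr Polynomial.sexticG_irreducible
  rw [e] at h
  exact (irreducible_isUnit_mul ((IsUnit.mk0 (-27 : ℂ) (by norm_num)).map C)).mp h

/-- `f6` is irreducible and of non-torus type. -/
theorem f6_irreducible_and_non_torus :
    Irreducible f6 ∧
      ¬ ∃ p q : MvPolynomial (Fin 2) ℂ,
        p.totalDegree ≤ 2 ∧ q.totalDegree ≤ 3 ∧ f6 = p ^ 3 + q ^ 2 := by
  refine ⟨f6_irreducible, ?_⟩
  rintro ⟨p, q, hp, hq, h⟩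
  exact f6_non_torus p q hp hq h

end
end

section
/- Let f6 = x^2(x-1)^2(x^2+2x) - x^2(x-1)^2(y^2-1) + (1/3)(x^2-1)(y^2-1)^2 - (1/27)(y^2-1)^3 ∈ ℂ[x,y], and let F ∈ ℂ[x,y,z] be its homogenization of degree 6, so F(x,y,1) = f6(x,y) and F is homogeneous of degree 6. Let U be the complement in the complex projective plane ℙ^2(ℂ) (the projectivization of ℂ^3 with its standard topology) of the zero locus of F. Then for every basepoint u ∈ U, the fundamental group π_1(U, u) is isomorphic to the cyclic group ℤ/6ℤ. -/
open MvPolynomial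

noncomputable section

/-- The complex projective plane, as the projectivization of `ℂ^3`. -/
abbrev P2C := Projectivization ℂ (Fin 3 → ℂ)

/-- The quotient topology on the projective plane, induced from `ℂ^3 \ {0}`. -/
instance : TopologicalSpace P2C :=
  inferInstanceAs (TopologicalSpace (Quotient (projectivizationSetoid ℂ (Fin 3 → ℂ))))

namespace Oka
open Complex Topology unitInterval

def G (X Y Z : ℂ) : ℂ :=
  (Y^2 - 3*X^2 + 2*Z^2)^3 - 27*(X-Z)^2*(2*X+Z)*Z*Y^2

lemma G_hom (k X Y Z : ℂ) : G (k*X) (k*Y) (k*Z) = k^6 * G X Y Z := by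
  unfold G; ring

lemma G_cont : Continuous (fun v : ℂ × ℂ × ℂ => G v.1 v.2.1 v.2.2) := by
  unfold G; fun_prop

lemma G_comp {α : Type*} [TopologicalSpace α] {f g h : α → ℂ} (hf : Continuous f)
    (hg : Continuous g) (hh : Continuous h) : Continuous (fun a => G (f a) (g a) (h a)) :=
  by unfold G; fun_prop

lemma eval_smul_hom (F : MvPolynomial (Fin 3) ℂ) (hF : F.IsHomogeneous 6) (k : ℂ) (v : Fin 3 → ℂ) :
    eval (k • v) F = k^6 * eval v F := by
  rw [eval_eq', eval_eq', Finset.mul_sum]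
  apply Finset.sum_congr rfl
  intro d hd
  have h1 : d.degree = 6 := by
    rw [Finsupp.degree_eq_weight_one]; exact hF (mem_support_iff.1 hd)
  rw [Finsupp.degree_eq_sum] at h1
  simp only [Pi.smul_apply, smul_eq_mul, mul_pow, Finset.prod_mul_distrib,
    Finset.prod_pow_eq_pow_sum, h1]
  ring

lemma evalF (F : MvPolynomial (Fin 3) ℂ) (hF : F.IsHomogeneous 6)
    (hFf6 : ∀ a b : ℂ, eval ![a, b, 1] F = eval ![a, b] f6) (X Y Z : ℂ) :
    eval ![X, Y, Z] F = -(1/27) * G X Y Z := by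
  have hne : ∀ Z : ℂ, Z ≠ 0 → eval ![X, Y, Z] F = -(1/27) * G X Y Z := by
    intro Z hZ
    have h1 : (![X, Y, Z] : Fin 3 → ℂ) = Z • ![X/Z, Y/Z, 1] := by
      ext i; fin_cases i <;> simp <;> field_simp
    have h3 : eval ![X, Y, Z] F = Z^6 * eval ![X/Z, Y/Z, 1] F := by
      rw [h1, eval_smul_hom F hF]
    rw [h3, hFf6]
    simp [f6, Oka.G, x, y, c]
    field_simp
    ring
  by_cases hZ : Z = 0
  · have hc1 : Continuous (fun Z : ℂ => eval ![X, Y, Z] F) :=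
      (MvPolynomial.continuous_eval F).comp (by fun_prop)
    have hc2 : Continuous (fun Z : ℂ => -(1/27) * G X Y Z) := by unfold G; fun_prop
    have : (fun Z : ℂ => eval ![X, Y, Z] F) = fun Z : ℂ => -(1/27) * G X Y Z := by
      apply Continuous.ext_on (dense_compl_singleton (0:ℂ)) hc1 hc2
      intro z hz; exact hne z hz
    exact congrFun this Z
  · exact hne Z hZ

abbrev UT := {v : ℂ × ℂ × ℂ // G v.1 v.2.1 v.2.2 ≠ 0}
abbrev U := {p : P2C // G (p.rep 0) (p.rep 1) (p.rep 2) ≠ 0}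

lemma G000 : G 0 0 0 = 0 := by simp [G]

lemma vne {X Y Z : ℂ} (h : G X Y Z ≠ 0) : (![X, Y, Z] : Fin 3 → ℂ) ≠ 0 := by
  intro h0
  apply h
  have h1 := congrFun h0 0
  have h2 := congrFun h0 1
  have h3 := congrFun h0 2
  simp at h1 h2 h3
  simp [h1, h2, h3, G]

lemma G_rep (v : Fin 3 → ℂ) (hv : v ≠ 0) :
    G ((Projectivization.mk ℂ v hv).rep 0) ((Projectivization.mk ℂ v hv).rep 1)
      ((Projectivization.mk ℂ v hv).rep 2) ≠ 0 ↔ G (v 0) (v 1) (v 2) ≠ 0 := by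
  obtain ⟨a, ha⟩ := Projectivization.exists_smul_eq_mk_rep ℂ v hv
  rw [← ha]
  simp [Units.smul_def, G_hom]

def pr (v : UT) : U :=
  ⟨Projectivization.mk ℂ ![v.1.1, v.1.2.1, v.1.2.2] (vne v.2), by
    rw [G_rep]; exact v.2⟩

lemma mk_cont : Continuous (fun v : {v : Fin 3 → ℂ // v ≠ 0} => Projectivization.mk ℂ v.1 v.2) :=
  continuous_quotient_mk'

lemma pr_cont : Continuous pr := by
  apply Continuous.subtype_mk
  have : Continuous (fun v : UT => (⟨![v.1.1, v.1.2.1, v.1.2.2], vne v.2⟩ : {v : Fin 3 → ℂ // v ≠ 0})) := by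
    apply Continuous.subtype_mk
    fun_prop
  exact mk_cont.comp this

lemma pr_eq_iff (v w : UT) : pr v = pr w ↔ ∃ k : ℂ, k ≠ 0 ∧ w.1 = k • v.1 := by
  unfold pr
  rw [Subtype.mk.injEq, Projectivization.mk_eq_mk_iff']
  constructor
  · rintro ⟨a, ha⟩
    have h1 := congrFun ha 0
    have h2 := congrFun ha 1
    have h3 := congrFun ha 2
    simp at h1 h2 h3
    have ha0 : a ≠ 0 := by
      rintro rfl
      simp at h1 h2 h3
      apply v.2; rw [← h1, ← h2, ← h3, G000]
    refine ⟨a⁻¹, inv_ne_zero ha0, ?_⟩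
    ext
    · simp [← h1, ha0]
    · simp [← h2, ha0]
    · simp [← h3, ha0]
  · rintro ⟨k, hk, h⟩
    refine ⟨k⁻¹, ?_⟩
    rw [h]
    ext i; fin_cases i <;> simp [hk]

lemma pr_surj : Function.Surjective pr := by
  rintro ⟨p, hp⟩
  refine ⟨⟨(p.rep 0, p.rep 1, p.rep 2), hp⟩, ?_⟩
  apply Subtype.ext
  have : (![p.rep 0, p.rep 1, p.rep 2] : Fin 3 → ℂ) = p.rep := by
    ext i; fin_cases i <;> rfl
  simp only [pr, this, Projectivization.mk_rep]

/-- the preimage criterion for openness in `U` -/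
lemma open_of_pr {V : Set U} (h : IsOpen (pr ⁻¹' V)) : IsOpen V := by
  have hU : IsOpen {p : P2C | G (p.rep 0) (p.rep 1) (p.rep 2) ≠ 0} := by
    have hq : IsQuotientMap (fun v : {v : Fin 3 → ℂ // v ≠ 0} => Projectivization.mk ℂ v.1 v.2) :=
      isQuotientMap_quotient_mk'
    rw [← hq.isOpen_preimage]
    have : (fun v : {v : Fin 3 → ℂ // v ≠ 0} => Projectivization.mk ℂ v.1 v.2) ⁻¹' {p : P2C | G (p.rep 0) (p.rep 1) (p.rep 2) ≠ 0}
      = {v | G (v.1 0) (v.1 1) (v.1 2) ≠ 0} := by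
      ext v; exact G_rep v.1 v.2
    rw [this]
    exact isOpen_ne_fun (G_comp ((continuous_apply 0).comp continuous_subtype_val) ((continuous_apply 1).comp continuous_subtype_val) ((continuous_apply 2).comp continuous_subtype_val)) continuous_const
  have hq : IsQuotientMap (fun v : {v : Fin 3 → ℂ // v ≠ 0} => Projectivization.mk ℂ v.1 v.2) :=
      isQuotientMap_quotient_mk'
  suffices h2 : IsOpen (Subtype.val '' V : Set P2C) by
    have : V = Subtype.val ⁻¹' (Subtype.val '' V : Set P2C) := by
      rw [Set.preimage_image_eq _ Subtype.val_injective]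
    rw [this]; exact h2.preimage continuous_subtype_val
  rw [← hq.isOpen_preimage]
  have h3 : IsOpen (Subtype.val '' (pr ⁻¹' V) : Set (ℂ × ℂ × ℂ)) := by
    have : IsOpen {v : ℂ × ℂ × ℂ | G v.1 v.2.1 v.2.2 ≠ 0} := isOpen_ne_fun G_cont continuous_const
    exact (this.isOpenEmbedding_subtypeVal.isOpen_iff_image_isOpen).1 h
  have h4 := h3.preimage (f := fun v : {v : Fin 3 → ℂ // v ≠ 0} => (v.1 0, v.1 1, v.1 2))
    (((continuous_apply 0).comp continuous_subtype_val).prodMk (((continuous_apply 1).comp continuous_subtype_val).prodMk ((continuous_apply 2).comp continuous_subtype_val)))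
  convert h4 using 1
  ext v
  simp only [Set.mem_preimage, Set.mem_image, Subtype.exists, exists_and_right, exists_eq_right]
  have hvv : (![v.1 0, v.1 1, v.1 2] : Fin 3 → ℂ) = v.1 := by
    ext i; fin_cases i <;> rfl
  constructor
  · rintro ⟨h1, h2⟩
    refine ⟨(G_rep v.1 v.2).1 h1, ?_⟩
    simpa only [pr, hvv] using h2
  · rintro ⟨h1, h2⟩
    refine ⟨(G_rep v.1 v.2).2 h1, ?_⟩
    simpa only [pr, hvv] using h2

end Oka

namespace Oka
open Complex Topology unitInterval

def Free (X Y Z d : ℂ) : Prop :=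
  ∀ t : I, G ((1-((t:ℝ):ℂ))*X) ((1-((t:ℝ):ℂ))*Y + ((t:ℝ):ℂ)*d) ((1-((t:ℝ):ℂ))*Z) ≠ 0

lemma G010 {k : ℂ} (hk : k ≠ 0) : G 0 k 0 ≠ 0 := by simp [G, hk]

def P : U := pr ⟨(0,1,0), G010 one_ne_zero⟩

lemma pr_P (v : UT) (h1 : v.1.1 = 0) (h2 : v.1.2.2 = 0) : pr v = P := by
  symm
  unfold P
  rw [pr_eq_iff]
  refine ⟨v.1.2.1, ?_, ?_⟩
  · intro h; apply v.2; rw [h1, h, h2, G000]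
  · ext <;> simp [h1, h2]

lemma Free.ne {X Y Z d : ℂ} (h : Free X Y Z d) : G X Y Z ≠ 0 := by
  have := h 0; simpa using this

lemma Free.dne {X Y Z d : ℂ} (h : Free X Y Z d) : d ≠ 0 := by
  have := h 1
  rintro rfl
  apply this; simp [G]

lemma free_of {X Y Z d : ℂ} (hd : d ≠ 0) (h : ∀ s : ℝ, 0 ≤ s → G X (Y + s*d) Z ≠ 0) :
    Free X Y Z d := by
  intro t
  by_cases ht : (t:ℝ) = 1
  · rw [ht]; simpa using G010 hd
  · have h1 : (1 - ((t:ℝ):ℂ)) ≠ 0 := by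
      intro h0; apply ht
      have : ((t:ℝ):ℂ) = 1 := by linear_combination -h0
      exact_mod_cast this
    have h2 : (0:ℝ) ≤ t/(1-t) := div_nonneg t.2.1 (sub_nonneg.2 t.2.2)
    have h3 := h _ h2
    have : (1-((t:ℝ):ℂ))*Y + ((t:ℝ):ℂ)*d = (1-((t:ℝ):ℂ))*(Y + ((t/(1-t) : ℝ):ℂ)*d) := by
      push_cast; field_simp
    rw [this, G_hom]
    exact mul_ne_zero (pow_ne_zero _ h1) h3

lemma Free.out {X Y Z d : ℂ} (h : Free X Y Z d) (s : ℝ) (hs : 0 ≤ s) : G X (Y + s*d) Z ≠ 0 := by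
  have h0 : 0 < 1 + s := by linarith
  have h1 := h ⟨s/(1+s), by positivity, by rw [div_le_one h0]; linarith⟩
  intro h2
  apply h1
  have h3 : (1 + (s:ℂ)) ≠ 0 := by exact_mod_cast h0.ne'
  have := G_hom (1/(1+s)) X (Y+s*d) Z
  rw [h2, mul_zero] at this
  convert this using 2
  · push_cast; field_simp; ring
  · push_cast; field_simp; ring
  · push_cast; field_simp; ring

lemma Free.scale {X Y Z d : ℂ} (h : Free X Y Z d) {k : ℂ} (hk : k ≠ 0) :
    Free (k*X) (k*Y) (k*Z) (k*d) := by
  intro t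
  have := G_hom k ((1-((t:ℝ):ℂ))*X) ((1-((t:ℝ):ℂ))*Y + ((t:ℝ):ℂ)*d) ((1-((t:ℝ):ℂ))*Z)
  have h2 : G (k * ((1-((t:ℝ):ℂ))*X)) (k * ((1-((t:ℝ):ℂ))*Y + ((t:ℝ):ℂ)*d)) (k * ((1-((t:ℝ):ℂ))*Z)) ≠ 0 := by
    rw [this]; exact mul_ne_zero (pow_ne_zero _ hk) (h t)
  convert h2 using 2 <;> ring

lemma Free.posd {X Y Z d : ℂ} (h : Free X Y Z d) {k : ℝ} (hk : 0 < k) :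
    Free X Y Z (k*d) := by
  apply free_of (mul_ne_zero (by exact_mod_cast hk.ne') h.dne)
  intro s hs
  have := h.out (s*k) (by positivity)
  convert this using 2
  push_cast; ring

lemma isOpen_free {α : Type*} [TopologicalSpace α] {X Y Z d : α → ℂ} (hX : Continuous X)
    (hY : Continuous Y) (hZ : Continuous Z) (hd : Continuous d) :
    IsOpen {a | Free (X a) (Y a) (Z a) (d a)} := by
  rw [← isClosed_compl_iff]
  have h1 : IsClosed {p : α × I | G ((1-((p.2:ℝ):ℂ))*X p.1) ((1-((p.2:ℝ):ℂ))*Y p.1 + ((p.2:ℝ):ℂ)*d p.1) ((1-((p.2:ℝ):ℂ))*Z p.1) = 0} := by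
    apply isClosed_eq _ continuous_const
    apply G_comp <;> fun_prop
  have h2 := isClosedMap_fst_of_compactSpace _ h1
  convert h2 using 1
  ext a
  simp [Free, and_assoc]

def rayT {X Y Z d : ℂ} (h : Free X Y Z d) (t : I) : UT :=
  ⟨((1-((t:ℝ):ℂ))*X, (1-((t:ℝ):ℂ))*Y + ((t:ℝ):ℂ)*d, (1-((t:ℝ):ℂ))*Z), h t⟩

lemma rayT_cont {X Y Z d : ℂ} (h : Free X Y Z d) : Continuous (rayT h) := by
  apply Continuous.subtype_mk
  fun_prop

def ray {X Y Z d : ℂ} (h : Free X Y Z d) : Path (pr ⟨(X,Y,Z), h.ne⟩) P where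
  toFun t := pr (rayT h t)
  continuous_toFun := pr_cont.comp (rayT_cont h)
  source' := by simp [rayT]
  target' := by apply pr_P <;> simp [rayT]

open Classical in
/-- wedge loops -/
def W (X Y Z d1 d2 : ℂ) : FundamentalGroup U P :=
  if h : Free X Y Z d1 ∧ Free X Y Z d2 then
    FundamentalGroup.fromPath (Path.Homotopic.Quotient.mk ((ray h.2).symm.trans (ray h.1)))
  else 1

lemma W_def {X Y Z d1 d2 : ℂ} (h1 : Free X Y Z d1) (h2 : Free X Y Z d2) :
    W X Y Z d1 d2 = FundamentalGroup.fromPath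
      (Path.Homotopic.Quotient.mk ((ray h2).symm.trans (ray h1))) := by
  unfold W; rw [dif_pos ⟨h1, h2⟩]

lemma family {V : Type*} [TopologicalSpace V] {a b : V} (γ : I → Path a b) (h : Continuous ↿γ) :
    Path.Homotopic.Quotient.mk (γ 0) = Path.Homotopic.Quotient.mk (γ 1) := by
  rw [Path.Homotopic.Quotient.eq]
  refine ⟨{ toFun := fun p => γ p.1 p.2
            continuous_toFun := h
            map_zero_left := fun t => rfl
            map_one_left := fun t => rfl
            prop' := ?_ }⟩
  intro t s hs
  rcases hs with rfl | hs
  · simp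
  · rw [Set.mem_singleton_iff] at hs; subst hs; simp

lemma ray_fam {α : Type*} [TopologicalSpace α] {X Y Z d : α → ℂ} (hX : Continuous X)
    (hY : Continuous Y) (hZ : Continuous Z) (hd : Continuous d)
    (hf : ∀ a, Free (X a) (Y a) (Z a) (d a)) :
    Continuous ↿(fun a => ray (hf a)) := by
  change Continuous (fun p : α × I => pr (rayT (hf p.1) p.2))
  apply pr_cont.comp
  apply Continuous.subtype_mk
  fun_prop

lemma W_fam {X Y Z d1 d2 : I → ℂ} (hX : Continuous X)
    (hY : Continuous Y) (hZ : Continuous Z) (hd1 : Continuous d1) (hd2 : Continuous d2)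
    (hf1 : ∀ a, Free (X a) (Y a) (Z a) (d1 a)) (hf2 : ∀ a, Free (X a) (Y a) (Z a) (d2 a)) :
    W (X 0) (Y 0) (Z 0) (d1 0) (d2 0) = W (X 1) (Y 1) (Z 1) (d1 1) (d2 1) := by
  rw [W_def (hf1 0) (hf2 0), W_def (hf1 1) (hf2 1)]
  apply congrArg
  apply family (fun k => (ray (hf2 k)).symm.trans (ray (hf1 k)))
  apply Path.trans_continuous_family
  · exact Path.symm_continuous_family _ (ray_fam hX hY hZ hd2 hf2)
  · exact ray_fam hX hY hZ hd1 hf1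

lemma W_joined {α : Type*} [TopologicalSpace α] {S : Set α} {a b : α} (hab : JoinedIn S a b)
    {X Y Z d1 d2 : α → ℂ} (hX : ContinuousOn X S)
    (hY : ContinuousOn Y S) (hZ : ContinuousOn Z S) (hd1 : ContinuousOn d1 S)
    (hd2 : ContinuousOn d2 S)
    (hf1 : ∀ a ∈ S, Free (X a) (Y a) (Z a) (d1 a)) (hf2 : ∀ a ∈ S, Free (X a) (Y a) (Z a) (d2 a)) :
    W (X a) (Y a) (Z a) (d1 a) (d2 a) = W (X b) (Y b) (Z b) (d1 b) (d2 b) := by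
  obtain ⟨γ, hγ⟩ := hab
  have key : ∀ {f : α → ℂ}, ContinuousOn f S → Continuous (fun t => f (γ t)) := fun hf =>
    hf.comp_continuous γ.continuous hγ
  have := W_fam (key hX) (key hY) (key hZ) (key hd1) (key hd2) (fun t => hf1 _ (hγ t))
    (fun t => hf2 _ (hγ t))
  simpa using this

lemma W_mul {X Y Z d1 d2 d3 : ℂ} (h1 : Free X Y Z d1) (h2 : Free X Y Z d2) (h3 : Free X Y Z d3) :
    W X Y Z d1 d2 * W X Y Z d2 d3 = W X Y Z d1 d3 := by
  rw [W_def h1 h2, W_def h2 h3, W_def h1 h3]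
  rw [FundamentalGroup.mul_def]
  simp only [Path.Homotopic.Quotient.mk_trans, Path.Homotopic.Quotient.mk_symm]
  rw [Path.Homotopic.Quotient.trans_assoc, ← Path.Homotopic.Quotient.trans_assoc (Path.Homotopic.Quotient.mk (ray h2)),
    Path.Homotopic.Quotient.trans_symm, Path.Homotopic.Quotient.refl_trans]

lemma W_self (X Y Z d : ℂ) : W X Y Z d d = 1 := by
  by_cases h : Free X Y Z d
  · exact mul_eq_left.1 (W_mul h h h)
  · unfold W; rw [dif_neg]; tauto

lemma W_inv {X Y Z d1 d2 : ℂ} (h1 : Free X Y Z d1) (h2 : Free X Y Z d2) :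
    (W X Y Z d1 d2)⁻¹ = W X Y Z d2 d1 := by
  rw [inv_eq_iff_mul_eq_one, W_mul h1 h2 h1, W_self]

lemma W_scale {X Y Z d1 d2 k : ℂ} (hk : k ≠ 0) (h1 : Free X Y Z d1) (h2 : Free X Y Z d2) :
    W (k*X) (k*Y) (k*Z) (k*d1) (k*d2) = W X Y Z d1 d2 := by
  have hj : JoinedIn {z : ℂ | z ≠ 0} k 1 := by
    have := (isPathConnected_compl_singleton_of_one_lt_rank (by simp) (0:ℂ) : IsPathConnected ({0}ᶜ : Set ℂ))
    exact this.joinedIn k hk 1 one_ne_zero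
  have := W_joined hj (X := fun k => k * X) (Y := fun k => k * Y) (Z := fun k => k*Z)
    (d1 := fun k => k*d1) (d2 := fun k => k*d2) (by fun_prop) (by fun_prop) (by fun_prop) (by fun_prop) (by fun_prop)
    (fun a ha => h1.scale ha) (fun a ha => h2.scale ha)
  simpa using this

lemma W_P {Y d1 d2 : ℂ} (h1 : Free 0 Y 0 d1) (h2 : Free 0 Y 0 d2) : W 0 Y 0 d1 d2 = 1 := by
  rw [W_def h1 h2]
  have hc : ∀ {d} (h : Free 0 Y 0 d) t, ray h t = P := by
    intro d h t
    change pr _ = P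
    apply pr_P <;> simp [rayT]
  have : (ray h2).symm.trans (ray h1) = Path.refl P := by
    ext t
    rw [Path.trans_apply]
    split_ifs
    · exact congrArg Subtype.val (hc h2 _)
    · exact congrArg Subtype.val (hc h1 _)
  rw [this]; rfl

/-- auxiliary loops -/
def Aq {v : I → UT} (hv : Continuous v) (h0 : pr (v 0) = P) (s : I) : Path P (pr (v s)) where
  toFun t := pr (v (s * t))
  continuous_toFun := pr_cont.comp (hv.comp (by fun_prop))
  source' := by simp [h0]
  target' := by simp

lemma VK {v : I → UT} (hv : Continuous v) (h0 : (v 0).1.1 = 0) (h0' : (v 0).1.2.2 = 0)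
    (h1 : (v 1).1.1 = 0) (h1' : (v 1).1.2.2 = 0) (H : Subgroup (FundamentalGroup U P))
    (D : Set ℂ) (hD : ∀ t, ∃ d ∈ D, Free (v t).1.1 (v t).1.2.1 (v t).1.2.2 d)
    (hW : ∀ t, ∀ d ∈ D, ∀ d' ∈ D, Free (v t).1.1 (v t).1.2.1 (v t).1.2.2 d →
      Free (v t).1.1 (v t).1.2.1 (v t).1.2.2 d' → W (v t).1.1 (v t).1.2.1 (v t).1.2.2 d d' ∈ H)
    (L : Path P P) (hL : ∀ t, L t = pr (v t)) :
    FundamentalGroup.fromPath (Path.Homotopic.Quotient.mk L) ∈ H := by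
  have hp0 := pr_P _ h0 h0'
  have hp1 := pr_P _ h1 h1'
  let A : ∀ (s : I) (d : ℂ) (h : Free (v s).1.1 (v s).1.2.1 (v s).1.2.2 d), FundamentalGroup U P :=
    fun s d h => FundamentalGroup.fromPath (Path.Homotopic.Quotient.mk ((Aq hv hp0 s).trans (ray h)))
  have hA : ∀ s d d' (h : Free (v s).1.1 (v s).1.2.1 (v s).1.2.2 d)
      (h' : Free (v s).1.1 (v s).1.2.1 (v s).1.2.2 d'), A s d' h' = W (v s).1.1 (v s).1.2.1 (v s).1.2.2 d' d * A s d h := by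
    intro s d d' h h'
    rw [W_def h' h]
    change FundamentalGroup.fromPath _ = _
    rw [FundamentalGroup.mul_def]
    simp only [Path.Homotopic.Quotient.mk_trans, Path.Homotopic.Quotient.mk_symm]
    change Path.Homotopic.Quotient.trans _ _ = Path.Homotopic.Quotient.trans (Path.Homotopic.Quotient.mk ((Aq hv hp0 s).trans (ray h))) _
    simp only [Path.Homotopic.Quotient.mk_trans, Path.Homotopic.Quotient.mk_symm]
    rw [Path.Homotopic.Quotient.trans_assoc, ← Path.Homotopic.Quotient.trans_assoc (Path.Homotopic.Quotient.mk (ray h)),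
    Path.Homotopic.Quotient.trans_symm, Path.Homotopic.Quotient.refl_trans]
  let K : I → Prop := fun s => ∀ d ∈ D, ∀ h : Free (v s).1.1 (v s).1.2.1 (v s).1.2.2 d, A s d h ∈ H
  have hKiff : ∀ s d (hd : d ∈ D) (h : Free (v s).1.1 (v s).1.2.1 (v s).1.2.2 d), K s ↔ A s d h ∈ H := by
    intro s d hd h
    constructor
    · intro hk; exact hk d hd h
    · intro hk d' hd' h'
      rw [hA s d d' h h']
      exact H.mul_mem (hW s d' hd' d hd h' h) hk
  have hloc : IsLocallyConstant K := by
    rw [IsLocallyConstant.iff_eventually_eq]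
    intro s
    obtain ⟨d, hd, hf⟩ := hD s
    have hc1 : Continuous (fun s => (v s).1.1) := by fun_prop
    have hc2 : Continuous (fun s => (v s).1.2.1) := by fun_prop
    have hc3 : Continuous (fun s => (v s).1.2.2) := by fun_prop
    have hop := isOpen_free hc1 hc2 hc3 (d := fun _ => d) continuous_const
    have : LocallyPathConnectedSpace I := (convex_Icc (0:ℝ) 1).locallyPathConnectedSpace
    have hnb := pathComponentIn_mem_nhds (hop.mem_nhds hf)
    filter_upwards [hnb] with s' hs'
    obtain ⟨γ, hγ⟩ := hs'
    have hf' : Free (v s').1.1 (v s').1.2.1 (v s').1.2.2 d := by have := hγ 1; simpa using this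
    rw [eq_iff_iff, hKiff s' d hd hf', hKiff s d hd hf]
    have := family (fun k => (Aq hv hp0 (γ k)).trans (ray (hγ k))) (by
      apply Path.trans_continuous_family
      · change Continuous (fun p : I × I => pr (v (γ p.1 * p.2)))
        exact pr_cont.comp (hv.comp (by fun_prop))
      · exact ray_fam (hc1.comp γ.continuous) (hc2.comp γ.continuous) (hc3.comp γ.continuous) continuous_const hγ)
    have e : A s d hf = A s' d hf' := by
      have aux : ∀ s'' (e : s'' = s) (h : Free (v s'').1.1 (v s'').1.2.1 (v s'').1.2.2 d), A s'' d h = A s d hf := by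
        rintro s'' rfl h; rfl
      have aux' : ∀ s'' (e : s'' = s') (h : Free (v s'').1.1 (v s'').1.2.1 (v s'').1.2.2 d), A s'' d h = A s' d hf' := by
        rintro s'' rfl h; rfl
      rw [← aux (γ 0) γ.source (hγ 0), ← aux' (γ 1) γ.target (hγ 1)]
      exact this
    rw [e]
  have hK := hloc.apply_eq_of_preconnectedSpace 0 1
  obtain ⟨d0, hd0, hf0⟩ := hD 0
  obtain ⟨d1, hd1, hf1⟩ := hD 1
  have hrc : ∀ s d (h : Free (v s).1.1 (v s).1.2.1 (v s).1.2.2 d), (v s).1.1 = 0 → (v s).1.2.2 = 0 →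
     ∀ t, ray h t = P := by
    intro s d h ha hb t
    change pr _ = P
    apply pr_P <;> simp [rayT, ha, hb]
  have hK0 : K 0 := by
    rw [hKiff 0 d0 hd0 hf0]
    have : (Aq hv hp0 0).trans (ray hf0) = Path.refl P := by
      ext t
      rw [Path.trans_apply]
      split_ifs
      · change (pr _).1 = _
        rw [zero_mul, hp0]; rfl
      · rw [hrc 0 d0 hf0 h0 h0']; rfl
    change FundamentalGroup.fromPath (Path.Homotopic.Quotient.mk _) ∈ H
    rw [this]
    exact H.one_mem
  rw [hK, hKiff 1 d1 hd1 hf1] at hK0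
  have : (Aq hv hp0 1).trans (ray hf1) = L.trans (Path.refl P) := by
    ext t
    rw [Path.trans_apply, Path.trans_apply]
    split_ifs
    · change (pr _).1 = _
      rw [one_mul, hL]
    · rw [hrc 1 d1 hf1 h1 h1']; rfl
  change FundamentalGroup.fromPath (Path.Homotopic.Quotient.mk _) ∈ H at hK0
  rw [this, Path.Homotopic.Quotient.mk_trans, Path.Homotopic.Quotient.mk_refl, Path.Homotopic.Quotient.trans_refl] at hK0
  exact hK0

end Oka

namespace Oka
open Complex Topology

def pp (X Z : ℂ) : Polynomial ℂ :=
  (Polynomial.X^2 - Polynomial.C (3*X^2-2*Z^2))^3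
    - Polynomial.C (27*((X-Z)^2*(2*X+Z)*Z)) * Polynomial.X^2

lemma pp_eval (X y Z : ℂ) : (pp X Z).eval y = G X y Z := by
  simp [pp, G]; ring

lemma pp_aux (X Z : ℂ) : ((Polynomial.X^2 - Polynomial.C (3*X^2-2*Z^2))^3 : Polynomial ℂ).Monic ∧
    ((Polynomial.X^2 - Polynomial.C (3*X^2-2*Z^2))^3 : Polynomial ℂ).natDegree = 6 := by
  have h1 : (Polynomial.X^2 - Polynomial.C (3*X^2-2*Z^2) : Polynomial ℂ).Monic :=
    Polynomial.monic_X_pow_sub_C _ two_ne_zero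
  refine ⟨h1.pow 3, ?_⟩
  rw [h1.natDegree_pow, Polynomial.natDegree_X_pow_sub_C]

lemma pp_lt (X Z : ℂ) : (Polynomial.C (27*((X-Z)^2*(2*X+Z)*Z)) * Polynomial.X^2).degree <
    ((Polynomial.X^2 - Polynomial.C (3*X^2-2*Z^2))^3 : Polynomial ℂ).degree := by
  rw [Polynomial.degree_eq_natDegree (pp_aux X Z).1.ne_zero, (pp_aux X Z).2]
  refine lt_of_le_of_lt (Polynomial.degree_C_mul_X_pow_le 2 _) ?_
  norm_num

lemma pp_monic (X Z : ℂ) : (pp X Z).Monic := (pp_aux X Z).1.sub_of_left (pp_lt X Z)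

lemma pp_natDegree (X Z : ℂ) : (pp X Z).natDegree = 6 := by
  unfold pp
  rw [Polynomial.natDegree_sub_eq_left_of_natDegree_lt, (pp_aux X Z).2]
  rw [(pp_aux X Z).2]
  exact lt_of_le_of_lt (Polynomial.natDegree_C_mul_X_pow_le _ _) (by norm_num)

lemma roots_fin (X Z : ℂ) : {y | G X y Z = 0}.Finite := by
  have := Polynomial.finite_setOfPred_isRoot (pp_monic X Z).ne_zero
  simpa [Polynomial.IsRoot, pp_eval] using this

/-- all but finitely many slopes are free -/
lemma slopes_fin {X Y Z : ℂ} (h : G X Y Z ≠ 0) : {κ : ℝ | ¬ Free X Y Z (1 + κ*I)}.Finite := by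
  apply ((roots_fin X Z).image (fun r => (r-Y).im/(r-Y).re)).subset
  intro κ hκ
  by_contra hc
  apply hκ
  apply free_of
  · intro h0
    have := congrArg Complex.re h0
    simp at this
  intro s hs h0
  apply hc
  refine ⟨_, h0, ?_⟩
  have hs0 : s ≠ 0 := by
    rintro rfl
    apply h; simpa using h0
  simp [hs0]

lemma exists_free {X Y Z : ℂ} (h : G X Y Z ≠ 0) : ∃ d, Free X Y Z d := by
  obtain ⟨κ, hκ⟩ := (slopes_fin h).infinite_compl.nonempty
  exact ⟨_, not_not.1 hκ⟩

abbrev E := {v : ℂ × ℂ × ℂ // G v.1 v.2.1 v.2.2 = 1}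
abbrev M6 := rootsOfUnity 6 ℂ

lemma M6pow (g : M6) : ((g:ℂˣ):ℂ)^6 = 1 := by
  have := g.2
  rw [mem_rootsOfUnity'] at this
  exact this

instance : MulAction M6 E where
  smul g v := ⟨((g:ℂˣ):ℂ) • v.1, by
    have := G_hom ((g:ℂˣ):ℂ) v.1.1 v.1.2.1 v.1.2.2
    rw [M6pow, one_mul, v.2] at this
    exact this⟩
  one_smul v := by
    apply Subtype.ext
    change ((1:ℂ)) • v.1 = v.1
    simp
  mul_smul g h v := by
    apply Subtype.ext
    change (((g:ℂˣ):ℂ) * ((h:ℂˣ):ℂ)) • v.1 = ((g:ℂˣ):ℂ) • (((h:ℂˣ):ℂ) • v.1)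
    rw [mul_smul]

lemma smulE (g : M6) (v : E) : (g • v).1 = ((g:ℂˣ):ℂ) • v.1 := rfl

instance : ContinuousConstSMul M6 E where
  continuous_const_smul g := by
    apply Continuous.subtype_mk
    fun_prop

def toUT (v : E) : UT := ⟨v.1, by rw [v.2]; exact one_ne_zero⟩
def pE (v : E) : U := pr (toUT v)

lemma pE_cont : Continuous pE := pr_cont.comp (by
  apply Continuous.subtype_mk; fun_prop)

lemma Ene (v : E) : v.1 ≠ 0 := by
  intro h
  have := v.2
  rw [h] at this
  simp [G] at this

lemma pE_iff {v w : E} : pE v = pE w ↔ v ∈ MulAction.orbit M6 w := by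
  unfold pE
  rw [eq_comm, pr_eq_iff]
  constructor
  · rintro ⟨k, hk, h⟩
    have h6 : k^6 = 1 := by
      have h1 := v.2
      have h2 := G_hom k w.1.1 w.1.2.1 w.1.2.2
      rw [w.2] at h2
      change v.1 = k • w.1 at h
      rw [h] at h1
      change G (k * w.1.1) (k * w.1.2.1) (k * w.1.2.2) = 1 at h1
      rw [h1] at h2
      rw [mul_one] at h2; exact h2.symm
    refine ⟨⟨Units.mk0 k hk, ?_⟩, ?_⟩
    · rw [mem_rootsOfUnity']; exact h6
    · apply Subtype.ext; exact h.symm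
  · rintro ⟨g, rfl⟩
    exact ⟨_, (g:ℂˣ).ne_zero, rfl⟩

/-- normalising local section -/
lemma pE_surj : Function.Surjective pE := by
  intro p
  obtain ⟨v, rfl⟩ := pr_surj p
  obtain ⟨k, hk⟩ := IsAlgClosed.exists_pow_nat_eq (G v.1.1 v.1.2.1 v.1.2.2) (n := 6) (by norm_num)
  have hk0 : k ≠ 0 := by
    rintro rfl; apply v.2; rw [← hk]; simp
  have hE : G (k⁻¹ * v.1.1) (k⁻¹ * v.1.2.1) (k⁻¹ * v.1.2.2) = 1 := by
    rw [G_hom, ← hk, inv_pow, inv_mul_cancel₀ (pow_ne_zero _ hk0)]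
  refine ⟨⟨k⁻¹ • v.1, hE⟩, ?_⟩
  unfold pE
  rw [eq_comm, pr_eq_iff]
  exact ⟨_, inv_ne_zero hk0, rfl⟩

lemma pE_quot : IsQuotientMap pE := by
  rw [isQuotientMap_iff, isCoinducing_iff]
  refine ⟨?_, pE_surj⟩
  intro s
  refine ⟨fun h => ?_, fun h => h.preimage pE_cont⟩
  apply open_of_pr
  rw [isOpen_iff_mem_nhds]
  intro w hw
  obtain ⟨k, hk⟩ := IsAlgClosed.exists_pow_nat_eq (G w.1.1 w.1.2.1 w.1.2.2) (n := 6) (by norm_num)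
  have hk0 : k ≠ 0 := by
    rintro rfl; apply w.2; rw [← hk]; simp
  let gg : UT → ℂ := fun v => G v.1.1 v.1.2.1 v.1.2.2
  have hgg : Continuous gg := G_comp (by fun_prop) (by fun_prop) (by fun_prop)
  let kk : UT → ℂ := fun v => k * (gg v / gg w) ^ ((6:ℕ):ℂ)⁻¹
  have hkk6 : ∀ v, kk v ^ 6 = gg v := by
    intro v
    change (k * (gg v / gg w) ^ ((6:ℕ):ℂ)⁻¹)^6 = _
    rw [mul_pow, Complex.cpow_nat_inv_pow _ (by norm_num), hk]
    change gg w * (gg v / gg w) = gg v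
    have : gg w ≠ 0 := w.2
    field_simp
  have hkk0 : ∀ v, kk v ≠ 0 := by
    intro v h; apply v.2
    have := hkk6 v
    rw [h] at this; simpa using this.symm
  have hkkc : ContinuousAt kk w := by
    apply ContinuousAt.mul continuousAt_const
    apply ContinuousAt.cpow _ continuousAt_const
    · rw [div_self w.2]; simp
    · exact hgg.continuousAt.div_const _
  let f : UT → E := fun v => ⟨(kk v)⁻¹ • v.1, by
    have := G_hom (kk v)⁻¹ v.1.1 v.1.2.1 v.1.2.2
    change G ((kk v)⁻¹ * v.1.1) ((kk v)⁻¹ * v.1.2.1) ((kk v)⁻¹ * v.1.2.2) = 1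
    rw [this, inv_pow, hkk6]
    exact inv_mul_cancel₀ v.2⟩
  have hfc : ContinuousAt f w := by
    refine (Topology.IsEmbedding.subtypeVal (p := fun v : ℂ × ℂ × ℂ => G v.1 v.2.1 v.2.2 = 1)).continuousAt_iff.2 ?_
    exact (hkkc.inv₀ (hkk0 w)).smul continuous_subtype_val.continuousAt
  have hf : ∀ v, pE (f v) = pr v := by
    intro v
    unfold pE
    rw [eq_comm, pr_eq_iff]
    exact ⟨_, inv_ne_zero (hkk0 v), rfl⟩
  have : f ⁻¹' (pE ⁻¹' s) ∈ 𝓝 w := by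
    apply hfc
    apply h.mem_nhds
    change pE (f w) ∈ s
    rw [hf]; exact hw
  filter_upwards [this] with v hv
  change pr v ∈ s
  rw [← hf]; exact hv

lemma pE_cov : IsQuotientCoveringMap pE M6 := by
  have hcl : IsClosed {v : ℂ × ℂ × ℂ | G v.1 v.2.1 v.2.2 = 1} := isClosed_eq G_cont continuous_const
  have : LocallyCompactSpace E := hcl.isClosedEmbedding_subtypeVal.locallyCompactSpace
  have : IsCancelSMul M6 E := by
    rw [isCancelSMul_iff_eq_one_of_smul_eq]
    intro g v h
    have h2 : ((g:ℂˣ):ℂ) • v.1 = v.1 := congrArg Subtype.val h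
    have h3 : (((g:ℂˣ):ℂ) - 1) • v.1 = 0 := by rw [sub_smul, h2]; simp
    rcases smul_eq_zero.1 h3 with h4 | h4
    · apply Subtype.ext; apply Units.ext
      simpa using sub_eq_zero.1 h4
    · exact absurd h4 (Ene v)
  exact pE_quot.isQuotientCoveringMap_of_properlyDiscontinuousSMul pE_iff

def e0 : E := ⟨(0,1,0), by simp [G]⟩
lemma pE_e0 : pE e0 = P := rfl

lemma E_P {v : E} (h : pE v = P) : v.1.1 = 0 ∧ v.1.2.2 = 0 := by
  rw [← pE_e0, pE_iff] at h
  obtain ⟨g, rfl⟩ := h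
  change ((g:ℂˣ):ℂ) * 0 = 0 ∧ ((g:ℂˣ):ℂ) * 0 = 0
  simp

lemma top_of_W (H : Subgroup (FundamentalGroup U P))
    (hH : ∀ X Y Z d d', Free X Y Z d → Free X Y Z d' → W X Y Z d d' ∈ H) : H = ⊤ := by
  rw [eq_top_iff]
  intro g _
  obtain ⟨L, rfl⟩ := Path.Homotopic.Quotient.mk_surjective g
  obtain ⟨Γ, hΓ, -⟩ := pE_cov.isCoveringMap.exists_path_lifts L.toContinuousMap e0 (by
    simp [pE_e0])
  have hΓ' : ∀ t, pE (Γ t) = L t := fun t => congrFun hΓ t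
  have hv : Continuous (fun t => toUT (Γ t)) := by
    apply Continuous.subtype_mk; fun_prop
  have a0 := E_P (v := Γ 0) (by rw [hΓ']; simp)
  have a1 := E_P (v := Γ 1) (by rw [hΓ']; simp)
  refine VK hv a0.1 a0.2 a1.1 a1.2 H Set.univ ?_ ?_ L (fun t => (hΓ' t).symm)
  · intro t
    obtain ⟨d, hd⟩ := exists_free (toUT (Γ t)).2
    exact ⟨d, trivial, hd⟩
  · intro t d _ d' _ h h'
    exact hH _ _ _ _ _ h h'

lemma J1 (w : E) : ∃ g : M6, Joined w (g • e0) := by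
  obtain ⟨d, hd⟩ := exists_free (toUT w).2
  obtain ⟨Γ, hΓ, h0⟩ := pE_cov.isCoveringMap.exists_path_lifts (ray hd).toContinuousMap w (by
    simp; rfl)
  have h1 : pE (Γ 1) = pE e0 := by
    have := congrFun hΓ 1
    change pE (Γ 1) = _ at this
    rw [this, pE_e0]; simp
  obtain ⟨g, hg⟩ := pE_iff.1 h1
  refine ⟨g, ⟨⟨Γ, h0, hg.symm⟩⟩⟩

def ζu : ℂˣ := Units.mk0 (exp (2*Real.pi*I/(6:ℕ))) (exp_ne_zero _)
def ζ6 : M6 := ⟨ζu, by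
  rw [mem_rootsOfUnity']
  change exp (2*Real.pi*I/(6:ℕ)) ^ 6 = 1
  exact (Complex.isPrimitiveRoot_exp 6 (by norm_num)).pow_eq_one⟩

lemma ζ6_gen (g : M6) : ∃ n : ℕ, ζ6 ^ n = g := by
  have hp : IsPrimitiveRoot (exp (2*Real.pi*I/(6:ℕ))) 6 := Complex.isPrimitiveRoot_exp 6 (by norm_num)
  obtain ⟨i, _, hi⟩ := hp.eq_pow_of_pow_eq_one (M6pow g)
  refine ⟨i, ?_⟩
  apply Subtype.ext; apply Units.ext
  rw [← hi]
  rfl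

lemma J2 : ∃ w : E, Joined (ζ6 • w) w := by
  obtain ⟨q, hq⟩ : ∃ q : ℂ, q^2 = -8 := IsAlgClosed.exists_pow_nat_eq _ (by norm_num)
  let m : unitInterval → ℂ := fun t => 1 - (1/8) * exp (2*Real.pi*I*(t:ℝ))
  have hm : Continuous m := by fun_prop
  have hn : ∀ t : unitInterval, ‖exp (2*Real.pi*I*(t:ℝ))‖ = 1 := by
    intro t
    rw [Complex.norm_exp]; simp
  have hre : ∀ t, |(m t).re - 1| ≤ 1/8 ∧ |(m t).im| ≤ 1/8 := by
    intro t
    have e1 := abs_re_le_norm (exp (2*Real.pi*I*(t:ℝ)))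
    have e2 := abs_im_le_norm (exp (2*Real.pi*I*(t:ℝ)))
    rw [hn] at e1 e2
    have h1 : (m t).re = 1 - (1/8) * (exp (2*Real.pi*I*(t:ℝ))).re := by
      simp [m]
    have h2 : (m t).im = - (1/8) * (exp (2*Real.pi*I*(t:ℝ))).im := by
      simp [m]
    rw [h1, h2]
    rw [abs_le] at *
    rw [abs_le]
    constructor <;> constructor <;> linarith
  have hs1 : ∀ t, (8*(m t)^2+1) ∈ slitPlane := by
    intro t
    left
    obtain ⟨h1, h2⟩ := hre t
    rw [abs_le] at h1 h2
    have : (8*(m t)^2+1 : ℂ).re = 8 * ((m t).re^2 - (m t).im^2) + 1 := by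
      simp [pow_two]
    rw [this]; nlinarith
  have hs2 : ∀ t, (1 + m t) ∈ slitPlane := by
    intro t
    left
    obtain ⟨h1, h2⟩ := hre t
    rw [abs_le] at h1 h2
    simp; linarith
  let R : unitInterval → ℂ := fun t => exp (2*Real.pi*I*(t:ℝ)/6) * exp ((2 * log (8*(m t)^2+1) + log (1+m t))/6)
  have hRc : Continuous R := by
    apply Continuous.mul (by fun_prop)
    apply Complex.continuous_exp.comp
    apply Continuous.div_const
    exact (continuous_const.mul (Continuous.clog (by fun_prop) hs1)).add (Continuous.clog (by fun_prop) hs2)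
  have hR0 : ∀ t, R t ≠ 0 := fun t => mul_ne_zero (exp_ne_zero _) (exp_ne_zero _)
  have hR6 : ∀ t, R t ^ 6 = G 0 (q * m t) 1 := by
    intro t
    have e1 : R t ^ 6 = exp (2*Real.pi*I*(t:ℝ)) * ((8*(m t)^2+1)^2 * (1 + m t)) := by
      change (_ * _)^6 = _
      rw [mul_pow, ← Complex.exp_nat_mul, ← Complex.exp_nat_mul]
      congr 1
      · congr 1; push_cast; ring
      · have : (((6:ℕ):ℂ) * ((2 * log (8*(m t)^2+1) + log (1+m t))/6)) = log (8*(m t)^2+1) + log (8*(m t)^2+1) + log (1+m t) := by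
          push_cast; ring
        rw [this, Complex.exp_add, Complex.exp_add, Complex.exp_log (slitPlane_ne_zero (hs1 t)), Complex.exp_log (slitPlane_ne_zero (hs2 t))]
        ring
    have e2 : exp (2*Real.pi*I*(t:ℝ)) = 8 * (1 - m t) := by
      simp only [m]; ring
    rw [e1, e2]
    unfold G
    rw [mul_pow, hq]; ring
  let w : unitInterval → E := fun t => ⟨((R t)⁻¹ * 0, (R t)⁻¹ * (q * m t), (R t)⁻¹ * 1), by
    rw [G_hom, ← hR6, inv_pow, inv_mul_cancel₀ (pow_ne_zero _ (hR0 t))]⟩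
  have hwc : Continuous w := by
    apply Continuous.subtype_mk
    have : Continuous (fun t => (R t)⁻¹) := hRc.inv₀ hR0
    fun_prop
  have hm1 : m 1 = m 0 := by simp [m]
  have hR1 : R 1 = exp (2*Real.pi*I/(6:ℕ)) * R 0 := by
    simp only [R, hm1]; simp
  refine ⟨w 1, ⟨⟨⟨w, hwc⟩, ?_, rfl⟩⟩⟩
  have h0 := hR0 0
  have hz := exp_ne_zero (2*Real.pi*I/(6:ℕ))
  have key : exp (2*Real.pi*I/(6:ℕ)) * (R 1)⁻¹ = (R 0)⁻¹ := by
    rw [hR1, mul_inv, ← mul_assoc, mul_inv_cancel₀ hz, one_mul]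
  apply Subtype.ext
  change ((R 0)⁻¹ * 0, (R 0)⁻¹ * (q * m 0), (R 0)⁻¹ * 1) =
    (exp (2*Real.pi*I/(6:ℕ)) * ((R 1)⁻¹ * 0), exp (2*Real.pi*I/(6:ℕ)) * ((R 1)⁻¹ * (q * m 1)), exp (2*Real.pi*I/(6:ℕ)) * ((R 1)⁻¹ * 1))
  simp only [← mul_assoc, key, hm1]

lemma joined_smul (g : M6) {v w : E} (h : Joined v w) : Joined (g • v) (g • w) := by
  obtain ⟨γ⟩ := h
  exact ⟨γ.map (continuous_const_smul g)⟩

instance : PathConnectedSpace E := by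
  obtain ⟨w0, hw0⟩ := J2
  have h1 : ∀ g : M6, Joined (g • w0) w0 := by
    intro g
    obtain ⟨n, rfl⟩ := ζ6_gen g
    induction n with
    | zero => simpa using Joined.refl w0
    | succ n ih =>
      rw [pow_succ', mul_smul]
      exact (joined_smul ζ6 ih).trans hw0
  obtain ⟨h, hh⟩ := J1 w0
  have h2 : ∀ w, Joined w w0 := by
    intro w
    obtain ⟨g, hg⟩ := J1 w
    have := joined_smul (g * h⁻¹) hh
    rw [mul_smul, mul_smul, inv_smul_smul, ← mul_smul] at this
    exact (hg.trans this.symm).trans (h1 _)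
  exact ⟨⟨w0⟩, fun a b => (h2 a).trans (h2 b).symm⟩

instance : PathConnectedSpace U := pE_surj.pathConnectedSpace pE_cont

lemma conclude (g : FundamentalGroup U P) (hg : Subgroup.zpowers g = ⊤) (h6 : g^6 = 1) :
    Nonempty (FundamentalGroup U P ≃* Multiplicative (ZMod 6)) := by
  have hs := pE_cov.fundamentalGroupToMulOpposite_surjective (x := P) ⟨e0, pE_e0⟩
  have hcard : Nat.card M6ᵐᵒᵖ = 6 := by
    rw [Nat.card_congr MulOpposite.opEquiv.symm]
    exact Complex.card_rootsOfUnity 6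
  have hcy : IsCyclic (FundamentalGroup U P) := ⟨g, fun h => by
    have : h ∈ (⊤ : Subgroup (FundamentalGroup U P)) := trivial
    rwa [← hg] at this⟩
  have hc : Nat.card (FundamentalGroup U P) = orderOf g := by
    rw [← Nat.card_zpowers, hg, Subgroup.card_top]
  have hd : orderOf g ∣ 6 := orderOf_dvd_of_pow_eq_one h6
  have hpos : 0 < orderOf g := Nat.pos_of_dvd_of_pos hd (by norm_num)
  have hfin : Finite (FundamentalGroup U P) := Nat.finite_of_card_ne_zero (by omega)
  have hle := Nat.card_le_card_of_surjective _ hs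
  rw [hcard] at hle
  have hc6 : Nat.card (FundamentalGroup U P) = 6 := by
    have := Nat.le_of_dvd (by norm_num) hd
    omega
  have : Nat.card (Multiplicative (ZMod 6)) = 6 := by simp
  exact ⟨mulEquivOfCyclicCardEq (by rw [hc6, this])⟩

end Oka

namespace Oka
open Complex Topology

def FibOK (H : Subgroup (FundamentalGroup U P)) (X Z : ℂ) : Prop :=
  ∀ Y d d', Free X Y Z d → Free X Y Z d' → W X Y Z d d' ∈ H

lemma FibOK.scale {H : Subgroup (FundamentalGroup U P)} {X Z : ℂ} (h : FibOK H X Z) {k : ℂ}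
    (hk : k ≠ 0) : FibOK H (k*X) (k*Z) := by
  intro Y d d' hd hd'
  have ki := inv_ne_zero hk
  have e1 := hd.scale ki
  have e2 := hd'.scale ki
  have e3 := W_scale ki hd hd'
  rw [inv_mul_cancel_left₀ hk, inv_mul_cancel_left₀ hk] at e1 e2 e3
  rw [← e3]
  exact h _ _ _ e1 e2

lemma W_posd {X Y Z d1 d2 : ℂ} (h1 : Free X Y Z d1) (h2 : Free X Y Z d2) {a b : ℝ} (ha : 0 < a)
    (hb : 0 < b) : W X Y Z (a*d1) (b*d2) = W X Y Z d1 d2 := by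
  have hc : Convex ℝ (Set.Ioi (0:ℝ) ×ˢ Set.Ioi (0:ℝ)) := (convex_Ioi 0).prod (convex_Ioi 0)
  have hj : JoinedIn (Set.Ioi (0:ℝ) ×ˢ Set.Ioi (0:ℝ)) (a,b) (1,1) :=
    JoinedIn.of_segment_subset (hc.segment_subset ⟨ha, hb⟩ (by simp))
  have := W_joined hj (X := fun _ => X) (Y := fun _ => Y) (Z := fun _ => Z)
    (d1 := fun p => (p.1:ℂ) * d1) (d2 := fun p => (p.2:ℂ) * d2) (by fun_prop) (by fun_prop)
    (by fun_prop) (by fun_prop) (by fun_prop) (fun p hp => h1.posd hp.1) (fun p hp => h2.posd hp.2)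
  simpa using this

/-- pairwise different heights -/
def Hts (X Z : ℂ) : Prop := ∀ r r', G X r Z = 0 → G X r' Z = 0 → r.im = r'.im → r = r'

lemma free_line {X Y Z : ℂ} (h : ∀ r, G X r Z = 0 → r.im ≠ Y.im) :
    Free X Y Z 1 ∧ Free X Y Z (-1) := by
  constructor
  · apply free_of one_ne_zero
    intro s _ h0
    apply h _ h0; simp
  · apply free_of (by simp)
    intro s _ h0
    apply h _ h0; simp

lemma line_free {X Y Z : ℂ} (h1 : Free X Y Z 1) (h2 : Free X Y Z (-1)) :
   ∀ r, G X r Z = 0 → r.im ≠ Y.im := by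
  intro r hr him
  rcases le_total Y.re r.re with h | h
  · apply h1.out (r.re - Y.re) (by linarith)
    convert hr using 2
    apply Complex.ext <;> simp [him]
  · apply h2.out (Y.re - r.re) (by linarith)
    convert hr using 2
    apply Complex.ext <;> simp [him]

lemma Hts.free {X Y Z : ℂ} (hh : Hts X Z) (h : G X Y Z ≠ 0) : Free X Y Z 1 ∨ Free X Y Z (-1) := by
  by_contra hc
  push Not at hc
  have h1 : ∃ s : ℝ, 0 ≤ s ∧ G X (Y + s*1) Z = 0 := by
    by_contra h2
    push Not at h2
    exact hc.1 (free_of one_ne_zero h2)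
  have h2 : ∃ s : ℝ, 0 ≤ s ∧ G X (Y + s*(-1)) Z = 0 := by
    by_contra h2
    push Not at h2
    exact hc.2 (free_of (by simp) h2)
  obtain ⟨s, hs, e1⟩ := h1
  obtain ⟨t, ht, e2⟩ := h2
  have := hh _ _ e1 e2 (by simp)
  have h3 := congrArg Complex.re this
  simp at h3
  have : s = 0 := by linarith
  subst this
  apply h; simpa using e1

lemma G_zero_iff {k : ℝ} (hk : 0 < k) (X Y Z : ℂ) :
    G (k*X) Y (k*Z) = 0 ↔ G X ((k:ℂ)⁻¹*Y) Z = 0 := by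
  have hk' : (k:ℂ) ≠ 0 := by exact_mod_cast hk.ne'
  have := G_hom k X ((k:ℂ)⁻¹*Y) Z
  rw [mul_inv_cancel_left₀ hk'] at this
  rw [this]; simp [hk']

lemma Hts.scale {X Z : ℂ} (hh : Hts X Z) {k : ℝ} (hk : 0 ≤ k) : Hts (k*X) (k*Z) := by
  rcases hk.eq_or_lt with rfl | hk
  · intro r r' h h' _
    simp [G] at h h'
    rw [h, h']
  · intro r r' h h' him
    rw [G_zero_iff hk] at h h'
    have hk' : (k:ℂ) ≠ 0 := by exact_mod_cast hk.ne'
    have := hh _ _ h h' (by rw [← ofReal_inv, im_ofReal_mul, im_ofReal_mul, him])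
    exact mul_left_cancel₀ (inv_ne_zero hk') this

lemma fib_of_lines {H : Subgroup (FundamentalGroup U P)} {X Z : ℂ} (hh : Hts X Z)
    (hline : ∀ Y, Free X Y Z (-1) → Free X Y Z 1 → W X Y Z (-1) 1 ∈ H) : FibOK H X Z := by
  -- lines in scaled fibres
  have hl2 : ∀ (k : ℝ) Y, 0 ≤ k → Free (k*X) Y (k*Z) (-1) → Free (k*X) Y (k*Z) 1 →
      W (k*X) Y (k*Z) (-1) 1 ∈ H := by
    intro k Y hk h1 h2
    rcases hk.eq_or_lt with rfl | hk
    · simp only [ofReal_zero, zero_mul] at *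
      rw [W_P h1 h2]; exact H.one_mem
    · have hk' : (k:ℂ) ≠ 0 := by exact_mod_cast hk.ne'
      have ki := inv_ne_zero hk'
      have e1 := h1.scale ki
      have e2 := h2.scale ki
      have e3 := W_scale ki h1 h2
      rw [inv_mul_cancel_left₀ hk', inv_mul_cancel_left₀ hk'] at e1 e2 e3
      have f1 := e1.posd hk
      have f2 := e2.posd hk
      rw [mul_inv_cancel_left₀ hk'] at f1 f2
      have e4 := W_posd e1 e2 hk hk
      rw [mul_inv_cancel_left₀ hk', mul_inv_cancel_left₀ hk'] at e4
      rw [← e3, ← e4]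
      exact hline _ f1 f2
  intro Y d d' h h'
  rw [W_def h h']
  let pT : ∀ {d} (h : Free X Y Z d), Path (⟨(X,Y,Z), h.ne⟩ : UT) (rayT h 1) := fun h =>
    { toFun := rayT h
      continuous_toFun := rayT_cont h
      source' := by simp [rayT]
      target' := rfl }
  let v := (pT h').symm.trans (pT h)
  have hv : ∀ t, ∃ (k : ℝ), 0 ≤ k ∧ (v t).1.1 = k*X ∧ (v t).1.2.2 = k*Z := by
    intro t
    change ∃ (k : ℝ), 0 ≤ k ∧ (((pT h').symm.trans (pT h)) t).1.1 = k*X ∧ (((pT h').symm.trans (pT h)) t).1.2.2 = k*Z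
    rw [Path.trans_apply]
    have aux : ∀ {d} (h : Free X Y Z d) (q : unitInterval), ∃ (k : ℝ), 0 ≤ k ∧ (pT h q).1.1 = k*X ∧
        (pT h q).1.2.2 = k*Z := by
      intro d h q
      refine ⟨1 - (q:ℝ), sub_nonneg.2 q.2.2, ?_, ?_⟩
      · rw [ofReal_sub]; rfl
      · rw [ofReal_sub]; rfl
    split_ifs
    · exact aux h' (unitInterval.symm _)
    · exact aux h _
  apply VK (v := v) v.continuous (H := H) (D := {1, -1})
  · rw [v.source]; simp [rayT]
  · rw [v.source]; simp [rayT]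
  · rw [v.target]; simp [rayT]
  · rw [v.target]; simp [rayT]
  · intro t
    obtain ⟨k, hk, e1, e2⟩ := hv t
    have := (v t).2
    rw [e1, e2] at this ⊢
    rcases (hh.scale hk).free this with h | h
    · exact ⟨1, by simp, h⟩
    · exact ⟨-1, by simp, h⟩
  · intro t a ha b hb fa fb
    obtain ⟨k, hk, e1, e2⟩ := hv t
    rw [e1, e2] at fa fb ⊢
    rcases ha with rfl | ha <;> rcases hb with rfl | hb
    · rw [W_self]; exact H.one_mem
    · rw [Set.mem_singleton_iff] at hb; subst hb
      rw [← W_inv fb fa]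
      exact H.inv_mem (hl2 k _ hk fb fa)
    · rw [Set.mem_singleton_iff] at ha; subst ha
      exact hl2 k _ hk fa fb
    · rw [Set.mem_singleton_iff] at ha hb; subst ha; subst hb
      rw [W_self]; exact H.one_mem
  · intro t
    change (((ray h').symm.trans (ray h)) t) = pr (((pT h').symm.trans (pT h)) t)
    rw [Path.trans_apply, Path.trans_apply]
    split_ifs
    · rfl
    · rfl

/-- generic fibres -/
def Gen (X Z : ℂ) : Prop :=
  3*X^2-2*Z^2 ≠ 0 ∧ (X-Z)^2*(2*X+Z)*Z ≠ 0 ∧ (3*X^2-2*Z^2)^2 - 4*((X-Z)^2*(2*X+Z)*Z) ≠ 0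

def Gd (X r Z : ℂ) : ℂ := 6*r*((r^2-(3*X^2-2*Z^2))^2 - 9*((X-Z)^2*(2*X+Z)*Z))

lemma pp_deriv (X r Z : ℂ) : (Polynomial.derivative (pp X Z)).eval r = Gd X r Z := by
  unfold pp Gd
  generalize 3*X^2-2*Z^2 = a
  generalize (X-Z)^2*(2*X+Z)*Z = b
  simp only [Polynomial.derivative_sub, Polynomial.derivative_pow, Polynomial.derivative_mul, Polynomial.derivative_C, Polynomial.derivative_X, Polynomial.eval_sub, Polynomial.eval_mul, Polynomial.eval_pow, Polynomial.eval_C, Polynomial.eval_X, Polynomial.eval_add, Polynomial.eval_one, Polynomial.eval_zero]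
  push_cast
  ring

lemma Gen.simple {X Z : ℂ} (h : Gen X Z) {r : ℂ} (hr : G X r Z = 0) : Gd X r Z ≠ 0 := by
  intro h0
  obtain ⟨h1, h2, h3⟩ := h
  unfold Gd at h0
  unfold G at hr
  set s := 3*X^2-2*Z^2 with hs
  set e := (X-Z)^2*(2*X+Z)*Z with he
  have hr' : (r^2-s)^3 = 27*e*r^2 := by
    rw [hs, he]; linear_combination hr
  rcases mul_eq_zero.1 h0 with h4 | h4
  · have : r = 0 := by simpa using h4
    subst this
    apply h1
    have : s^3 = 0 := by linear_combination -hr'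
    simpa using this
  · have h5 : e * ((r^2-s) - 3*r^2) = 0 := by
      linear_combination (1/9)*hr' - (1/9)*(r^2-s)*h4
    rcases mul_eq_zero.1 h5 with h6 | h6
    · exact h2 h6
    · apply h3
      have h7 : r^2 = -s/2 := by linear_combination -(1/2)*h6
      rw [h7] at h4
      linear_combination (4/9)*h4

lemma Gen.card {X Z : ℂ} (h : Gen X Z) : (pp X Z).roots.toFinset.card = 6 := by
  have hnd : (pp X Z).roots.Nodup := by
    rw [Multiset.nodup_iff_count_le_one]
    intro a
    rw [Polynomial.count_roots]
    by_contra hc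
    push Not at hc
    rw [Polynomial.one_lt_rootMultiplicity_iff_isRoot (pp_monic X Z).ne_zero] at hc
    have h1 : G X a Z = 0 := by rw [← pp_eval]; exact hc.1
    apply h.simple h1
    rw [← pp_deriv]; exact hc.2
  rw [Multiset.toFinset_card_of_nodup hnd, ← pp_natDegree X Z]
  exact (Polynomial.splits_iff_card_roots.1 (IsAlgClosed.splits (pp X Z)))

lemma mem_roots' {X Z r : ℂ} : r ∈ (pp X Z).roots.toFinset ↔ G X r Z = 0 := by
  rw [Multiset.mem_toFinset, Polynomial.mem_roots (pp_monic X Z).ne_zero, Polynomial.IsRoot,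
    pp_eval]

lemma near_root {X Z y : ℂ} {δ : ℝ} (hδ : 0 < δ) (h : ‖G X y Z‖ < δ^6) :
    ∃ r, G X r Z = 0 ∧ ‖r - y‖ < δ := by
  by_contra hc
  push Not at hc
  have h1 := (IsAlgClosed.splits (pp X Z)).eval_eq_prod_roots y
  rw [pp_eval, (pp_monic X Z).leadingCoeff, one_mul] at h1
  have h2 : δ^6 ≤ ‖((pp X Z).roots.map (fun a => y - a)).prod‖ := by
    have hcard : (pp X Z).roots.card = 6 := by
      rw [← pp_natDegree X Z]
      exact (Polynomial.splits_iff_card_roots.1 (IsAlgClosed.splits (pp X Z)))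
    have aux : ∀ s : Multiset ℂ, (∀ a ∈ s, δ ≤ ‖y - a‖) → δ^s.card ≤ ‖(s.map (fun a => y - a)).prod‖ := by
      intro s
      induction s using Multiset.induction_on with
      | empty => intro _; simp
      | cons a s ih =>
        intro hs
        rw [Multiset.card_cons, Multiset.map_cons, Multiset.prod_cons, norm_mul, pow_succ']
        apply mul_le_mul (hs a (Multiset.mem_cons_self a s)) (ih (fun b hb => hs b (Multiset.mem_cons_of_mem hb))) (by positivity) (by positivity)
    rw [← hcard]
    apply aux
    intro a ha
    rw [norm_sub_rev]
    apply hc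
    rw [← mem_roots']; simpa using ha
  rw [← h1] at h2
  linarith

end Oka

namespace Oka
open Complex Topology

lemma exists_tilt (R : Finset ℂ) : ∃ κ : ℝ, ∀ r ∈ R, ∀ r' ∈ R,
    ((1+κ*I)*r).im = ((1+κ*I)*r').im → r = r' := by
  have hfin : (⋃ p ∈ R.offDiag, {κ : ℝ | ((1+κ*I)*p.1).im = ((1+κ*I)*p.2).im}).Finite := by
    apply Set.Finite.biUnion (Finset.finite_toSet _)
    rintro ⟨r, r'⟩ hp
    rw [Finset.mem_coe, Finset.mem_offDiag] at hp
    apply Set.Subsingleton.finite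
    intro a ha b hb
    simp at ha hb
    by_contra hab
    have h1 : (a - b) * (r.re - r'.re) = 0 := by linarith
    rcases mul_eq_zero.1 h1 with h2 | h2
    · exact hab (sub_eq_zero.1 h2)
    · apply hp.2.2
      have h3 : r.re = r'.re := by linarith
      apply Complex.ext h3
      rw [h3] at ha; linarith
  obtain ⟨κ, hκ⟩ := hfin.exists_notMem
  refine ⟨κ, fun r hr r' hr' h => ?_⟩
  by_contra hne
  apply hκ
  simp only [Set.mem_iUnion]
  exact ⟨(r, r'), Finset.mem_offDiag.2 ⟨hr, hr', hne⟩, h⟩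

lemma line_move {X Y Z Y' : ℂ} (h : ∀ r, G X r Z = 0 → r.im ∉ Set.uIcc Y.im Y'.im) :
    W X Y Z (-1) 1 = W X Y' Z (-1) 1 := by
  have hc : Convex ℝ {y : ℂ | y.im ∈ Set.uIcc Y.im Y'.im} :=
    (convex_uIcc Y.im Y'.im).is_linear_preimage (f := Complex.im) Complex.imLm.isLinear
  have hj := JoinedIn.of_segment_subset (hc.segment_subset (x := Y) (y := Y')
    Set.left_mem_uIcc Set.right_mem_uIcc)
  have hf : ∀ y ∈ {y : ℂ | y.im ∈ Set.uIcc Y.im Y'.im}, Free X y Z 1 ∧ Free X y Z (-1) := by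
    intro y hy
    apply free_line
    intro r hr he
    apply h r hr
    rw [he]; exact hy
  exact W_joined hj (X := fun _ => X) (Y := fun y => y) (Z := fun _ => Z)
    (d1 := fun _ => -1) (d2 := fun _ => 1) (by fun_prop) (by fun_prop) (by fun_prop) (by fun_prop)
    (by fun_prop) (fun a ha => (hf a ha).2) (fun a ha => (hf a ha).1)

lemma Gen.scale {X Z : ℂ} (h : Gen X Z) {k : ℂ} (hk : k ≠ 0) : Gen (k*X) (k*Z) := by
  obtain ⟨h1, h2, h3⟩ := h
  refine ⟨?_, ?_, ?_⟩
  · have : 3*(k*X)^2-2*(k*Z)^2 = k^2*(3*X^2-2*Z^2) := by ring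
    rw [this]; exact mul_ne_zero (pow_ne_zero _ hk) h1
  · have : (k*X-k*Z)^2*(2*(k*X)+k*Z)*(k*Z) = k^4*((X-Z)^2*(2*X+Z)*Z) := by ring
    rw [this]; exact mul_ne_zero (pow_ne_zero _ hk) h2
  · have : (3*(k*X)^2-2*(k*Z)^2)^2 - 4*((k*X-k*Z)^2*(2*(k*X)+k*Z)*(k*Z))
       = k^4*((3*X^2-2*Z^2)^2 - 4*((X-Z)^2*(2*X+Z)*Z)) := by ring
    rw [this]; exact mul_ne_zero (pow_ne_zero _ hk) h3

lemma exists_gap (R : Finset ℂ) (h : ∀ r ∈ R, ∀ r' ∈ R, r.im = r'.im → r = r') :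
    ∃ ε : ℝ, 0 < ε ∧ ∀ r ∈ R, ∀ r' ∈ R, |r.im - r'.im| ≤ 2*ε → r = r' := by
  have h1 : ∀ p ∈ R.offDiag, ∀ᶠ ε in 𝓝[>] (0:ℝ), 2*ε < |p.1.im - p.2.im| := by
    rintro ⟨r, r'⟩ hp
    rw [Finset.mem_offDiag] at hp
    have h2 : 0 < |r.im - r'.im| := by
      rw [abs_pos]; intro h0
      exact hp.2.2 (h _ hp.1 _ hp.2.1 (sub_eq_zero.1 h0))
    apply nhdsWithin_le_nhds
    have : Continuous fun ε : ℝ => 2*ε := by fun_prop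
    apply this.continuousAt.eventually_lt continuousAt_const
    simpa using h2
  have h3 := (Finset.eventually_all _).2 h1
  obtain ⟨ε, h4, h5⟩ := (h3.and self_mem_nhdsWithin).exists
  refine ⟨ε, h5, fun r hr r' hr' hle => ?_⟩
  by_contra hne
  have := h4 (r, r') (Finset.mem_offDiag.2 ⟨hr, hr', hne⟩)
  simp at this; linarith

lemma local_const {H : Subgroup (FundamentalGroup U P)} {k x0 : ℂ} (hg : Gen (k*x0) k)
    (hh : Hts (k*x0) k) : ∃ ρ > 0, ∀ x ∈ Metric.ball x0 ρ, ∀ x' ∈ Metric.ball x0 ρ,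
      FibOK H (k*x) k → FibOK H (k*x') k := by
  set R := (pp (k*x0) k).roots.toFinset with hR
  have hcard : R.card = 6 := hg.card
  obtain ⟨ε, hε, hgap⟩ := exists_gap R (fun r hr r' hr' =>
    hh r r' (mem_roots'.1 hr) (mem_roots'.1 hr'))
  have hnb : ∀ᶠ x in 𝓝 x0, ∀ r ∈ R, ‖G (k*x) r k‖ < ε^6 := by
    rw [Finset.eventually_all]
    intro r hr
    have : Continuous fun x => ‖G (k*x) r k‖ := continuous_norm.comp
      (G_comp (by fun_prop) (by fun_prop) (by fun_prop))
    apply this.continuousAt.eventually_lt continuousAt_const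
    rw [mem_roots'.1 hr]; simp; positivity
  obtain ⟨ρ, hρ, hb⟩ := Metric.eventually_nhds_iff_ball.1 hnb
  have key : ∀ x ∈ Metric.ball x0 ρ, (∀ q, G (k*x) q k = 0 → ∃ r ∈ R, |q.im - r.im| < ε) ∧
      (∀ r ∈ R, ∃ q, G (k*x) q k = 0 ∧ |q.im - r.im| < ε) ∧
      (∀ q q', G (k*x) q k = 0 → G (k*x) q' k = 0 → ∀ r ∈ R, |q.im - r.im| < ε → |q'.im - r.im| < ε
        → q = q') := by
    intro x hx
    have h1 : ∀ r ∈ R, ∃ q, G (k*x) q k = 0 ∧ |q.im - r.im| < ε := by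
      intro r hr
      obtain ⟨q, h1, h2⟩ := near_root hε (hb x hx r hr)
      exact ⟨q, h1, lt_of_le_of_lt (by simpa using Complex.abs_im_le_norm (q - r)) h2⟩
    choose! φ hφ1 hφ2 using h1
    have hinj : Set.InjOn φ R := by
      intro r hr r' hr' he
      apply hgap r hr r' hr'
      have h1 := hφ2 r hr
      have h2 := hφ2 r' hr'
      rw [← he] at h2
      rw [abs_lt] at h1 h2; rw [abs_le]; constructor <;> linarith
    have himg : R.image φ = (pp (k*x) k).roots.toFinset := by
      apply Finset.eq_of_subset_of_card_le
      · intro q hq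
        obtain ⟨r, hr, rfl⟩ := Finset.mem_image.1 hq
        exact mem_roots'.2 (hφ1 r hr)
      · rw [Finset.card_image_of_injOn hinj, hcard]
        refine (Multiset.toFinset_card_le _).trans ?_
        rw [← pp_natDegree (k*x) k]
        exact Polynomial.card_roots' _
    have hsurj : ∀ q, G (k*x) q k = 0 → ∃ r ∈ R, φ r = q := by
      intro q hq
      rw [← mem_roots', ← himg, Finset.mem_image] at hq
      exact hq
    refine ⟨?_, fun r hr => ⟨φ r, hφ1 r hr, hφ2 r hr⟩, ?_⟩
    · intro q hq
      obtain ⟨r, hr, rfl⟩ := hsurj q hq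
      exact ⟨r, hr, hφ2 r hr⟩
    · intro q q' hq hq' r hr h1 h2
      obtain ⟨r1, hr1, rfl⟩ := hsurj q hq
      obtain ⟨r2, hr2, rfl⟩ := hsurj q' hq'
      have h3 := hφ2 r1 hr1
      have h4 := hφ2 r2 hr2
      congr 1
      rw [abs_lt] at h1 h2 h3 h4
      have e1 : r1 = r := by
        apply hgap _ hr1 _ hr; rw [abs_le]; constructor <;> linarith
      have e2 : r2 = r := by
        apply hgap _ hr2 _ hr; rw [abs_le]; constructor <;> linarith
      rw [e1, e2]
  refine ⟨ρ, hρ, fun x hx x' hx' hF => ?_⟩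
  obtain ⟨k1, k2, k3⟩ := key x' hx'
  -- lines far from R
  have far : ∀ Y : ℂ, (∀ r ∈ R, ε ≤ |Y.im - r.im|) → W (k*x') Y k (-1) 1 ∈ H := by
    intro Y hY
    have hf : ∀ z ∈ Metric.ball x0 ρ, Free (k*z) Y k 1 ∧ Free (k*z) Y k (-1) := by
      intro z hz
      apply free_line
      intro q hq he
      obtain ⟨r, hr, h1⟩ := (key z hz).1 q hq
      rw [he] at h1
      exact absurd h1 (not_lt.2 (hY r hr))
    have hj := JoinedIn.of_segment_subset ((convex_ball x0 ρ).segment_subset hx hx')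
    have := W_joined hj (X := fun z => k*z) (Y := fun _ => Y) (Z := fun _ => k)
      (d1 := fun _ => -1) (d2 := fun _ => 1) (by fun_prop) (by fun_prop) (by fun_prop) (by fun_prop)
      (by fun_prop) (fun a ha => (hf a ha).2) (fun a ha => (hf a ha).1)
    rw [← this]
    exact hF _ _ _ (hf x hx).2 (hf x hx).1
  apply fib_of_lines
  · intro q q' hq hq' he
    obtain ⟨r, hr, h1⟩ := k1 q hq
    exact k3 q q' hq hq' r hr h1 (by rw [← he]; exact h1)
  · intro Y f1 f2
    have hl := line_free f2 f1
    by_cases hY : ∀ r ∈ R, ε ≤ |Y.im - r.im|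
    · exact far Y hY
    · push Not at hY
      obtain ⟨r, hr, hYr⟩ := hY
      obtain ⟨q, hq, hqr⟩ := k2 r hr
      have gapr : ∀ r' ∈ R, r' ≠ r → 2*ε < |r'.im - r.im| := by
        intro r' hr' hne
        by_contra hc
        exact hne (hgap _ hr' _ hr (not_lt.1 hc))
      have hmove : ∀ b : ℝ, |b - r.im| = ε → (q.im ∉ Set.uIcc Y.im b) → W (k*x') Y k (-1) 1 ∈ H := by
        intro b hb hqb
        have e1 : (Y + ((b - Y.im : ℝ):ℂ)*I).im = b := by simp
        rw [line_move (Y' := Y + ((b - Y.im : ℝ):ℂ)*I)]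
        · apply far
          intro r' hr'
          rw [e1]
          by_cases h : r' = r
          · rw [h, hb]
          · have h1 := gapr r' hr' h
            have h2 := abs_sub_le r'.im b r.im
            rw [hb, abs_sub_comm r'.im b] at h2
            linarith
        · intro q' hq' hmem
          rw [e1] at hmem
          have hle : |q'.im - r.im| ≤ ε := by
            rw [abs_lt] at hYr
            have hb' := abs_le.1 hb.le
            rw [Set.mem_uIcc] at hmem
            rw [abs_le]
            rcases hmem with h | h <;> constructor <;> linarith [h.1, h.2, hb'.1, hb'.2]
          obtain ⟨r', hr', h1⟩ := k1 q' hq'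
          by_cases h : r' = r
          · subst h
            have := k3 q' q hq' hq r' hr' h1 hqr
            rw [this] at hmem
            exact hqb hmem
          · have h3 := gapr r' hr' h
            have h2 := abs_sub_le r'.im q'.im r.im
            rw [abs_sub_comm r'.im q'.im] at h2
            linarith
      have hne := hl q hq
      rw [abs_lt] at hYr
      rcases lt_or_gt_of_ne hne with h | h
      · apply hmove (r.im + ε) (by simp [abs_of_pos hε])
        rw [Set.uIcc_of_le (by linarith)]
        intro h2; linarith [h2.1]
      · apply hmove (r.im - ε) (by simp [abs_of_pos hε])
        rw [Set.uIcc_of_ge (by linarith)]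
        intro h2; linarith [h2.2]

lemma local_const1 {H : Subgroup (FundamentalGroup U P)} {x0 : ℂ} (hg : Gen x0 1) :
    ∃ ρ > 0, ∀ x ∈ Metric.ball x0 ρ, ∀ x' ∈ Metric.ball x0 ρ, FibOK H x 1 → FibOK H x' 1 := by
  obtain ⟨κ, hκ⟩ := exists_tilt (pp x0 1).roots.toFinset
  set k : ℂ := 1 + κ*I with hk
  have hk0 : k ≠ 0 := by
    intro h
    have := congrArg Complex.re h
    simp [hk] at this
  have h1 : Gen (k*x0) k := by have := hg.scale hk0; rwa [mul_one] at this
  have hG : ∀ r, G (k*x0) r k = 0 → G x0 (k⁻¹*r) 1 = 0 := by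
    intro r hr
    have := G_hom k x0 (k⁻¹*r) 1
    rw [mul_inv_cancel_left₀ hk0, mul_one, hr] at this
    have := this.symm
    simpa [hk0] using this
  have h2 : Hts (k*x0) k := by
    intro r r' hr hr' he
    have := hκ _ (mem_roots'.2 (hG r hr)) _ (mem_roots'.2 (hG r' hr'))
      (by rw [mul_inv_cancel_left₀ hk0, mul_inv_cancel_left₀ hk0, he])
    exact mul_left_cancel₀ (inv_ne_zero hk0) this
  obtain ⟨ρ, hρ, h3⟩ := local_const (H := H) h1 h2
  refine ⟨ρ, hρ, fun x hx x' hx' hF => ?_⟩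
  have h4 := hF.scale hk0
  rw [mul_one] at h4
  have h5 := (h3 x hx x' hx' h4).scale (inv_ne_zero hk0)
  rwa [inv_mul_cancel_left₀ hk0, inv_mul_cancel₀ hk0] at h5

lemma gen_conn : IsPreconnected {x : ℂ | Gen x 1} := by
  have hfin : {x : ℂ | ¬ Gen x 1}.Finite := by
    apply Set.Finite.subset (((Polynomial.nthRoots 2 (2/3 : ℂ)).toFinset ∪ {1, -1/2, 0, 8/9} : Finset ℂ).finite_toSet)
    intro x hx
    simp only [Finset.coe_union, Set.mem_union, Finset.mem_coe, Multiset.mem_toFinset,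
      Polynomial.mem_nthRoots zero_lt_two, Finset.mem_insert, Finset.mem_singleton]
    by_contra hc
    push Not at hc
    obtain ⟨c1, c2, c3, c4, c5⟩ := hc
    apply hx
    refine ⟨?_, ?_, ?_⟩
    · intro h; apply c1; linear_combination (1/3)*h
    · refine mul_ne_zero (mul_ne_zero (pow_ne_zero _ (sub_ne_zero.2 c2)) ?_) one_ne_zero
      intro h; apply c3; linear_combination (1/2)*h
    · have : (3*x^2-2*1^2)^2 - 4*((x-1)^2*(2*x+1)*1) = x^3*(9*x-8) := by ring
      rw [this]
      refine mul_ne_zero (pow_ne_zero _ c4) ?_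
      intro h; apply c5; linear_combination (1/9)*h
  have := (hfin.countable.isPathConnected_compl_of_one_lt_rank (by simp)).isConnected.isPreconnected
  convert this using 1
  ext x; simp

lemma fib_all {H : Subgroup (FundamentalGroup U P)} {x0 x1 : ℂ} (h0 : Gen x0 1) (hF : FibOK H x0 1)
    (h1 : Gen x1 1) : FibOK H x1 1 := by
  set u := ⋃ (x : ℂ) (ρ : ℝ) (_ : ∀ y ∈ Metric.ball x ρ, FibOK H y 1), Metric.ball x ρ with hu
  set v := ⋃ (x : ℂ) (ρ : ℝ) (_ : ∀ y ∈ Metric.ball x ρ, ¬ FibOK H y 1), Metric.ball x ρ with hv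
  have hmu : ∀ y ∈ u, FibOK H y 1 := by
    intro y hy
    simp only [hu, Set.mem_iUnion] at hy
    obtain ⟨a, b, h, h'⟩ := hy
    exact h y h'
  have hmv : ∀ y ∈ v, ¬ FibOK H y 1 := by
    intro y hy
    simp only [hv, Set.mem_iUnion] at hy
    obtain ⟨a, b, h, h'⟩ := hy
    exact h y h'
  have hin : ∀ x, Gen x 1 → (FibOK H x 1 → x ∈ u) ∧ (¬ FibOK H x 1 → x ∈ v) := by
    intro x hx
    obtain ⟨ρ, hρ, h⟩ := local_const1 (H := H) hx
    have hs := Metric.mem_ball_self (x := x) hρ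
    constructor
    · intro hf
      simp only [hu, Set.mem_iUnion]
      exact ⟨x, ρ, fun y hy => h x hs y hy hf, hs⟩
    · intro hf
      simp only [hv, Set.mem_iUnion]
      exact ⟨x, ρ, fun y hy hfy => hf (h y hy x hs hfy), hs⟩
  apply hmu
  refine gen_conn.subset_left_of_subset_union (u := u) (v := v) ?_ ?_ ?_ ?_ ?_ h1
  · exact isOpen_iUnion fun _ => isOpen_iUnion fun _ => isOpen_iUnion fun _ => Metric.isOpen_ball
  · exact isOpen_iUnion fun _ => isOpen_iUnion fun _ => isOpen_iUnion fun _ => Metric.isOpen_ball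
  · rw [Set.disjoint_left]; intro y hy hy'; exact hmv y hy' (hmu y hy)
  · intro y hy
    by_cases hf : FibOK H y 1
    · exact Or.inl ((hin y hy).1 hf)
    · exact Or.inr ((hin y hy).2 hf)
  · exact ⟨x0, h0, (hin x0 h0).1 hF⟩

lemma top_of_fib {H : Subgroup (FundamentalGroup U P)} {X0 Z0 : ℂ} (h0 : Gen X0 Z0)
    (hF : FibOK H X0 Z0) : H = ⊤ := by
  have norm : ∀ X Z, Gen X Z → Z ≠ 0 := by
    rintro X Z h rfl
    apply h.2.1; simp
  have hz0 := norm _ _ h0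
  have g1 : Gen (Z0⁻¹*X0) 1 := by
    have := h0.scale (inv_ne_zero hz0); rwa [inv_mul_cancel₀ hz0] at this
  have f1 : FibOK H (Z0⁻¹*X0) 1 := by
    have := hF.scale (inv_ne_zero hz0); rwa [inv_mul_cancel₀ hz0] at this
  have hall : ∀ X Z, Gen X Z → FibOK H X Z := by
    intro X Z h
    have hz := norm _ _ h
    have g2 : Gen (Z⁻¹*X) 1 := by
      have := h.scale (inv_ne_zero hz); rwa [inv_mul_cancel₀ hz] at this
    have := (fib_all g1 f1 g2).scale hz
    rwa [mul_inv_cancel_left₀ hz, mul_one] at this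
  apply top_of_W
  intro X Y Z d d' h h'
  have c1 : Continuous fun t : ℂ => X + t*(2-X) := by fun_prop
  have c2 : Continuous fun t : ℂ => Z + t*(1-Z) := by fun_prop
  have o1 := isOpen_free c1 (continuous_const (y := Y)) c2 (continuous_const (y := d))
  have o2 := isOpen_free c1 (continuous_const (y := Y)) c2 (continuous_const (y := d'))
  have hm : ∀ᶠ t : ℂ in 𝓝 0, Free (X + t*(2-X)) Y (Z + t*(1-Z)) d ∧ Free (X + t*(2-X)) Y (Z + t*(1-Z)) d' :=
    (o1.inter o2).mem_nhds (by simpa using ⟨h, h'⟩)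
  obtain ⟨ρ, hρ, hb⟩ := Metric.eventually_nhds_iff_ball.1 hm
  let q : ℂ → ℂ → ℂ := fun X Z => (3*X^2-2*Z^2) * ((X-Z)^2*(2*X+Z)*Z) * ((3*X^2-2*Z^2)^2 - 4*((X-Z)^2*(2*X+Z)*Z))
  let f : ℂ → ℂ := fun t => q (X + t*(2-X)) (Z + t*(1-Z))
  have hd : Differentiable ℂ f := by unfold f q; fun_prop
  have han : AnalyticOnNhd ℂ f Set.univ := fun z _ => hd.analyticAt z
  have hne : ∀ᶠ t in 𝓝[≠] (0:ℂ), f t ≠ 0 := by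
    rcases (han 0 trivial).eventually_eq_zero_or_eventually_ne_zero with h1 | h1
    · have := han.eqOn_zero_of_preconnected_of_eventuallyEq_zero isPreconnected_univ (Set.mem_univ 0) h1
      have := this (Set.mem_univ 1)
      simp [f, q] at this
      norm_num at this
    · exact h1
  have hm2 : ∀ᶠ t in 𝓝[≠] (0:ℂ), t ∈ Metric.ball (0:ℂ) ρ :=
    nhdsWithin_le_nhds (Metric.ball_mem_nhds _ hρ)
  obtain ⟨t, ht1, ht2⟩ := (hne.and hm2).exists
  have hj := JoinedIn.of_segment_subset ((convex_ball (0:ℂ) ρ).segment_subset (Metric.mem_ball_self hρ) ht2)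
  have hw := W_joined hj (X := fun t => X + t*(2-X)) (Y := fun _ => Y) (Z := fun t => Z + t*(1-Z))
      (d1 := fun _ => d) (d2 := fun _ => d') (by fun_prop) (by fun_prop) (by fun_prop) (by fun_prop)
      (by fun_prop) (fun a ha => (hb a ha).1) (fun a ha => (hb a ha).2)
  simp only [zero_mul, add_zero] at hw
  rw [hw]
  refine hall _ _ ?_ _ _ _ (hb t ht2).1 (hb t ht2).2
  have h3 := mul_ne_zero_iff.1 ht1
  have h4 := mul_ne_zero_iff.1 h3.1
  exact ⟨h4.1, h4.2, h3.2⟩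

end Oka

namespace Oka
open Complex Topology

def Dh (X Z r τ Y : ℂ) : ℂ :=
  (Y+τ*r)*((Y^2-(3*X^2-2*Z^2)*τ^2)^2+(Y^2-(3*X^2-2*Z^2)*τ^2)*(τ^2*(r^2-(3*X^2-2*Z^2)))
    + (τ^2*(r^2-(3*X^2-2*Z^2)))^2 - 27*((X-Z)^2*(2*X+Z)*Z)*τ^4)

lemma G_Dh (X Z r τ Y : ℂ) : G (τ*X) Y (τ*Z) = (Y - τ*r)*Dh X Z r τ Y + τ^6 * G X r Z := by
  unfold G Dh; ring

def Valid (X Z r θ : ℂ) : Prop :=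
  θ ≠ 0 ∧ G X r Z = 0 ∧ Gd X r Z ≠ 0 ∧ ∀ t : ℝ, 0 < t → G X (r + t*θ) Z ≠ 0

lemma Valid.dh {X Z r θ : ℂ} (h : Valid X Z r θ) (t : unitInterval) :
    Dh X Z r (1-((t:ℝ):ℂ)) ((1-((t:ℝ):ℂ))*r + ((t:ℝ):ℂ)*θ) ≠ 0 := by
  obtain ⟨h1, h2, h3, h4⟩ := h
  have ht0 := t.2.1
  have ht1 := t.2.2
  generalize (t:ℝ) = t at *
  rcases ht0.eq_or_lt with rfl | ht0
  · convert h3 using 1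
    unfold Dh Gd; push_cast; ring
  rcases ht1.eq_or_lt with rfl | ht1
  · convert pow_ne_zero 5 h1 using 1
    unfold Dh; push_cast; ring
  have ht' : (1 - (t:ℂ)) ≠ 0 := by
    have : (1 - t) ≠ 0 := by linarith
    exact_mod_cast this
  intro h0
  have h5 := h4 (t/(1-t)) (div_pos ht0 (by linarith))
  apply h5
  have h6 := G_Dh X Z r (1-(t:ℂ)) ((1-(t:ℂ))*r + t*θ)
  rw [h0, h2] at h6
  have h7 := G_hom (1-(t:ℂ)) X (r + ((t/(1-t) : ℝ):ℂ)*θ) Z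
  have e : (1-(t:ℂ)) * (r + ((t/(1-t) : ℝ):ℂ)*θ) = (1-(t:ℂ))*r + t*θ := by
    push_cast; field_simp
  rw [e, h6] at h7
  have h8 := h7.symm
  simpa [ht'] using h8

def IsLasso (X Z r θ : ℂ) (g : FundamentalGroup U P) : Prop :=
  ∃ η1 : ℝ, 0 < η1 ∧ ∀ η : ℝ, 0 < η → η ≤ η1 →
    Free X (r-η*θ) Z (θ*(1+η*I)) ∧ Free X (r-η*θ) Z (θ*(1-η*I)) ∧
      W X (r-η*θ) Z (θ*(1+η*I)) (θ*(1-η*I)) = g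

lemma lasso_unif0 {X Z r θ : unitInterval → ℂ} (hX : Continuous X) (hZ : Continuous Z)
    (hr : Continuous r) (hθ : Continuous θ) (hv : ∀ k, Valid (X k) (Z k) (r k) (θ k)) (ε : ℝ)
    (hε : ε ≠ 0) : ∀ᶠ η : ℝ in 𝓝[>] 0, ∀ k, Free (X k) (r k - η*θ k) (Z k) (θ k*(1+ε*η*I)) := by
  let f : ℝ × unitInterval × unitInterval → ℂ := fun p =>
    Dh (X p.2.1) (Z p.2.1) (r p.2.1) (1-((p.2.2:ℝ):ℂ))
      ((1-((p.2.2:ℝ):ℂ))*(r p.2.1 - p.1*θ p.2.1) + ((p.2.2:ℝ):ℂ)*(θ p.2.1*(1+ε*p.1*I)))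
  have hf : Continuous f := by
    unfold f Dh; fun_prop
  have hcl : IsClosed (f ⁻¹' {0}) := isClosed_singleton.preimage hf
  have hcl2 := isClosedMap_fst_of_compactSpace _ hcl
  have h0 : (0:ℝ) ∉ Prod.fst '' (f ⁻¹' {0}) := by
    rintro ⟨⟨η, k, t⟩, h1, h2⟩
    simp only at h2
    subst h2
    apply (hv k).dh t
    simpa [f] using h1
  have h1 : ∀ᶠ η : ℝ in 𝓝[>] 0, η ∉ Prod.fst '' (f ⁻¹' {0}) :=
    nhdsWithin_le_nhds (hcl2.isOpen_compl.mem_nhds h0)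
  filter_upwards [h1, self_mem_nhdsWithin] with η hη hpos k t
  have hpos : 0 < η := hpos
  rw [G_Dh _ _ (r k), (hv k).2.1, mul_zero, add_zero]
  apply mul_ne_zero
  · have e : (1-((t:ℝ):ℂ))*(r k - η*θ k) + ((t:ℝ):ℂ)*(θ k*(1+ε*η*I)) - (1-((t:ℝ):ℂ))*r k
      = θ k * ((((t:ℝ) - (1-t)*η : ℝ):ℂ) + ((t*ε*η : ℝ):ℂ)*I) := by push_cast; ring
    rw [e]
    apply mul_ne_zero (hv k).1
    intro h0
    have h2 := congrArg Complex.im h0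
    have h3 := congrArg Complex.re h0
    simp at h2 h3
    rcases h2 with h2 | h2
    · rcases h2 with h2 | h2
      · rw [h2] at h3; simp at h3; linarith
      · exact hε h2
    · linarith
  · intro h0
    apply hη
    exact ⟨(η, k, t), h0, rfl⟩

lemma lasso_unif {X Z r θ : unitInterval → ℂ} (hX : Continuous X) (hZ : Continuous Z)
    (hr : Continuous r) (hθ : Continuous θ) (hv : ∀ k, Valid (X k) (Z k) (r k) (θ k)) :
    ∃ η1 : ℝ, 0 < η1 ∧ ∀ η : ℝ, 0 < η → η ≤ η1 → ∀ k,
    Free (X k) (r k - η*θ k) (Z k) (θ k*(1+η*I)) ∧ Free (X k) (r k - η*θ k) (Z k) (θ k*(1-η*I)) := by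
  have h1 := lasso_unif0 hX hZ hr hθ hv 1 (by norm_num)
  have h2 := lasso_unif0 hX hZ hr hθ hv (-1) (by norm_num)
  obtain ⟨u, hu, h3⟩ := mem_nhdsGT_iff_exists_Ioc_subset.1 (h1.and h2)
  refine ⟨u, hu, fun η h h' k => ?_⟩
  have h4 := h3 ⟨h, h'⟩
  refine ⟨?_, ?_⟩
  · convert h4.1 k using 2; push_cast; ring
  · convert h4.2 k using 2; push_cast; ring

lemma Valid.exists {X Z r θ : ℂ} (h : Valid X Z r θ) : ∃ g, IsLasso X Z r θ g := by
  obtain ⟨η1, h1, h2⟩ := lasso_unif (X := fun _ => X) (Z := fun _ => Z) (r := fun _ => r)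
    (θ := fun _ => θ) continuous_const continuous_const continuous_const continuous_const (fun _ => h)
  refine ⟨W X (r-η1*θ) Z (θ*(1+η1*I)) (θ*(1-η1*I)), η1, h1, fun η h3 h4 => ?_⟩
  refine ⟨(h2 η h3 h4 0).1, (h2 η h3 h4 0).2, ?_⟩
  have hj : JoinedIn (Set.Ioc 0 η1) η η1 :=
    JoinedIn.of_segment_subset ((convex_Ioc 0 η1).segment_subset ⟨h3, h4⟩ ⟨h1, le_rfl⟩)
  exact W_joined hj (X := fun _ => X) (Y := fun η => r-η*θ) (Z := fun _ => Z)
    (d1 := fun η => θ*(1+η*I)) (d2 := fun η => θ*(1-η*I)) (by fun_prop) (by fun_prop) (by fun_prop)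
    (by fun_prop) (by fun_prop) (fun a ha => (h2 a ha.1 ha.2 0).1) (fun a ha => (h2 a ha.1 ha.2 0).2)

lemma IsLasso.unique {X Z r θ : ℂ} {g g'} (h : IsLasso X Z r θ g) (h' : IsLasso X Z r θ g') :
    g = g' := by
  obtain ⟨η1, h1, h2⟩ := h
  obtain ⟨η2, h3, h4⟩ := h'
  rw [← (h2 (min η1 η2) (lt_min h1 h3) (min_le_left _ _)).2.2]
  exact (h4 (min η1 η2) (lt_min h1 h3) (min_le_right _ _)).2.2

lemma IsLasso.scale {X Z r θ : ℂ} {g} (h : IsLasso X Z r θ g) {k : ℂ} (hk : k ≠ 0) :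
    IsLasso (k*X) (k*Z) (k*r) (k*θ) g := by
  obtain ⟨η1, h1, h2⟩ := h
  refine ⟨η1, h1, fun η h3 h4 => ?_⟩
  obtain ⟨h5, h6, h7⟩ := h2 η h3 h4
  have e1 : k*r - η*(k*θ) = k*(r - η*θ) := by ring
  rw [e1, mul_assoc, mul_assoc]
  refine ⟨h5.scale hk, h6.scale hk, ?_⟩
  rw [W_scale hk h5 h6, h7]

lemma IsLasso.joined {α : Type*} [TopologicalSpace α] {S : Set α} {a b : α} (hab : JoinedIn S a b)
    {X Z r θ : α → ℂ} (hX : ContinuousOn X S) (hZ : ContinuousOn Z S) (hr : ContinuousOn r S)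
    (hθ : ContinuousOn θ S) (hv : ∀ a ∈ S, Valid (X a) (Z a) (r a) (θ a)) {g}
    (h : IsLasso (X a) (Z a) (r a) (θ a) g) : IsLasso (X b) (Z b) (r b) (θ b) g := by
  obtain ⟨γ, hγ⟩ := hab
  have key : ∀ {f : α → ℂ}, ContinuousOn f S → Continuous (fun t => f (γ t)) := fun hf =>
    hf.comp_continuous γ.continuous hγ
  obtain ⟨η1, h1, h2⟩ := lasso_unif (key hX) (key hZ) (key hr) (key hθ) (fun k => hv _ (hγ k))
  obtain ⟨η2, h3, h4⟩ := h
  refine ⟨min η1 η2, lt_min h1 h3, fun η h5 h6 => ?_⟩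
  have h7 := h2 η h5 (h6.trans (min_le_left _ _))
  have h8 := (h4 η h5 (h6.trans (min_le_right _ _))).2.2
  have c1 := key hr
  have c2 := key hθ
  have := W_fam (Y := fun k => r (γ k) - η*θ (γ k)) (d1 := fun k => θ (γ k)*(1+η*I))
    (d2 := fun k => θ (γ k)*(1-η*I)) (key hX) (c1.sub (continuous_const.mul c2)) (key hZ)
    (c2.mul continuous_const) (c2.mul continuous_const) (fun k => (h7 k).1) (fun k => (h7 k).2)
  simp only [γ.source, γ.target] at this
  have h9 := h7 1
  rw [γ.target] at h9
  exact ⟨h9.1, h9.2, by rw [← this]; exact h8⟩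

lemma cross_half {X Z r : ℂ} {ε b : ℝ} (hε : ε = 1 ∨ ε = -1) (hb : 0 < b)
    (hroot : ∀ r', G X r' Z = 0 → 0 ≤ ε*(r'.im - r.im) → ε*(r'.im - r.im) ≤ b → r' = r) :
    ∀ᶠ η : ℝ in 𝓝[>] 0, Free X (r-η) Z (-1) ∧ Free X (r-η) Z (1+ε*η*I) ∧
      W X (r-η) Z (-1) (1+ε*η*I) = W X (r-η+ε*b*I) Z (-1) 1 := by
  have hε2 : ε*ε = 1 := by rcases hε with rfl | rfl <;> norm_num
  have hsm : ∀ r' ∈ (pp X Z).roots.toFinset, ∀ᶠ η : ℝ in 𝓝[>] 0,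
      b < ε*(r'.im - r.im) → η*(r'.re - r.re + η) < ε*(r'.im - r.im) - b := by
    intro r' _
    by_cases h : b < ε*(r'.im - r.im)
    · apply nhdsWithin_le_nhds
      have hc : Continuous fun η : ℝ => η*(r'.re - r.re + η) := by fun_prop
      have := hc.continuousAt.eventually_lt (x₀ := 0) (continuousAt_const (y := ε*(r'.im - r.im) - b))
        (by simp; linarith)
      filter_upwards [this] with η h _ using h
    · filter_upwards with η h' using absurd h' h
  have hsm := (Finset.eventually_all _).2 hsm
  filter_upwards [hsm, self_mem_nhdsWithin] with η hη hpos
  have hpos : 0 < η := hpos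
  have key : ∀ k ∈ Set.Icc (0:ℝ) 1, Free X (r-η+ε*(k*b)*I) Z (-1) ∧
      Free X (r-η+ε*(k*b)*I) Z (1+ε*((1-k)*η)*I) := by
    intro k hk
    have hkb : 0 ≤ k*b := mul_nonneg hk.1 hb.le
    have hkb' : k*b ≤ b := by nlinarith [hk.2]
    constructor
    · apply free_of (by simp)
      intro s hs h0
      have h1 := hroot _ h0 (by
        simp
        have : ε*(ε*(k*b)) = k*b := by linear_combination (k*b)*hε2
        linarith) (by 
        simp
        have : ε*(ε*(k*b)) = k*b := by linear_combination (k*b)*hε2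
        linarith)
      have := congrArg Complex.re h1
      simp at this
      linarith
    · apply free_of (by
        intro h0
        have := congrArg Complex.re h0
        simp at this)
      intro s hs h0
      set r' := r-η+ε*(k*b)*I + s*(1+ε*((1-k)*η)*I) with hr'
      have hre : r'.re = r.re - η + s := by simp [hr']
      have him : ε*(r'.im - r.im) = k*b + s*((1-k)*η) := by
        simp [hr']
        linear_combination (k*b + s*((1-k)*η))*hε2
      have hnn : 0 ≤ s*((1-k)*η) := mul_nonneg hs (mul_nonneg (by linarith [hk.2]) hpos.le)
      by_cases hle : ε*(r'.im - r.im) ≤ b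
      · have h1 := hroot _ h0 (by rw [him]; linarith) hle
        rw [h1] at hre him
        have hs' : s = η := by linarith
        subst hs'
        have e0 : k*b + s*((1-k)*s) = 0 := by rw [← him]; ring
        have e1 : k*b = 0 := by linarith
        have e2 : k = 0 := by rcases mul_eq_zero.1 e1 with h | h; exact h; linarith
        subst e2
        nlinarith
      · push Not at hle
        have h2 := hη r' (mem_roots'.2 h0) hle
        rw [him, hre] at h2
        nlinarith [mul_nonneg (mul_nonneg hs hpos.le) hk.1]
  have hj : JoinedIn (Set.Icc (0:ℝ) 1) 0 1 :=
    JoinedIn.of_segment_subset ((convex_Icc 0 1).segment_subset (by simp) (by simp))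
  have hw := W_joined hj (X := fun _ => X) (Y := fun k => r-η+ε*(k*b)*I) (Z := fun _ => Z)
    (d1 := fun _ => -1) (d2 := fun k => 1+ε*((1-k)*η)*I) (by fun_prop) (by fun_prop) (by fun_prop)
    (by fun_prop) (by fun_prop) (fun a ha => (key a ha).1) (fun a ha => (key a ha).2)
  have k0 := key 0 (by simp)
  simp at k0 hw
  exact ⟨k0.1, by simpa [mul_assoc] using k0.2, by simpa [mul_assoc] using hw⟩

lemma cross_right {X Z r Y1 Y2 : ℂ} {g} (hl : IsLasso X Z r 1 g) (h1 : Y1.im < r.im)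
    (h2 : r.im < Y2.im) (hroot : ∀ r', G X r' Z = 0 → Y1.im ≤ r'.im → r'.im ≤ Y2.im → r' = r) :
    W X Y1 Z (-1) 1 = W X Y2 Z (-1) 1 * g := by
  obtain ⟨η1, hη1, hl⟩ := hl
  have e1 := cross_half (X := X) (Z := Z) (r := r) (ε := 1) (b := Y2.im - r.im) (Or.inl rfl) (by linarith)
    (fun r' h h' h'' => hroot r' h (by linarith) (by linarith))
  have e2 := cross_half (X := X) (Z := Z) (r := r) (ε := -1) (b := r.im - Y1.im) (Or.inr rfl) (by linarith)
    (fun r' h h' h'' => hroot r' h (by linarith) (by linarith))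
  have e3 : ∀ᶠ η : ℝ in 𝓝[>] 0, η ≤ η1 := nhdsWithin_le_nhds (eventually_le_nhds hη1)
  obtain ⟨η, ⟨a1, a2, a3⟩, ⟨b1, b2, b3⟩, h3, h4⟩ := (e1.and (e2.and (e3.and self_mem_nhdsWithin))).exists
  obtain ⟨_, _, h5⟩ := hl η h4 h3
  have c1 : W X Y2 Z (-1) 1 = W X (r - η + ((1:ℝ):ℂ)*(Y2.im-r.im : ℝ)*I) Z (-1) 1 := by
    apply line_move
    intro r' hr' hm
    have : (r - η + ((1:ℝ):ℂ)*(Y2.im-r.im : ℝ)*I).im = Y2.im := by simp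
    rw [this, Set.uIcc_self, Set.mem_singleton_iff] at hm
    have := hroot r' hr' (by linarith) (by linarith)
    rw [this] at hm; linarith
  have c2 : W X Y1 Z (-1) 1 = W X (r - η + ((-1:ℝ):ℂ)*(r.im-Y1.im : ℝ)*I) Z (-1) 1 := by
    apply line_move
    intro r' hr' hm
    have : (r - η + ((-1:ℝ):ℂ)*(r.im-Y1.im : ℝ)*I).im = Y1.im := by simp
    rw [this, Set.uIcc_self, Set.mem_singleton_iff] at hm
    have := hroot r' hr' (by linarith) (by linarith)
    rw [this] at hm; linarith
  rw [c1, c2, ← a3, ← b3, ← h5, mul_one]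
  have d1 : (1:ℂ) * (1+η*I) = 1 + ((1:ℝ):ℂ)*η*I := by push_cast; ring
  have d2 : (1:ℂ) * (1-η*I) = 1 + ((-1:ℝ):ℂ)*η*I := by push_cast; ring
  rw [d1, d2, W_mul a1 a2 b2]

lemma G_neg (X Y Z : ℂ) : G (-X) Y (-Z) = G X (-Y) Z := by unfold G; ring

lemma grp_aux {A : Type*} [Group A] {a b g : A} (h : b⁻¹ = a⁻¹ * g) : a = g * b := by
  rw [← inv_inv b, h]; simp

lemma cross_left {X Z r Y1 Y2 : ℂ} {g} (hl : IsLasso X Z r (-1) g) (h1 : Y1.im < r.im)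
    (h2 : r.im < Y2.im) (hroot : ∀ r', G X r' Z = 0 → Y1.im ≤ r'.im → r'.im ≤ Y2.im → r' = r) :
    W X Y1 Z (-1) 1 = g * W X Y2 Z (-1) 1 := by
  have h3 := hl.scale (k := -1) (by simp)
  simp only [neg_one_mul, neg_neg] at h3
  have h4 := cross_right (Y1 := -Y2) (Y2 := -Y1) h3 (by simpa) (by simpa) (fun r' h h' h'' => by
    rw [G_neg] at h
    simp at h' h''
    have := hroot _ h (by simp; linarith) (by simp; linarith)
    rw [← this, neg_neg])
  have f : ∀ Y : ℂ, (Y = Y1 ∨ Y = Y2) → W (-X) (-Y) (-Z) (-1) 1 = (W X Y Z (-1) 1)⁻¹ := by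
    intro Y hY
    have hf := free_line (X := X) (Y := Y) (Z := Z) (by
      intro r' hr' he
      have : r' = r := by
        rcases hY with rfl | rfl
        · exact hroot r' hr' (by linarith) (by linarith)
        · exact hroot r' hr' (by linarith) (by linarith)
      subst this
      rcases hY with rfl | rfl <;> linarith)
    rw [W_inv hf.2 hf.1]
    have := W_scale (k := -1) (by simp) hf.1 hf.2
    simpa using this
  rw [f _ (Or.inl rfl), f _ (Or.inr rfl)] at h4
  exact grp_aux h4

lemma top_line {X Y Z : ℂ} {ε : ℝ} (hε : ε ≠ 0) (h : ∀ r, G X r Z = 0 → ε*r.im < ε*Y.im) :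
    W X Y Z (-1) 1 = 1 := by
  have hf : ∀ d : ℂ, d ≠ 0 → 0 ≤ ε*d.im → Free X Y Z d := by
    intro d hd hi
    apply free_of hd
    intro s hs h0
    have := h _ h0
    simp at this
    nlinarith [mul_nonneg hs hi]
  have hj : JoinedIn (Set.Icc (0:ℝ) 1) 0 1 :=
    JoinedIn.of_segment_subset ((convex_Icc 0 1).segment_subset (by simp) (by simp))
  have hw := W_joined hj (X := fun _ => X) (Y := fun k => Y) (Z := fun _ => Z)
    (d1 := fun k => -1+k*(1+ε*I)) (d2 := fun k => 1+k*(-1+ε*I)) (by fun_prop) (by fun_prop) (by fun_prop)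
    (by fun_prop) (by fun_prop) (by
      intro k hk
      apply hf
      · intro h0
        have h1 := congrArg Complex.im h0
        have h2 := congrArg Complex.re h0
        simp at h1 h2
        rcases h1 with h1 | h1
        · rw [h1] at h2; norm_num at h2
        · exact hε h1
      · simp; nlinarith [hk.1, mul_nonneg hk.1 (mul_self_nonneg ε)]) (by
      intro k hk
      apply hf
      · intro h0
        have h1 := congrArg Complex.im h0
        have h2 := congrArg Complex.re h0
        simp at h1 h2
        rcases h1 with h1 | h1
        · rw [h1] at h2; norm_num at h2
        · exact hε h1
      · simp; nlinarith [hk.1, mul_nonneg hk.1 (mul_self_nonneg ε)])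
  simp at hw
  rw [hw, W_self]

end Oka

namespace Oka
open Complex Topology

lemma ray_real {n K L a t : ℝ} (hn0 : 0 < n) (hn : n ≤ 1/4) (f5 : 0 < L) (f4 : (1-n)^2 ≤ K)
    (ha : 0 ≤ a) (ht : 0 < t)
    (h1 : (n * (n + (2*a*t+t^2)) * (L + (2*t*(2*a+a*n)+t^2*n)))^3*K^2 =
      (n*n*L)^3*(K + ((1+n)*(2*a*t) + n*t^2))^2) : False := by
  obtain ⟨q, hq⟩ : ∃ q, q = 2*a*t+t^2 := ⟨_, rfl⟩
  obtain ⟨L', hL'⟩ : ∃ q, q = L + (2*t*(2*a+a*n)+t^2*n) := ⟨_, rfl⟩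
  obtain ⟨M, hM⟩ : ∃ q, q = K + ((1+n)*(2*a*t) + n*t^2) := ⟨_, rfl⟩
  rw [← hq, ← hL', ← hM] at h1
  have hat : 0 ≤ a*t := mul_nonneg ha ht.le
  have hqp : 0 < q := by rw [hq]; positivity
  have hLL : L ≤ L' := by
    have : 0 ≤ 2*t*(2*a + a*n) + t^2*n := by positivity
    linarith
  have hMK : M ≤ K + (1+n)*q := by
    rw [hM, hq]; nlinarith [sq_nonneg t]
  have hKp : n*(1+n) < K := by
    have e1 : (1-n)^2 = 1-2*n+n*n := by ring
    have e2 : n*(1+n) = n+n*n := by ring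
    linarith
  have hK0 : 0 < K := by
    have : 0 < n*(1+n) := by positivity
    linarith
  have hM0 : 0 ≤ M := by
    have : 0 ≤ (1+n)*(2*a*t) + n*t^2 := by positivity
    linarith
  have hnM : n*M < K*(n+q) := by
    have h1 : n*M ≤ n*(K+(1+n)*q) := mul_le_mul_of_nonneg_left hMK hn0.le
    have h2 := mul_lt_mul_of_pos_right hKp hqp
    linarith
  clear hq hL' hM hat f4 hMK hKp
  have h2 : n^3 * ((n+q)^3*L'^3*K^2) = n^3 * (n^3*L^3*M^2) := by linear_combination h1
  have h3 := mul_left_cancel₀ (pow_ne_zero 3 hn0.ne') h2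
  have h4 : (n*M)^2 < (K*(n+q))^2 := by
    apply pow_lt_pow_left₀ hnM (by positivity) (by norm_num)
  have h5 : n*(n*M)^2 < (n+q)*(K*(n+q))^2 := by
    apply mul_lt_mul'' (by linarith) h4 hn0.le (by positivity)
  have h6 : L^3 ≤ L'^3 := pow_le_pow_left₀ f5.le hLL 3
  have h7 : n*(n*M)^2*L^3 < (n+q)*(K*(n+q))^2*L'^3 := by
    apply mul_lt_mul h5 h6 (by positivity) (by positivity)
  have e1 : n*(n*M)^2*L^3 = n^3*L^3*M^2 := by ring
  have e2 : (n+q)*(K*(n+q))^2*L'^3 = (n+q)^3*L'^3*K^2 := by ring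
  linarith

lemma ray_key {u : ℂ} (ha : 0 ≤ u.re) (hu : u ≠ 0) (hn : normSq u ≤ 1/4) {t : ℝ} (ht : 0 < t) :
    ((1+u^2+t*u)^2-1)^3*(1+u^2)^2 ≠ ((1+u^2)^2-1)^3*(1+u^2+t*u)^2 := by
  intro h0
  have hn0 : 0 < normSq u := normSq_pos.2 hu
  have e1 : (1+u^2+t*u)^2-1 = u*(u+t)*(2+u^2+t*u) := by ring
  have e2 : (1+u^2)^2-1 = u*u*(2+u^2) := by ring
  rw [e1, e2] at h0
  have h1 := congrArg normSq h0
  simp only [map_mul, map_pow] at h1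
  have f1 : normSq (u+t) = normSq u + (2*u.re*t + t^2) := by
    simp [normSq_apply]; ring
  have f2 : normSq (2+u^2+t*u) = normSq (2+u^2) + (2*t*(2*u.re + u.re*normSq u) + t^2*normSq u) := by
    simp [normSq_apply, pow_two]; ring
  have f3 : normSq (1+u^2+t*u) = normSq (1+u^2) + ((1+normSq u)*(2*u.re*t) + normSq u*t^2) := by
    simp [normSq_apply, pow_two]; ring
  have f4 : (1 - normSq u)^2 ≤ normSq (1+u^2) := by
    simp [normSq_apply, pow_two]; nlinarith [sq_nonneg (u.re)]
  have f5 : 0 < normSq (2+u^2) := by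
    rw [normSq_pos]; intro h
    have := congrArg Complex.re h
    simp [pow_two] at this
    rw [normSq_apply] at hn
    nlinarith [mul_self_nonneg u.re, mul_self_nonneg u.im]
  rw [f1, f2, f3] at h1
  exact ray_real hn0 hn f5 f4 ha ht h1

lemma half_disc {ρ : ℝ} (hρ : 0 < ρ) {u : ℂ} (hu : 0 ≤ u.re) (hu0 : u ≠ 0) (hu1 : ‖u‖ < ρ) :
    JoinedIn {u : ℂ | 0 ≤ u.re ∧ u ≠ 0 ∧ ‖u‖ < ρ} ((ρ/2 : ℝ):ℂ) u := by
  apply JoinedIn.symm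
  apply JoinedIn.of_segment_subset
  intro z hz
  have hz2 := (convex_ball (0:ℂ) ρ).segment_subset (x := u) (y := ((ρ/2 : ℝ):ℂ)) (by simpa using hu1)
    (by rw [mem_ball_zero_iff, norm_real, Real.norm_of_nonneg (by positivity)]; linarith) hz
  obtain ⟨a, b, ha, hb, hab, rfl⟩ := hz
  rw [mem_ball_zero_iff] at hz2
  have hre : (a • u + b • ((ρ/2 : ℝ):ℂ)).re = a*u.re + b*(ρ/2) := by simp
  refine ⟨?_, ?_, hz2⟩
  · rw [hre]; positivity
  · intro h0
    have h1 := congrArg Complex.re h0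
    rw [hre] at h1
    simp at h1
    have h2 : 0 ≤ a*u.re := by positivity
    have h3 : b*(ρ/2) = 0 := le_antisymm (by linarith) (by positivity)
    have h4 : b = 0 := by
      rcases mul_eq_zero.1 h3 with h | h; exact h; linarith
    subst h4
    have : a = 1 := by linarith
    subst this
    apply hu0; simpa using h0

lemma G_norm {X Z σ j Y : ℂ} (hS : σ^2 = 3*X^2-2*Z^2) (hE : (X-Z)^2*(2*X+Z)*Z = j*(σ^2)^2) :
    G X (σ*Y) Z = σ^6 * ((Y^2-1)^3 - 27*j*Y^2) := by
  have : G X (σ*Y) Z = ((σ*Y)^2 - (3*X^2-2*Z^2))^3 - 27*((X-Z)^2*(2*X+Z)*Z)*(σ*Y)^2 := by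
    unfold G; ring
  rw [this, ← hS, hE]; ring

lemma valid_local {X Z σ j u : ℂ} (hσ : σ ≠ 0) (hS : σ^2 = 3*X^2-2*Z^2)
    (hE : (X-Z)^2*(2*X+Z)*Z = j*(σ^2)^2) (hj : ((1+u^2)^2-1)^3 = 27*j*(1+u^2)^2)
    (ha : 0 ≤ u.re) (hu : u ≠ 0) (hn : ‖u‖ ≤ 1/2) : Valid X Z (σ*(1+u^2)) (σ*u) := by
  have hn' : normSq u ≤ 1/4 := by rw [normSq_eq_norm_sq]; nlinarith [norm_nonneg u]
  have hu2 : ‖u^2‖ ≤ 1/4 := by rw [norm_pow]; nlinarith [norm_nonneg u]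
  have hY : 3/4 ≤ ‖1+u^2‖ := by
    have := norm_sub_le (1+u^2) (u^2)
    simp at this
    simp at hu2
    linarith
  have hY0 : 1+u^2 ≠ 0 := by intro h; rw [h] at hY; norm_num at hY
  refine ⟨mul_ne_zero hσ hu, ?_, ?_, ?_⟩
  · rw [G_norm hS hE, hj]; ring
  · have e : Gd X (σ*(1+u^2)) Z = 6*σ^5*(1+u^2)*(((1+u^2)^2-1)^2 - 9*j) := by
      unfold Gd; rw [hE, ← hS]; ring
    rw [e]
    refine mul_ne_zero (mul_ne_zero (mul_ne_zero (by norm_num) (pow_ne_zero _ hσ)) hY0) ?_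
    intro h0
    have h1 : ((1+u^2)^2-1)^2*(2*(1+u^2)^2+1) = 0 := by
      linear_combination 3*(1+u^2)^2*h0 - hj
    rcases mul_eq_zero.1 h1 with h2 | h2
    · have h3 : u^2*(2+u^2) = 0 := by
        have := pow_eq_zero_iff (two_ne_zero) |>.1 h2
        linear_combination this
      rcases mul_eq_zero.1 h3 with h4 | h4
      · exact hu (by simpa using h4)
      · have : u^2 = -2 := by linear_combination h4
        rw [this] at hu2; norm_num at hu2
    · have h3 : (1+u^2)^2 = -1/2 := by linear_combination (1/2)*h2
      have h4 := congrArg norm h3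
      rw [norm_pow] at h4
      norm_num at h4
      nlinarith
  · intro t ht h0
    have e : σ*(1+u^2) + t*(σ*u) = σ*(1+u^2+t*u) := by ring
    rw [e, G_norm hS hE] at h0
    have h1 := (mul_eq_zero.1 h0).resolve_left (pow_ne_zero _ hσ)
    apply ray_key ha hu hn' ht
    linear_combination (1+u^2)^2*h1 - (1+u^2+t*u)^2*hj

lemma local_lasso {X Z σ h : ℂ → ℂ} {ρ0 : ℝ} (hρ0 : 0 < ρ0)
    (hX : ContinuousOn X (Metric.ball 0 ρ0)) (hZ : ContinuousOn Z (Metric.ball 0 ρ0))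
    (hσ : ContinuousOn σ (Metric.ball 0 ρ0))
    (hσ0 : ∀ ζ ∈ Metric.ball (0:ℂ) ρ0, σ ζ ≠ 0)
    (hS : ∀ ζ ∈ Metric.ball (0:ℂ) ρ0, (σ ζ)^2 = 3*(X ζ)^2-2*(Z ζ)^2)
    (hE : ∀ ζ ∈ Metric.ball (0:ℂ) ρ0, (X ζ-Z ζ)^2*(2*X ζ+Z ζ)*Z ζ = (ζ*h ζ)*((σ ζ)^2)^2)
    (hh : ContDiffAt ℂ 1 h 0) (hh0 : h 0 ≠ 0) :
    ∃ ρ > 0, ρ ≤ ρ0 ∧ ∃ g, ∀ ζ, ζ ≠ 0 → ‖ζ‖ < ρ → ∀ Y u : ℂ, (Y^2-1)^3 = 27*(ζ*h ζ)*Y^2 → 0 ≤ Y.re →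
      u^2 = Y-1 → 0 ≤ u.re → IsLasso (X ζ) (Z ζ) (σ ζ*Y) (σ ζ*u) g := by
  set j : ℂ → ℂ := fun ζ => ζ*h ζ with hj
  have hd : HasStrictDerivAt j (h 0) 0 := by
    have h1 := (hasStrictDerivAt_id (0:ℂ)).mul (hh.hasStrictDerivAt one_ne_zero)
    exact h1.congr_deriv (by simp)
  have hde := hd.hasStrictFDerivAt_equiv hh0
  set e := hde.toOpenPartialHomeomorph j with he
  have hej : ∀ z, e z = j z := fun z => rfl
  have h0s : (0:ℂ) ∈ e.source := hde.mem_toOpenPartialHomeomorph_source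
  have hj0 : j 0 = 0 := by simp [hj]
  have h0t : (0:ℂ) ∈ e.target := by rw [← hj0, ← hej]; exact e.map_source h0s
  have hs0 : e.symm 0 = 0 := by
    have := e.left_inv h0s
    rwa [hej, hj0] at this
  -- the open set of good w
  have hT : e.target ∩ e.symm ⁻¹' (Metric.ball 0 ρ0) ∈ 𝓝 (0:ℂ) := by
    apply (e.isOpen_inter_preimage_symm Metric.isOpen_ball).mem_nhds
    refine ⟨h0t, ?_⟩
    rw [Set.mem_preimage, hs0]; exact Metric.mem_ball_self hρ0
  let w : ℂ → ℂ := fun u => ((1+u^2)^2-1)^3/(27*(1+u^2)^2)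
  have hYne : ∀ u : ℂ, ‖u‖ < 1 → 1+u^2 ≠ 0 := by
    intro u hu h0
    have : u^2 = -1 := by linear_combination h0
    have h2 := congrArg norm this
    rw [norm_pow] at h2
    simp at h2
    rcases h2 with h2 | h2 <;> linarith [norm_nonneg u]
  have hwc : ∀ u : ℂ, ‖u‖ < 1 → ContinuousAt w u := by
    intro u hu
    have := hYne u hu
    unfold w
    apply ContinuousAt.div (by fun_prop) (by fun_prop)
    simp [this]
  have hw0 : w 0 = 0 := by simp [w]
  have hev : ∀ᶠ u in 𝓝 (0:ℂ), w u ∈ e.target ∩ e.symm ⁻¹' (Metric.ball 0 ρ0) := by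
    have := hwc 0 (by simp)
    apply this
    rw [hw0]; exact hT
  obtain ⟨ρ2, hρ2, hb⟩ := Metric.eventually_nhds_iff_ball.1 hev
  set ρ1 := min ρ2 (1/2) with hρ1
  have hρ1p : 0 < ρ1 := lt_min hρ2 (by norm_num)
  have hρ1h : ρ1 ≤ 1/2 := min_le_right _ _
  set D := {u : ℂ | 0 ≤ u.re ∧ u ≠ 0 ∧ ‖u‖ < ρ1} with hD
  have hwD : ∀ u ∈ D, w u ∈ e.target ∩ e.symm ⁻¹' (Metric.ball 0 ρ0) := by
    intro u hu
    apply hb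
    rw [mem_ball_zero_iff]; exact hu.2.2.trans_le (min_le_left _ _)
  let ζf : ℂ → ℂ := fun u => e.symm (w u)
  have hζm : ∀ u ∈ D, ζf u ∈ Metric.ball (0:ℂ) ρ0 := fun u hu => (hwD u hu).2
  have hζc : ContinuousOn ζf D := by
    apply e.continuousOn_symm.comp
    · intro u hu; exact (hwc u (by linarith [hu.2.2])).continuousWithinAt
    · intro u hu; exact (hwD u hu).1
  have hζj : ∀ u ∈ D, j (ζf u) = w u := fun u hu => by
    rw [← hej]; exact e.right_inv (hwD u hu).1
  have hval : ∀ u ∈ D, Valid (X (ζf u)) (Z (ζf u)) (σ (ζf u)*(1+u^2)) (σ (ζf u)*u) := by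
    intro u hu
    have hm := hζm u hu
    have hY := hYne u (by linarith [hu.2.2])
    apply valid_local (j := j (ζf u)) (hσ0 _ hm) (hS _ hm) (hE _ hm) _ hu.1 hu.2.1 (by linarith [hu.2.2])
    rw [hζj u hu]
    simp only [w]
    field_simp
  have hbase : ((ρ1/2 : ℝ):ℂ) ∈ D := by
    refine ⟨?_, ?_, ?_⟩
    · rw [ofReal_re]; positivity
    · rw [ofReal_ne_zero]; positivity
    · rw [norm_real, Real.norm_of_nonneg (by positivity)]; linarith
  obtain ⟨g, hg⟩ := (hval _ hbase).exists
  have hall : ∀ u ∈ D, IsLasso (X (ζf u)) (Z (ζf u)) (σ (ζf u)*(1+u^2)) (σ (ζf u)*u) g := by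
    intro u hu
    have cσ : ContinuousOn (fun u => σ (ζf u)) D := hσ.comp hζc hζm
    exact IsLasso.joined (half_disc hρ1p hu.1 hu.2.1 hu.2.2) (hX.comp hζc hζm) (hZ.comp hζc hζm)
      (cσ.mul (by fun_prop)) (cσ.mul (by fun_prop)) hval hg
  -- smallness
  have hjc : ContinuousAt j 0 := hd.hasDerivAt.continuousAt
  have hsm : ∀ᶠ ζ in 𝓝 (0:ℂ), ‖j ζ‖ < (ρ1^2)^3/54 ∧ ζ ∈ e.source := by
    refine Filter.Eventually.and ?_ (e.open_source.mem_nhds h0s)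
    apply hjc.norm.eventually_lt continuousAt_const
    rw [hj0, norm_zero]; positivity
  obtain ⟨ρ3, hρ3, hb3⟩ := Metric.eventually_nhds_iff_ball.1 hsm
  refine ⟨min ρ3 ρ0, lt_min hρ3 hρ0, min_le_right _ _, g, ?_⟩
  intro ζ hζ0 hζ Y u hY hYre huY hure
  obtain ⟨k1, k2⟩ := hb3 ζ (by rw [mem_ball_zero_iff]; exact hζ.trans_le (min_le_left _ _))
  have hjne : j ζ ≠ 0 := by
    intro h0
    apply hζ0
    apply e.injOn k2 h0s
    rw [hej, hej, h0, hj0]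
  have hYe : Y = 1+u^2 := by linear_combination -huY
  have hu0 : u ≠ 0 := by
    rintro rfl
    have : Y = 1 := by rw [hYe]; ring
    rw [this] at hY
    apply hjne
    change (1^2-1 : ℂ)^3 = 27*j ζ*1^2 at hY
    linear_combination -(1/27)*hY
  have hsmall : ‖Y-1‖ < ρ1^2 := by
    by_contra hc
    push Not at hc
    have hp1 : 1 ≤ ‖Y+1‖ := by
      have := Complex.re_le_norm (Y+1)
      simp at this; linarith
    have hm : ‖Y-1‖ ≤ ‖Y^2-1‖ := by
      have : Y^2-1 = (Y-1)*(Y+1) := by ring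
      rw [this, norm_mul]
      nlinarith [norm_nonneg (Y-1)]
    have hY2 : ‖Y^2‖ ≤ 1 + ‖Y^2-1‖ := by
      have := norm_add_le (1:ℂ) (Y^2-1)
      simpa using this
    have h3 := congrArg norm hY
    change ‖(Y^2-1)^3‖ = ‖27*j ζ*Y^2‖ at h3
    rw [norm_pow, norm_mul, norm_mul] at h3
    have h27 : ‖(27:ℂ)‖ = 27 := by simp
    rw [h27] at h3
    set m := ‖Y^2-1‖
    set κ := ρ1^2
    have hκp : 0 < κ := by positivity
    have hκ : κ ≤ 1 := by nlinarith
    have hκ3 : κ^3 ≤ 1 := pow_le_one₀ hκp.le hκ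
    have hmκ : κ ≤ m := hc.trans hm
    have h4 : m^3 ≤ 27*‖j ζ‖*(1+m) := by
      rw [h3]; gcongr
    have h5 : 27*‖j ζ‖*(1+m) < κ^3/2*(1+m) := by
      apply mul_lt_mul_of_pos_right _ (by linarith)
      linarith
    have h6 : κ^3/2*(1+m) ≤ m^3 := by
      rcases le_total m 1 with h | h
      · have : κ^3 ≤ m^3 := pow_le_pow_left₀ hκp.le hmκ 3
        nlinarith [pow_pos hκp 3]
      · have : m ≤ m^3 := le_self_pow₀ h (by norm_num)
        nlinarith
    linarith
  have hun : ‖u‖ < ρ1 := by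
    rw [← huY, norm_pow] at hsmall
    exact lt_of_pow_lt_pow_left₀ 2 hρ1p.le hsmall
  have huD : u ∈ D := ⟨hure, hu0, hun⟩
  have hres := hall u huD
  have hYn := hYne u (by linarith)
  have hwj : w u = j ζ := by
    rw [hYe] at hY
    simp only [w]
    rw [hY]
    field_simp
    rfl
  have hζe : ζf u = ζ := by
    simp only [ζf]
    rw [hwj, ← hej]; exact e.left_inv k2
  rw [hζe] at hres
  rw [hYe]; exact hres

end Oka

namespace Oka
open Complex Topology

def sR (x : ℝ) : ℝ := 3*x^2-2
def eR (x : ℝ) : ℝ := (x-1)^2*(2*x+1)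
def DR (x : ℝ) : ℝ := (eR x*sR x)^2-4*(eR x)^3
def aR (x : ℝ) : ℝ := ((eR x*sR x + √(DR x))/2)^((1:ℝ)/3)
def bR (x : ℝ) : ℝ := eR x/aR x
def vR (x : ℝ) : ℝ := sR x + 3*(aR x + bR x)
def uf (x : ℝ) : ℂ := ((sR x - 3*(aR x+bR x)/2 : ℝ):ℂ) + ((3*√3/2*(aR x - bR x) : ℝ):ℂ)*I
def zf (x : ℝ) : ℂ := (uf x)^(2⁻¹:ℂ)

lemma pow_pos_of_neg_aux {x : ℝ} (hx : x < -1/2) : 0 < (x-1)^2 := by nlinarith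

lemma eR_neg {x : ℝ} (hx : x < -1/2) : eR x < 0 := by
  unfold eR
  apply mul_neg_of_pos_of_neg
  · exact pow_pos_of_neg_aux hx
  · linarith

lemma base_pos {x : ℝ} (hx : x < -1/2) : 0 < (eR x*sR x + √(DR x))/2 := by
  have he := eR_neg hx
  have : |eR x*sR x| < √(DR x) := by
    rw [← Real.sqrt_sq_eq_abs]
    apply Real.sqrt_lt_sqrt (sq_nonneg _)
    unfold DR
    have : (eR x)^3 < 0 := by apply Odd.pow_neg (by decide) he
    linarith
  have := (abs_lt.1 this).1
  linarith

lemma aR_pos {x : ℝ} (hx : x < -1/2) : 0 < aR x := Real.rpow_pos_of_pos (base_pos hx) _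

lemma bR_neg {x : ℝ} (hx : x < -1/2) : bR x < 0 := div_neg_of_neg_of_pos (eR_neg hx) (aR_pos hx)

lemma ab_mul {x : ℝ} (hx : x < -1/2) : aR x * bR x = eR x := by
  unfold bR; field_simp [(aR_pos hx).ne']

lemma ab_cube {x : ℝ} (hx : x < -1/2) : aR x^3 + bR x^3 = eR x*sR x := by
  have h1 : aR x^3 = (eR x*sR x + √(DR x))/2 := by
    unfold aR
    rw [← Real.rpow_natCast, ← Real.rpow_mul (base_pos hx).le]; norm_num
  have h2 : (aR x*bR x)^3 = eR x^3 := by rw [ab_mul hx]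
  have hD : 0 ≤ DR x := by
    unfold DR
    have : (eR x)^3 < 0 := by apply Odd.pow_neg (by decide) (eR_neg hx)
    nlinarith [sq_nonneg (eR x*sR x)]
  have h3 : √(DR x)^2 = (eR x*sR x)^2-4*(eR x)^3 := Real.sq_sqrt hD
  have h4 : aR x^3 * (aR x^3 + bR x^3 - eR x*sR x) = 0 := by
    have : aR x^3 * bR x^3 = eR x^3 := by rw [← h2]; ring
    rw [mul_sub, mul_add, this, h1]
    linear_combination (1/4)*h3
  have := (mul_eq_zero.1 h4).resolve_left (pow_ne_zero _ (aR_pos hx).ne')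
  linarith

lemma uf_im {x : ℝ} (hx : x < -1/2) : 0 < (uf x).im := by
  have h1 := aR_pos hx
  have h2 := bR_neg hx
  have h3 : 0 < √(3:ℝ) := by positivity
  have : (uf x).im = 3*√3/2*(aR x - bR x) := by simp [uf]
  rw [this]
  apply mul_pos (by positivity) (by linarith)

lemma uf_re (x : ℝ) : (uf x).re = sR x - 3*(aR x+bR x)/2 := by simp [uf]

lemma G_fac {x : ℝ} (hx : x < -1/2) (y : ℂ) :
    G x y 1 = (y^2 - vR x)*((y^2 - uf x)*(y^2 - (starRingEnd ℂ) (uf x))) := by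
  have h1 : (aR x : ℂ) * bR x = eR x := by exact_mod_cast ab_mul hx
  have h2 : (aR x : ℂ)^3 + (bR x:ℂ)^3 = eR x*sR x := by exact_mod_cast ab_cube hx
  have h3 : (((√3:ℝ):ℂ)*I)^2 = -3 := by
    rw [mul_pow, I_sq, ← ofReal_pow, Real.sq_sqrt (by norm_num)]; norm_num
  have hG : G x y 1 = (y^2 - sR x)^3 - 27*eR x*y^2 := by
    unfold G sR eR; push_cast; ring
  have hv : (vR x : ℂ) = sR x + 3*(aR x + bR x) := by unfold vR; push_cast; ring
  have hu : uf x = sR x - 3*(aR x+bR x)/2 + 3/2*(((√3:ℝ):ℂ)*I)*(aR x - bR x) := by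
    unfold uf; push_cast; ring
  have hu' : (starRingEnd ℂ) (uf x) = sR x - 3*(aR x+bR x)/2 - 3/2*(((√3:ℝ):ℂ)*I)*(aR x - bR x) := by
    unfold uf; rw [map_add, map_mul, conj_I, conj_ofReal, conj_ofReal]; push_cast; ring
  rw [hG, hv, hu', hu]
  generalize (((√3:ℝ):ℂ)*I) = w at *
  generalize (aR x:ℂ) = a at *
  generalize (bR x:ℂ) = b at *
  generalize (eR x:ℂ) = e at *
  generalize (sR x:ℂ) = s at *
  linear_combination 27*(y^2-s)*h1 + 27*h2 + (9/4)*(a-b)^2*(y^2-s-3*(a+b))*h3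

lemma zf_sq (x : ℝ) : zf x^2 = uf x := by
  unfold zf; exact cpow_ofNat_inv_pow _ 2

lemma sq_im (z : ℂ) : (z^2).im = 2*(z.re*z.im) := by rw [pow_two, mul_im]; ring
lemma sq_re (z : ℂ) : (z^2).re = z.re^2 - z.im^2 := by rw [pow_two, mul_re]; ring

lemma half_re (u : ℂ) : 0 ≤ (u^(2⁻¹:ℂ)).re := by
  rw [cpow_inv_two_re]; positivity

lemma zf_re {x : ℝ} (hx : x < -1/2) : 0 < (zf x).re := by
  apply lt_of_le_of_ne (half_re _)
  intro h
  have h1 := uf_im hx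
  rw [← zf_sq, sq_im] at h1
  change 0 = (zf x).re at h
  rw [← h] at h1; simp at h1

lemma zf_im {x : ℝ} (hx : x < -1/2) : 0 < (zf x).im := by
  have h1 := uf_im hx
  have h2 := zf_re hx
  rw [← zf_sq, sq_im] at h1
  by_contra hc
  push Not at hc
  nlinarith

lemma zf_cont : ContinuousOn zf (Set.Iio (-1/2)) := by
  have c1 : Continuous eR := by unfold eR; fun_prop
  have c2 : Continuous sR := by unfold sR; fun_prop
  have c3 : Continuous DR := by unfold DR; fun_prop
  have c4 : ContinuousOn aR (Set.Iio (-1/2)) := by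
    intro x hx
    unfold aR
    apply ContinuousAt.continuousWithinAt
    apply ContinuousAt.rpow_const
    · fun_prop
    · left; exact (base_pos hx).ne'
  have c5 : ContinuousOn bR (Set.Iio (-1/2)) :=
    c1.continuousOn.div c4 (fun x hx => (aR_pos hx).ne')
  have c6 : ContinuousOn uf (Set.Iio (-1/2)) := by
    unfold uf; fun_prop
  intro x hx
  unfold zf
  apply ContinuousWithinAt.cpow (c6 x hx) continuousWithinAt_const
  right; exact (uf_im hx).ne'

lemma zf_root {x : ℝ} (hx : x < -1/2) : G x (zf x) 1 = 0 := by
  rw [G_fac hx, zf_sq]; ring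

lemma root_cases {x : ℝ} (hx : x < -1/2) {y : ℂ} (hy : G x y 1 = 0) :
    y^2 = vR x ∨ (y = zf x ∨ y = -zf x) ∨ (y = (starRingEnd ℂ) (zf x) ∨ y = -(starRingEnd ℂ) (zf x)) := by
  rw [G_fac hx] at hy
  rcases mul_eq_zero.1 hy with h | h
  · left; linear_combination h
  rcases mul_eq_zero.1 h with h | h
  · right; left
    rw [← zf_sq] at h
    exact sq_eq_sq_iff_eq_or_eq_neg.1 (sub_eq_zero.1 h)
  · right; right
    rw [← zf_sq, map_pow] at h
    exact sq_eq_sq_iff_eq_or_eq_neg.1 (sub_eq_zero.1 h)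

/-- the four nonreal-square roots -/
def Four (x : ℝ) (r : ℂ) : Prop :=
  (r = zf x ∨ r = -zf x) ∨ (r = (starRingEnd ℂ) (zf x) ∨ r = -(starRingEnd ℂ) (zf x))

lemma Four.root {x : ℝ} (hx : x < -1/2) {r : ℂ} (h : Four x r) : G x r 1 = 0 := by
  rw [G_fac hx]
  rcases h with (rfl | rfl) | (rfl | rfl)
  · rw [zf_sq]; ring
  · rw [neg_sq, zf_sq]; ring
  · rw [← map_pow, zf_sq]; ring
  · rw [neg_sq, ← map_pow, zf_sq]; ring

lemma Four.abs {x : ℝ} (hx : x < -1/2) {r : ℂ} (h : Four x r) :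
    |r.re| = (zf x).re ∧ |r.im| = (zf x).im := by
  have h1 := zf_re hx
  have h2 := zf_im hx
  rcases h with (rfl | rfl) | (rfl | rfl) <;> simp [abs_of_pos h1, abs_of_pos h2]

lemma Four.simple {x : ℝ} (hx : x < -1/2) {r : ℂ} (h : Four x r) : Gd x r 1 ≠ 0 := by
  intro h0
  have hr := h.root hx
  have ha := h.abs hx
  have h1 := zf_re hx
  have h2 := zf_im hx
  have he := (eR_neg hx).ne
  have hre : r.re ≠ 0 := by intro h; rw [h] at ha; simp at ha; linarith
  have him : r.im ≠ 0 := by intro h; rw [h] at ha; simp at ha; linarith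
  have hr0 : r ≠ 0 := by rintro rfl; simp at hre
  have hG : (r^2 - sR x)^3 - 27*eR x*r^2 = 0 := by
    rw [← hr]; unfold G sR eR; push_cast; ring
  have hd : 6*r*((r^2 - sR x)^2 - 9*eR x) = 0 := by
    rw [← h0]; unfold Gd sR eR; push_cast; ring
  have h3 := (mul_eq_zero.1 hd).resolve_left (mul_ne_zero (by norm_num) hr0)
  have h4 : (eR x : ℂ)*((r^2 - sR x) - 3*r^2) = 0 := by
    linear_combination (1/9)*hG - (1/9)*(r^2-sR x)*h3
  have h5 := (mul_eq_zero.1 h4).resolve_left (by exact_mod_cast he)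
  have h6 : r^2 = ((-sR x/2 : ℝ):ℂ) := by push_cast; linear_combination -(1/2)*h5
  have h7 := congrArg Complex.im h6
  rw [sq_im, ofReal_im] at h7
  have : r.re*r.im ≠ 0 := mul_ne_zero hre him
  apply this; linarith

lemma four_ext {x : ℝ} (hx : x < -1/2) {r r' : ℂ} (h : Four x r) (h' : Four x r')
    (h1 : 0 < r.re*r'.re) (h2 : 0 < r.im*r'.im) : r' = r := by
  have a1 := zf_re hx
  have a2 := zf_im hx
  rcases h with (rfl | rfl) | (rfl | rfl) <;> rcases h' with (rfl | rfl) | (rfl | rfl) <;>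
    first
    | rfl
    | (exfalso; simp at h1 h2; nlinarith)

lemma four_of {x : ℝ} (hx : x < -1/2) {y : ℂ} (hy : G x y 1 = 0) (hre : y.re ≠ 0) (him : y.im ≠ 0) :
    Four x y := by
  rcases root_cases hx hy with h | h
  · exfalso
    have h1 := congrArg Complex.im h
    rw [sq_im, ofReal_im] at h1
    exact mul_ne_zero hre him (by linarith)
  · exact h

/-- validity in the closed quadrant -/
lemma Four.valid {x : ℝ} (hx : x < -1/2) {r θ : ℂ} (h : Four x r) (h1 : 0 < r.re*θ.re)
    (h2 : 0 < r.im*θ.im) : Valid x 1 r θ := by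
  refine ⟨?_, h.root hx, h.simple hx, ?_⟩
  · rintro rfl; simp at h1
  · intro t ht h0
    have ha := h.abs hx
    have e1 : (r + t*θ).re = r.re + t*θ.re := by simp
    have e2 : (r + t*θ).im = r.im + t*θ.im := by simp
    have p1 : 0 < r.re*(r+t*θ).re := by rw [e1]; nlinarith [mul_pos ht h1, mul_self_nonneg r.re]
    have p2 : 0 < r.im*(r+t*θ).im := by rw [e2]; nlinarith [mul_pos ht h2, mul_self_nonneg r.im]
    have h4 := four_of hx h0 (right_ne_zero_of_mul p1.ne') (right_ne_zero_of_mul p2.ne')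
    have h5 := four_ext hx h h4 p1 p2
    have h6 : (t:ℂ)*θ = 0 := by linear_combination h5
    have h7 := congrArg Complex.re h6
    simp at h7
    rcases h7 with h7 | h7
    · linarith
    · rw [h7] at h1; simp at h1

lemma vR_neg {x : ℝ} (hx : x < -1/2) (hs : sR x < 0) : vR x < 0 := by
  have he := eR_neg hx
  have h1 : (vR x - sR x)^3 = 27*eR x*vR x := by
    unfold vR; linear_combination 27*ab_cube hx + 81*(aR x+bR x)*ab_mul hx
  by_contra hc
  push Not at hc
  have h2 : 0 < (vR x - sR x)^3 := pow_pos (by linarith) 3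
  nlinarith [mul_nonneg (neg_nonneg.2 he.le) hc]

lemma vR_lt {x : ℝ} (hx : x < -1/2) (hs : sR x < 0) : -vR x < (zf x).im^2 := by
  have he := eR_neg hx
  have h1 : 0 < aR x + bR x := by
    by_contra hc
    push Not at hc
    have h2 : 0 < aR x^3 + bR x^3 := by rw [ab_cube hx]; exact mul_pos_of_neg_of_neg he hs
    have h3 : aR x^3 + bR x^3 = (aR x+bR x)*(aR x^2 - aR x*bR x + bR x^2) := by ring
    have h4 : 0 ≤ aR x^2 - aR x*bR x + bR x^2 := by nlinarith [sq_nonneg (aR x - bR x), sq_nonneg (aR x+bR x)]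
    nlinarith
  have h2 : (zf x).re^2 - (zf x).im^2 = sR x - 3*(aR x+bR x)/2 := by
    rw [← sq_re, zf_sq, uf_re]
  have h3 := sq_nonneg (zf x).re
  have h4 : vR x = sR x + 3*(aR x + bR x) := rfl
  nlinarith

end Oka

namespace Oka
open Complex Topology

lemma six_aux {X Z : ℂ} {g : FundamentalGroup U P} (r : Fin 6 → ℂ)
    (hdec : ∀ i j, i < j → (r j).im < (r i).im)
    (hall : ∀ y, G X y Z = 0 → ∃ i, y = r i)
    (hl : ∀ i, IsLasso X Z (r i) 1 g ∨ IsLasso X Z (r i) (-1) g) (k : ℕ) (hk : k ≤ 6) :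
    ∀ Y : ℂ, (∀ i : Fin 6, i.val < k → Y.im < (r i).im) → (∀ i : Fin 6, k ≤ i.val → (r i).im < Y.im) →
      W X Y Z (-1) 1 = g^k := by
  induction k with
  | zero =>
    intro Y _ h2
    rw [pow_zero]
    apply top_line (ε := 1) one_ne_zero
    intro y hy
    obtain ⟨i, rfl⟩ := hall y hy
    have := h2 i (Nat.zero_le _)
    linarith
  | succ k ih =>
    intro Y h1 h2
    let i0 : Fin 6 := ⟨k, by omega⟩
    have hev : ∀ᶠ t in 𝓝[>] (r i0).im, ∀ i : Fin 6, i.val < k → t < (r i).im := by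
      rw [Filter.eventually_all]
      intro i
      by_cases hi : i.val < k
      · have := hdec i i0 hi
        filter_upwards [nhdsWithin_le_nhds (eventually_lt_nhds this)] with t ht _ using ht
      · exact Filter.Eventually.of_forall fun t h => absurd h hi
    obtain ⟨t, ht, ht0⟩ := (hev.and self_mem_nhdsWithin).exists
    have ht0 : (r i0).im < t := ht0
    have him : ((t:ℂ)*I).im = t := by simp
    have hW : W X ((t:ℂ)*I) Z (-1) 1 = g^k := by
      apply ih (by omega)
      · intro i hi; rw [him]; exact ht i hi
      · intro i hi; rw [him]
        rcases hi.eq_or_lt with h | h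
        · have : i = i0 := Fin.ext h.symm
          rw [this]; exact ht0
        · exact (hdec i0 i h).trans ht0
    have hY := h1 i0 (Nat.lt_succ_self k)
    have honly : ∀ r', G X r' Z = 0 → Y.im ≤ r'.im → r'.im ≤ ((t:ℂ)*I).im → r' = r i0 := by
      intro y hy ha hb
      obtain ⟨i, rfl⟩ := hall y hy
      rw [him] at hb
      rcases lt_trichotomy i.val k with h | h | h
      · exact absurd (ht i h) (not_lt.2 hb)
      · have : i = i0 := Fin.ext h
        rw [this]
      · exact absurd (h2 i h) (not_lt.2 ha)
    rcases hl i0 with h | h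
    · rw [cross_right h hY (by rw [him]; exact ht0) honly, hW, pow_succ]
    · rw [cross_left h hY (by rw [him]; exact ht0) honly, hW, pow_succ']

lemma six {X Z : ℂ} {g : FundamentalGroup U P} (r : Fin 6 → ℂ)
    (hdec : ∀ i j, i < j → (r j).im < (r i).im)
    (hroot : ∀ i, G X (r i) Z = 0)
    (hall : ∀ y, G X y Z = 0 → ∃ i, y = r i)
    (hl : ∀ i, IsLasso X Z (r i) 1 g ∨ IsLasso X Z (r i) (-1) g) :
    g^6 = 1 ∧ FibOK (Subgroup.zpowers g) X Z := by
  have main := six_aux r hdec hall hl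
  constructor
  · obtain ⟨t, ht⟩ := (Set.finite_range (fun i => (r i).im)).bddBelow
    have him : (((t-1 : ℝ):ℂ)*I).im = t-1 := by simp
    have hb : ∀ i, t ≤ (r i).im := fun i => ht ⟨i, rfl⟩
    rw [← main 6 le_rfl (((t-1 : ℝ):ℂ)*I)]
    · apply top_line (ε := -1) (by norm_num)
      intro y hy
      obtain ⟨i, rfl⟩ := hall y hy
      rw [him]; linarith [hb i]
    · intro i _; rw [him]; linarith [hb i]
    · intro i hi; omega
  · apply fib_of_lines
    · intro y y' hy hy' h
      obtain ⟨i, rfl⟩ := hall y hy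
      obtain ⟨j, rfl⟩ := hall y' hy'
      rcases lt_trichotomy i j with hij | hij | hij
      · exact absurd h (hdec i j hij).ne'
      · rw [hij]
      · exact absurd h (hdec j i hij).ne
    · intro Y h1 h2
      have hn := line_free h2 h1
      have hex : ∃ k ≤ 6, (∀ i : Fin 6, i.val < k → Y.im < (r i).im) ∧
          (∀ i : Fin 6, k ≤ i.val → (r i).im < Y.im) := by
        by_cases hc : ∃ n, ∃ h : n < 6, ¬ Y.im < (r ⟨n, h⟩).im
        · classical
          obtain ⟨hn6, hs⟩ := Nat.find_spec hc
          refine ⟨Nat.find hc, hn6.le, ?_, ?_⟩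
          · intro i hi
            have := Nat.find_min hc hi
            push Not at this
            exact this i.isLt
          · intro i hi
            have h3 : (r ⟨Nat.find hc, hn6⟩).im < Y.im := lt_of_le_of_ne (not_lt.1 hs) (hn _ (hroot _))
            rcases hi.eq_or_lt with h | h
            · have : i = ⟨Nat.find hc, hn6⟩ := Fin.ext h.symm
              rw [this]; exact h3
            · exact (hdec ⟨Nat.find hc, hn6⟩ i h).trans h3
        · push Not at hc
          exact ⟨6, le_rfl, fun i _ => hc i.val i.isLt, fun i hi => by omega⟩
      obtain ⟨k, hk, ha, hb⟩ := hex
      rw [main k hk Y ha hb]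
      exact Subgroup.npow_mem_zpowers g k

lemma IsLasso.dir {X Z r θ θ' : ℂ} {g : FundamentalGroup U P} (h : IsLasso X Z r θ g) {C : Set ℂ}
    (hC : Convex ℝ C) (h1 : θ ∈ C) (h2 : θ' ∈ C) (hv : ∀ t ∈ C, Valid X Z r t) :
    IsLasso X Z r θ' g := by
  have hj := JoinedIn.of_segment_subset (hC.segment_subset h1 h2)
  exact IsLasso.joined hj (X := fun _ => X) (Z := fun _ => Z) (r := fun _ => r) (θ := fun t => t)
    continuousOn_const continuousOn_const continuousOn_const continuousOn_id hv h

lemma convex_quad (a b : ℝ) : Convex ℝ {t : ℂ | 0 < a*t.re ∧ 0 < b*t.im} := by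
  intro p hp q hq s t hs ht hst
  simp only [Set.mem_ofPred_eq, add_re, add_im, real_smul, re_ofReal_mul, im_ofReal_mul] at *
  rcases hs.eq_or_lt with rfl | hs
  · have : t = 1 := by linarith
    subst this; simpa using hq
  · constructor
    · nlinarith [mul_pos hs hp.1, mul_nonneg ht hq.1.le]
    · nlinarith [mul_pos hs hp.2, mul_nonneg ht hq.2.le]

lemma convex_half (a : ℝ) : Convex ℝ {t : ℂ | 0 < a*t.re} := by
  intro p hp q hq s t hs ht hst
  simp only [Set.mem_ofPred_eq, add_re, real_smul, re_ofReal_mul] at *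
  rcases hs.eq_or_lt with rfl | hs
  · have : t = 1 := by linarith
    subst this; simpa using hq
  · nlinarith [mul_pos hs hp, mul_nonneg ht hq.le]

/-- quadrant direction change -/
lemma Four.dir {x : ℝ} (hx : x < -1/2) {r θ θ' : ℂ} (h : Four x r) {g : FundamentalGroup U P}
    (hl : IsLasso x 1 r θ g) (h1 : 0 < r.re*θ.re) (h2 : 0 < r.im*θ.im)
    (h3 : 0 < r.re*θ'.re) (h4 : 0 < r.im*θ'.im) : IsLasso x 1 r θ' g :=
  hl.dir (convex_quad r.re r.im) ⟨h1, h2⟩ ⟨h3, h4⟩ fun _ ht => h.valid hx ht.1 ht.2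

lemma root_re {x : ℝ} (hx : x < -1/2) (hs : sR x < 0) {y : ℂ} (hy : G x y 1 = 0) :
    (y.re = 0 ∧ y.im^2 = -vR x) ∨ Four x y := by
  rcases root_cases hx hy with h | h
  · left
    have hv := vR_neg hx hs
    have h1 := congrArg Complex.im h
    have h2 := congrArg Complex.re h
    rw [sq_im, ofReal_im] at h1
    rw [sq_re, ofReal_re] at h2
    have : y.re = 0 := by
      by_contra hc
      have : y.im = 0 := by
        have : y.re*y.im = 0 := by linarith
        exact (mul_eq_zero.1 this).resolve_left hc
      rw [this] at h2
      nlinarith [sq_nonneg y.re]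
    refine ⟨this, ?_⟩
    rw [this] at h2; linarith
  · right; exact h

lemma Four.valid2 {x : ℝ} (hx : x < -1/2) (hs : sR x < 0) {r θ : ℂ} (h : Four x r)
    (h1 : 0 < r.re*θ.re) : Valid x 1 r θ := by
  refine ⟨?_, h.root hx, h.simple hx, ?_⟩
  · rintro rfl; simp at h1
  · intro t ht h0
    have ha := (h.abs hx).1
    have e1 : (r + t*θ).re = r.re + t*θ.re := by simp
    have hz := zf_re hx
    have h2 := mul_pos ht h1
    rcases root_re hx hs h0 with h3 | h3
    · have := h3.1
      rw [e1] at this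
      have h4 : r.re*(r.re + t*θ.re) = 0 := by rw [this, mul_zero]
      nlinarith [mul_self_nonneg r.re]
    · have h4 := (h3.abs hx).1
      have h5 : (r+t*θ).re^2 = r.re^2 := by rw [← sq_abs, h4, ← ha, sq_abs]
      rw [e1] at h5
      have : 0 ≤ (t*θ.re)^2 := sq_nonneg _
      nlinarith

lemma Four.dir2 {x : ℝ} (hx : x < -1/2) (hs : sR x < 0) {r θ θ' : ℂ} (h : Four x r)
    {g : FundamentalGroup U P}
    (hl : IsLasso x 1 r θ g) (h1 : 0 < r.re*θ.re) 
    (h3 : 0 < r.re*θ'.re) : IsLasso x 1 r θ' g :=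
  hl.dir (convex_half r.re) h1 h3 fun _ ht => h.valid2 hx hs ht

lemma gen_real {x : ℝ} (hx : x < -1/2) (hs : sR x < 0) : Gen x 1 := by
  have he := eR_neg hx
  have h1 : (3*(x:ℂ)^2-2*1^2) = ((sR x : ℝ):ℂ) := by unfold sR; push_cast; ring
  have h2 : ((x:ℂ)-1)^2*(2*x+1)*1 = ((eR x : ℝ):ℂ) := by unfold eR; push_cast; ring
  unfold Gen
  rw [h1, h2]
  refine ⟨by exact_mod_cast hs.ne, by exact_mod_cast he.ne, ?_⟩
  have : 0 < sR x^2 - 4*eR x := by nlinarith [sq_nonneg (sR x)]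
  exact_mod_cast this.ne'

lemma tau_root {x : ℝ} (hx : x < -1/2) {τ : ℝ} (hτ : τ^2 = -vR x) : G x (τ*I) 1 = 0 := by
  rw [G_fac hx]
  have : ((τ:ℂ)*I)^2 = vR x := by
    rw [mul_pow, I_sq, ← ofReal_pow, hτ]; push_cast; ring
  rw [this]; ring

lemma tau_valid {x : ℝ} (hx : x < -1/2) (hs : sR x < 0) {τ φ : ℝ} (hτ : τ^2 = -vR x)
    (hφ : φ*(zf x).re < (zf x).im - |τ|) {θ : ℂ} (h1 : 0 < θ.re) (h2 : 0 ≤ θ.im)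
    (h3 : θ.im ≤ φ*θ.re) : Valid x 1 (τ*I) θ := by
  have hr := tau_root hx hτ
  refine ⟨?_, hr, (gen_real hx hs).simple hr, ?_⟩
  · rintro rfl; simp at h1
  · intro t ht h0
    have e1 : (τ*I + t*θ).re = t*θ.re := by simp
    have e2 : (τ*I + t*θ).im = τ + t*θ.im := by simp
    have p1 := mul_pos ht h1
    rcases root_re hx hs h0 with h4 | h4
    · rw [e1] at h4; linarith [h4.1]
    · have h5 := h4.abs hx
      rw [e1, e2, abs_of_pos p1] at h5
      have h6 : |τ + t*θ.im| ≤ |τ| + t*θ.im := by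
        apply (abs_add_le _ _).trans
        rw [abs_of_nonneg (mul_nonneg ht.le h2)]
      rw [h5.2] at h6
      have h7 : t*θ.im ≤ t*(φ*θ.re) := mul_le_mul_of_nonneg_left h3 ht.le
      rw [← h5.1] at hφ
      nlinarith

lemma tau_dir {x : ℝ} (hx : x < -1/2) (hs : sR x < 0) {τ φ : ℝ} (hτ : τ^2 = -vR x) (hφ0 : 0 ≤ φ)
    (hφ : φ*(zf x).re < (zf x).im - |τ|) {θ θ' : ℂ} {g : FundamentalGroup U P}
    (hl : IsLasso x 1 (τ*I) θ g) (h1 : 0 < θ.re) (h2 : θ.im = 0)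
    (h1' : 0 < θ'.re) (h2' : θ'.im = φ*θ'.re) : IsLasso x 1 (τ*I) θ' g := by
  refine hl.dir (C := {t | 0 < t.re ∧ 0 ≤ t.im ∧ t.im ≤ φ*t.re}) ?_ ⟨h1, h2.ge, ?_⟩ ⟨h1', ?_, h2'.le⟩
    fun t ht => tau_valid hx hs hτ hφ ht.1 ht.2.1 ht.2.2
  · intro p hp q hq s t hs ht hst
    simp only [Set.mem_ofPred_eq, add_re, add_im, real_smul, re_ofReal_mul, im_ofReal_mul] at *
    refine ⟨?_, by nlinarith [mul_nonneg hs hp.2.1, mul_nonneg ht hq.2.1],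
       by nlinarith [mul_le_mul_of_nonneg_left hp.2.2 hs, mul_le_mul_of_nonneg_left hq.2.2 ht]⟩
    rcases hs.eq_or_lt with rfl | hs
    · have : t = 1 := by linarith
      subst this; simpa using hq.1
    · nlinarith [mul_pos hs hp.1, mul_nonneg ht hq.1.le]
  · rw [h2]; positivity
  · rw [h2']; positivity

/-- transport along the real axis -/
lemma transport {x x' : ℝ} (hx : x < -1/2) (hx' : x' < -1/2) {g : FundamentalGroup U P}
    (h : IsLasso x 1 (zf x) (1+I) g) : IsLasso x' 1 (zf x') (1+I) g := by
  have hj := JoinedIn.of_segment_subset ((convex_Iio (-1/2:ℝ)).segment_subset hx hx')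
  refine IsLasso.joined hj (X := fun x => (x:ℂ)) (Z := fun _ => 1) (r := zf) (θ := fun _ => 1+I)
    (by fun_prop) (by fun_prop) zf_cont (by fun_prop) ?_ h
  intro x hx
  apply Four.valid hx (Or.inl (Or.inl rfl))
  · simpa using zf_re hx
  · simpa using zf_im hx

lemma transport' {x x' : ℝ} (hx : x < -1/2) (hx' : x' < -1/2) {g : FundamentalGroup U P}
    (h : IsLasso x 1 ((starRingEnd ℂ) (zf x)) (1-I) g) :
    IsLasso x' 1 ((starRingEnd ℂ) (zf x')) (1-I) g := by
  have hj := JoinedIn.of_segment_subset ((convex_Iio (-1/2:ℝ)).segment_subset hx hx')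
  refine IsLasso.joined hj (X := fun x => (x:ℂ)) (Z := fun _ => 1)
    (r := fun x => (starRingEnd ℂ) (zf x)) (θ := fun _ => 1-I)
    (by fun_prop) (by fun_prop) (continuous_conj.comp_continuousOn zf_cont) (by fun_prop) ?_ h
  intro x hx
  apply Four.valid hx (Or.inr (Or.inl rfl))
  · simpa using zf_re hx
  · simpa using zf_im hx

end Oka

namespace Oka
open Complex Topology

lemma sqrt_cpow {a : ℝ} (ha : 0 ≤ a) : (a:ℂ)^(2⁻¹:ℂ) = ((√a : ℝ):ℂ) := by
  rw [Real.sqrt_eq_rpow, ofReal_cpow ha]; norm_num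

lemma sR_lt_vR {x : ℝ} (hx : x < -1/2) (hs : sR x < 0) : sR x < vR x := by
  have he := eR_neg hx
  have h1 : (vR x - sR x)^3 = 27*eR x*vR x := by
    unfold vR; linear_combination 27*ab_cube hx + 81*(aR x+bR x)*ab_mul hx
  have hv := vR_neg hx hs
  by_contra hc
  push Not at hc
  have h2 : (vR x - sR x)^3 ≤ 0 := by
    rw [Odd.pow_nonpos_iff (by decide)]; linarith
  nlinarith [mul_pos_of_neg_of_neg he hv]

lemma loc_A (ε : ℝ) (hε : ε^2 = 1) : ∃ ρ > (0:ℝ), ∃ g : FundamentalGroup U P, ∀ x : ℝ,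
    -1/2 - ρ < x → x < -1/2 → sR x < 0 ∧ ∀ Y u : ℂ, G x ((ε*I*√(-sR x))*Y) 1 = 0 → 0 ≤ Y.re →
      u^2 = Y-1 → 0 ≤ u.re → IsLasso x 1 ((ε*I*√(-sR x))*Y) ((ε*I*√(-sR x))*u) g := by
  have hε' : (ε:ℂ)^2 = 1 := by exact_mod_cast hε
  let S : ℂ → ℂ := fun ζ => 3*(-1/2+ζ)^2-2
  have hre : ∀ ζ ∈ Metric.ball (0:ℂ) (1/4), 0 < (-S ζ).re := by
    intro ζ hζ
    rw [mem_ball_zero_iff] at hζ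
    have e : -S ζ = (5/4:ℝ) + (3*ζ-3*ζ^2) := by simp only [S]; push_cast; ring
    have h1 : ‖3*ζ-3*ζ^2‖ ≤ 3*‖ζ‖+3*‖ζ‖^2 := by
      apply (norm_sub_le _ _).trans
      rw [norm_mul, norm_mul, norm_pow]; simp
    have h2 := (abs_le.1 (abs_re_le_norm (3*ζ-3*ζ^2))).1
    rw [e, add_re, ofReal_re]
    nlinarith [norm_nonneg ζ]
  have hS0 : ∀ ζ ∈ Metric.ball (0:ℂ) (1/4), S ζ ≠ 0 := by
    intro ζ hζ h0
    have := hre ζ hζ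
    rw [h0] at this; simp at this
  have hsq : ∀ ζ, (ε*I*(-S ζ)^(2⁻¹:ℂ))^2 = S ζ := by
    intro ζ
    rw [mul_pow, mul_pow, hε', I_sq, cpow_ofNat_inv_pow _ 2]; ring
  obtain ⟨ρ, hρ, hρ0, g, hg⟩ := local_lasso (X := fun ζ => -1/2+ζ) (Z := fun _ => 1)
    (σ := fun ζ => ε*I*(-S ζ)^(2⁻¹:ℂ)) (h := fun ζ => (ζ-3/2)^2*2/(S ζ)^2) (ρ0 := 1/4) (by norm_num)
    (by fun_prop) (by fun_prop) (by
      apply ContinuousOn.mul continuousOn_const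
      intro ζ hζ
      apply ContinuousWithinAt.cpow _ continuousWithinAt_const
      · left; exact hre ζ hζ
      · apply Continuous.continuousWithinAt; simp only [S]; fun_prop)
    (by
      intro ζ hζ h0
      have := hsq ζ
      rw [h0] at this
      exact hS0 ζ hζ (by rw [← this]; ring))
    (by intro ζ hζ; rw [hsq]; simp only [S]; ring)
    (by
      intro ζ hζ
      rw [hsq]
      have := hS0 ζ hζ
      field_simp
      ring)
    (by
      have h0 := hS0 0 (by simp)
      apply ContDiffAt.div
      · fun_prop
      · simp only [S]; fun_prop
      · exact pow_ne_zero _ h0)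
    (by
      have h0 := hS0 0 (by simp)
      exact div_ne_zero (by norm_num) (pow_ne_zero _ h0))
  refine ⟨ρ, hρ, g, ?_⟩
  intro x hx1 hx2
  have hn : ‖((x+1/2 : ℝ):ℂ)‖ < ρ := by
    rw [norm_real, Real.norm_eq_abs, abs_lt]; constructor <;> linarith
  have hz0 : ((x+1/2 : ℝ):ℂ) ≠ 0 := by
    have : x+1/2 ≠ 0 := by linarith
    exact_mod_cast this
  have hb : ((x+1/2 : ℝ):ℂ) ∈ Metric.ball (0:ℂ) (1/4) := by
    rw [mem_ball_zero_iff]; linarith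
  have eX : -1/2 + ((x+1/2 : ℝ):ℂ) = x := by push_cast; ring
  have eS : -S ((x+1/2 : ℝ):ℂ) = ((-sR x : ℝ):ℂ) := by
    simp only [S, sR]; push_cast; ring
  have hs : 0 < -sR x := by
    have := hre _ hb
    rwa [eS, ofReal_re] at this
  have hgx := hg _ hz0 hn
  rw [eS, sqrt_cpow hs.le, eX] at hgx
  refine ⟨by linarith, ?_⟩
  intro Y u hY hY0 hu hu0
  apply hgx Y u _ hY0 hu hu0
  have hσ := hsq ((x+1/2 : ℝ):ℂ)
  have hSne := hS0 _ hb
  rw [eS, sqrt_cpow hs.le] at hσ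
  set σ : ℂ := ε*I*((√(-sR x) : ℝ):ℂ) with hσd
  have hσ0 : σ ≠ 0 := by
    intro h; rw [h] at hσ; exact hSne (by rw [← hσ]; ring)
  set j := ((x+1/2 : ℝ):ℂ) * (((((x+1/2 : ℝ):ℂ)-3/2)^2*2/(S ((x+1/2 : ℝ):ℂ))^2)) with hj
  have hjS : j*(σ^2)^2 = ((x:ℂ)-1)^2*(2*x+1)*1 := by
    rw [hσ, hj]
    clear_value j σ
    generalize S ((x+1/2 : ℝ):ℂ) = s0 at *
    field_simp
    push_cast; ring
  have := G_norm (X := x) (Z := 1) (σ := σ) (j := j) (Y := Y)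
    (by rw [hσ]; simp only [S]; push_cast; ring) hjS.symm
  rw [hY] at this
  have h2 := (mul_eq_zero.1 this.symm).resolve_left (pow_ne_zero _ hσ0)
  linear_combination h2

lemma loc_A' (ε : ℝ) (hε : ε^2 = 1) : ∃ ρ > (0:ℝ), ∃ g : FundamentalGroup U P, ∀ x : ℝ,
    -1/2 - ρ < x → x < -1/2 → sR x < 0 ∧
    (∀ r, Four x r → 0 < ε*r.im → ∃ θ : ℂ, 0 < r.re*θ.re ∧ 0 < r.im*θ.im ∧ IsLasso x 1 r θ g) ∧
    (∀ τ : ℝ, τ^2 = -vR x → 0 < ε*τ → ∃ θ : ℂ, 0 < θ.re ∧ θ.im = 0 ∧ IsLasso x 1 (τ*I) θ g) := by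
  obtain ⟨ρ, hρ, g, hg⟩ := loc_A ε hε
  refine ⟨ρ, hρ, g, ?_⟩
  intro x hx1 hx
  obtain ⟨hs, hg⟩ := hg x hx1 hx
  refine ⟨hs, ?_, ?_⟩
  all_goals
    have hq : 0 < √(-sR x) := Real.sqrt_pos.2 (by linarith)
    have hq2 : √(-sR x)^2 = -sR x := Real.sq_sqrt (by linarith)
    set q := √(-sR x) with hqd
    clear_value q
    have hε' : (ε:ℂ)^2 = 1 := by exact_mod_cast hε
    have hqC : (q:ℂ) ≠ 0 := by exact_mod_cast hq.ne'
  · intro r hr hri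
    set Y : ℂ := ((ε*r.im/q : ℝ):ℂ) + ((-ε*r.re/q : ℝ):ℂ)*I with hY
    have hr' : (ε*I*q)*Y = r := by
      have e : r = r.re + r.im*I := (re_add_im r).symm
      rw [hY]; push_cast
      field_simp
      have hr2 : (r:ℂ) = r.re*(ε^2) + r.im*(ε^2)*I := by rw [hε']; simp
      conv_rhs => rw [hr2]
      linear_combination (-(ε:ℂ)^2*r.re)*I_sq
    have hYre : Y.re = ε*r.im/q := by rw [hY]; simp
    have hYim : Y.im = -ε*r.re/q := by rw [hY]; simp
    have hu2 : ((Y-1)^(2⁻¹:ℂ))^2 = Y-1 := cpow_ofNat_inv_pow _ 2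
    have hu0 := half_re (Y-1)
    set u := (Y-1)^(2⁻¹:ℂ) with hu
    clear_value u Y
    have hL := hg Y u (by rw [hr']; exact hr.root hx) (by rw [hYre]; positivity) hu2 hu0
    rw [hr'] at hL
    have hrre : r.re ≠ 0 := by
      intro h
      have := (hr.abs hx).1
      rw [h] at this
      have := zf_re hx
      simp at *; linarith
    have him := congrArg Complex.im hu2
    rw [sq_im, sub_im, one_im, hYim] at him
    have hupos : 0 < u.re := by
      apply lt_of_le_of_ne hu0
      intro h
      rw [← h] at him
      have : ε*r.re = 0 := by
        field_simp at him; linarith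
      have hε0 : ε ≠ 0 := by rintro rfl; norm_num at hε
      exact mul_ne_zero hε0 hrre this
    have e1 : ((ε*I*q)*u : ℂ).re = -(ε*q*u.im) := by simp
    have e2 : ((ε*I*q)*u : ℂ).im = ε*q*u.re := by simp
    refine ⟨_, ?_, ?_, hL⟩
    · rw [e1]
      have : 2*u.re*(r.re * -(ε*q*u.im)) = r.re^2 := by
        have h1 : 2*(u.re*u.im)*q = -ε*r.re := by
          field_simp at him; linarith
        linear_combination (-ε*r.re)*h1 + r.re^2*hε
      have h2 : 0 < r.re^2 := by positivity
      rw [← this] at h2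
      exact (mul_pos_iff_of_pos_left (by positivity)).1 h2
    · rw [e2]
      have := mul_pos hri (mul_pos hq hupos)
      linarith
  · intro τ hτ hετ
    have hv := sR_lt_vR hx hs
    have hY1 : ε*τ/q < 1 := by
      rw [div_lt_one hq]
      apply lt_of_pow_lt_pow_left₀ 2 hq.le
      rw [mul_pow, hε, hτ, hq2]; linarith
    have hw : 0 < √(1-ε*τ/q) := Real.sqrt_pos.2 (by linarith)
    have hw2 : √(1-ε*τ/q)^2 = 1-ε*τ/q := Real.sq_sqrt (by linarith)
    set w := √(1-ε*τ/q)
    clear_value w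
    have hr' : ((ε:ℂ)*I*q)*((ε*τ/q : ℝ):ℂ) = τ*I := by
      push_cast
      field_simp
      linear_combination (τ:ℂ)*hε'
    have hw2' : (w:ℂ)^2 = 1 - ((ε*τ/q : ℝ):ℂ) := by exact_mod_cast hw2
    have hL := hg ((ε*τ/q : ℝ):ℂ) (-(ε:ℂ)*I*w) (by rw [hr']; exact tau_root hx hτ)
      (by rw [ofReal_re]; positivity)
      (by
        have : (-(ε:ℂ)*I*w)^2 = (ε:ℂ)^2*(I)^2*(w:ℂ)^2 := by ring
        rw [this, hε', I_sq, hw2']; ring) (by simp)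
    rw [hr'] at hL
    have e : ((ε:ℂ)*I*q)*(-(ε:ℂ)*I*w) = ((q*w : ℝ):ℂ) := by
      have : ((ε:ℂ)*I*q)*(-(ε:ℂ)*I*w) = -((ε:ℂ)^2*(I)^2*(q*w)) := by ring
      rw [this, hε', I_sq]; push_cast; ring
    rw [e] at hL
    refine ⟨_, ?_, ?_, hL⟩
    · rw [ofReal_re]; positivity
    · rw [ofReal_im]

lemma loc_B : ∃ x : ℝ, x < -1/2 ∧ ∃ g : FundamentalGroup U P,
    ∀ r, Four x r → 0 < r.re → ∃ θ : ℂ, 0 < r.re*θ.re ∧ 0 < r.im*θ.im ∧ IsLasso x 1 r θ g := by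
  let S : ℂ → ℂ := fun ζ => 3*(-1)^2-2*ζ^2
  have hre : ∀ ζ ∈ Metric.ball (0:ℂ) (1/2), 0 < (S ζ).re := by
    intro ζ hζ
    rw [mem_ball_zero_iff] at hζ
    have e : S ζ = (3:ℝ) - 2*ζ^2 := by simp only [S]; push_cast; ring
    have h1 : ‖2*ζ^2‖ ≤ 2*‖ζ‖^2 := by
      rw [norm_mul, norm_pow]; simp
    have h2 := (abs_le.1 (abs_re_le_norm (2*ζ^2))).2
    rw [e, sub_re, ofReal_re]
    nlinarith [norm_nonneg ζ]
  have hS0 : ∀ ζ ∈ Metric.ball (0:ℂ) (1/2), S ζ ≠ 0 := by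
    intro ζ hζ h0
    have := hre ζ hζ
    rw [h0] at this; simp at this
  have hsq : ∀ ζ, ((S ζ)^(2⁻¹:ℂ))^2 = S ζ := by
    intro ζ
    rw [cpow_ofNat_inv_pow _ 2]
  obtain ⟨ρ, hρ, hρ0, g, hg⟩ := local_lasso (X := fun ζ => -1) (Z := fun ζ => ζ)
    (σ := fun ζ => (S ζ)^(2⁻¹:ℂ)) (h := fun ζ => (-1-ζ)^2*(-2+ζ)/(S ζ)^2) (ρ0 := 1/2) (by norm_num)
    (by fun_prop) (by fun_prop) (by
      intro ζ hζ
      apply ContinuousWithinAt.cpow _ continuousWithinAt_const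
      · left; exact hre ζ hζ
      · apply Continuous.continuousWithinAt; simp only [S]; fun_prop)
    (by
      intro ζ hζ h0
      have := hsq ζ
      rw [h0] at this
      exact hS0 ζ hζ (by rw [← this]; ring))
    (by intro ζ hζ; rw [hsq])
    (by
      intro ζ hζ
      rw [hsq]
      have := hS0 ζ hζ
      field_simp)
    (by
      have h0 := hS0 0 (by simp)
      apply ContDiffAt.div
      · fun_prop
      · simp only [S]; fun_prop
      · exact pow_ne_zero _ h0)
    (by
      have h0 := hS0 0 (by simp)
      exact div_ne_zero (by norm_num) (pow_ne_zero _ h0))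
  set t : ℝ := ρ/2 with ht
  have ht0 : 0 < t := by positivity
  have hn : ‖(t:ℂ)‖ < ρ := by
    rw [norm_real, Real.norm_eq_abs, abs_lt]; constructor <;> linarith
  have hz0 : (t:ℂ) ≠ 0 := by exact_mod_cast ht0.ne'
  have hb : (t:ℂ) ∈ Metric.ball (0:ℂ) (1/2) := by
    rw [mem_ball_zero_iff]; linarith
  have hx : -1/t < -1/2 := by
    rw [div_lt_div_iff₀ ht0 (by norm_num)]; linarith
  refine ⟨-1/t, hx, g, ?_⟩
  have eS : S t = ((3-2*t^2 : ℝ):ℂ) := by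
    simp only [S]; push_cast; ring
  have hs : 0 < 3-2*t^2 := by
    have := hre _ hb
    rwa [eS, ofReal_re] at this
  have hgx := hg _ hz0 hn
  have hσ := hsq t
  have hSne := hS0 _ hb
  rw [eS, sqrt_cpow hs.le] at hgx hσ
  have hq : 0 < √(3-2*t^2) := Real.sqrt_pos.2 hs
  set q := √(3-2*t^2) with hqd
  clear_value q
  have hqC : (q:ℂ) ≠ 0 := by exact_mod_cast hq.ne'
  intro r hr hrre
  set Y : ℂ := ((t*r.re/q : ℝ):ℂ) + ((t*r.im/q : ℝ):ℂ)*I with hY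
  have hr' : q*Y = t*r := by
    rw [hY]; push_cast
    field_simp
    rw [re_add_im]
  have hYre : Y.re = t*r.re/q := by rw [hY]; simp
  have hYim : Y.im = t*r.im/q := by rw [hY]; simp
  have hu2 : ((Y-1)^(2⁻¹:ℂ))^2 = Y-1 := cpow_ofNat_inv_pow _ 2
  have hu0 := half_re (Y-1)
  set u := (Y-1)^(2⁻¹:ℂ) with hu
  clear_value u Y
  have hrt : G (-1) (q*Y) t = 0 := by
    rw [hr']
    have h1 := G_hom t ((-1/t : ℝ):ℂ) r 1
    rw [hr.root hx] at h1
    have e : (t:ℂ)*((-1/t : ℝ):ℂ) = -1 := by push_cast; field_simp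
    rw [e] at h1
    simpa using h1
  set j := (t:ℂ) * ((-1-(t:ℂ))^2*(-2+(t:ℂ))/(((3-2*t^2 : ℝ):ℂ))^2) with hj
  rw [eS] at hSne
  have hjS : j*((q:ℂ)^2)^2 = ((-1:ℂ)-t)^2*(2*(-1)+t)*t := by
    rw [hσ, hj]
    field_simp
  have hGn := G_norm (X := -1) (Z := t) (σ := q) (j := j) (Y := Y)
    (by rw [hσ]; push_cast; ring) hjS.symm
  rw [hrt] at hGn
  have h2 := (mul_eq_zero.1 hGn.symm).resolve_left (pow_ne_zero _ hqC)
  have hL := hgx Y u (by linear_combination h2) (by rw [hYre]; positivity) hu2 hu0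
  have hL2 := hL.scale (inv_ne_zero hz0)
  rw [hr', inv_mul_cancel_left₀ hz0, inv_mul_cancel₀ hz0] at hL2
  have e3 : (t:ℂ)⁻¹ * (-1) = ((-1/t : ℝ):ℂ) := by push_cast; field_simp
  rw [e3] at hL2
  have hrim : r.im ≠ 0 := by
    intro h
    have h1 := (hr.abs hx).2
    rw [h] at h1
    have h2 := zf_im hx
    simp at h1; linarith
  have him := congrArg Complex.im hu2
  rw [sq_im, sub_im, one_im, hYim] at him
  have hupos : 0 < u.re := by
    apply lt_of_le_of_ne hu0
    intro h
    rw [← h] at him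
    have : t*r.im = 0 := by
      field_simp at him; linarith
    exact mul_ne_zero ht0.ne' hrim this
  have e0 : (t:ℂ)⁻¹*(q*u) = ((q/t : ℝ):ℂ)*u := by push_cast; ring
  rw [e0] at hL2
  refine ⟨_, ?_, ?_, hL2⟩
  · rw [re_ofReal_mul]; positivity
  · rw [im_ofReal_mul]
    have : 2*u.re*(r.im*(q/t*u.im)) = r.im^2 := by
      field_simp
      field_simp at him
      linear_combination him
    have h2 : 0 < r.im^2 := by positivity
    rw [← this] at h2
    exact (mul_pos_iff_of_pos_left (by positivity)).1 h2

end Oka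

namespace Oka
open Complex Topology

lemma tilt_lasso {x φ : ℝ} {r : ℂ} {ε : ℂ} {g : FundamentalGroup U P}
    (h : IsLasso x 1 r (ε*(1-φ*I)⁻¹) g) (hk : (1-φ*I : ℂ) ≠ 0) :
    IsLasso ((1-φ*I)*x) (1-φ*I) ((1-φ*I)*r) ε g := by
  have := h.scale hk
  rwa [mul_one, mul_comm ε, mul_inv_cancel_left₀ hk] at this

lemma exists_gen : ∃ g : FundamentalGroup U P, Subgroup.zpowers g = ⊤ ∧ g^6 = 1 := by
  obtain ⟨ρ1, hρ1, g1, h1⟩ := loc_A' 1 (by norm_num)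
  obtain ⟨ρ2, hρ2, g2, h2⟩ := loc_A' (-1) (by norm_num)
  obtain ⟨x0, hx0, g, h3⟩ := loc_B
  set x : ℝ := -1/2 - min ρ1 ρ2/2 with hxd
  have hm : 0 < min ρ1 ρ2 := lt_min hρ1 hρ2
  have hx : x < -1/2 := by rw [hxd]; linarith
  obtain ⟨hs, h1, h1'⟩ := h1 x (by rw [hxd]; linarith [min_le_left ρ1 ρ2]) hx
  obtain ⟨_, h2, h2'⟩ := h2 x (by rw [hxd]; linarith [min_le_right ρ1 ρ2]) hx
  clear_value x
  have hF1 : ∀ t, Four t (zf t) := fun t => Or.inl (Or.inl rfl)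
  have hF2 : ∀ t, Four t (-zf t) := fun t => Or.inl (Or.inr rfl)
  have hF3 : ∀ t, Four t ((starRingEnd ℂ) (zf t)) := fun t => Or.inr (Or.inl rfl)
  have hF4 : ∀ t, Four t (-(starRingEnd ℂ) (zf t)) := fun t => Or.inr (Or.inr rfl)
  have hp := zf_re hx
  have hmm := zf_im hx
  have hp0 := zf_re hx0
  have hm0 := zf_im hx0
  have hg1 : g1 = g := by
    obtain ⟨θ, a1, a2, a3⟩ := h1 _ (hF1 x) (by linarith)
    obtain ⟨θ', b1, b2, b3⟩ := h3 _ (hF1 x0) hp0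
    have a4 := (hF1 x).dir hx a3 a1 a2 (θ' := 1+I) (by simpa using hp) (by simpa using hmm)
    have b4 := (hF1 x0).dir hx0 b3 b1 b2 (θ' := 1+I) (by simpa using hp0) (by simpa using hm0)
    exact a4.unique (transport hx0 hx b4)
  have hg2 : g2 = g := by
    obtain ⟨θ, a1, a2, a3⟩ := h2 _ (hF3 x) (by rw [conj_im]; linarith)
    obtain ⟨θ', b1, b2, b3⟩ := h3 _ (hF3 x0) (by rwa [conj_re])
    have a4 := (hF3 x).dir hx a3 a1 a2 (θ' := 1-I) (by simpa using hp) (by simpa using hmm)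
    have b4 := (hF3 x0).dir hx0 b3 b1 b2 (θ' := 1-I) (by simpa using hp0) (by simpa using hm0)
    exact a4.unique (transport' hx0 hx b4)
  subst hg1
  subst hg2
  clear h3 hp0 hm0 hx0
  have hv := vR_neg hx hs
  have hlt := vR_lt hx hs
  obtain ⟨τ, hτ0, hτ⟩ : ∃ τ : ℝ, 0 < τ ∧ τ^2 = -vR x :=
    ⟨√(-vR x), Real.sqrt_pos.2 (by linarith), Real.sq_sqrt (by linarith)⟩
  have hτm : τ < (zf x).im := by
    apply lt_of_pow_lt_pow_left₀ 2 hmm.le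
    rw [hτ]; exact hlt
  obtain ⟨φ, hφ0, hφ⟩ : ∃ φ : ℝ, 0 < φ ∧ φ*(zf x).re < (zf x).im - τ := by
    refine ⟨((zf x).im - τ)/(2*(zf x).re), div_pos (by linarith) (by linarith), ?_⟩
    rw [div_mul_eq_mul_div, div_lt_iff₀ (by linarith)]
    nlinarith
  have hk : (1-φ*I : ℂ) ≠ 0 := by
    intro h
    have := congrArg Complex.re h
    simp at this
  have hinv : (1-φ*I : ℂ)⁻¹ = (((1+φ^2)⁻¹ : ℝ):ℂ)*(1+φ*I) := by
    have h0 : (1+(φ:ℂ)^2) ≠ 0 := by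
      have : (1+φ^2) ≠ 0 := by positivity
      exact_mod_cast this
    push_cast
    rw [inv_eq_iff_eq_inv, mul_inv, inv_inv]
    have h4 : (1+φ*I : ℂ) ≠ 0 := by
      intro h
      have := congrArg Complex.re h
      simp at this
    rw [eq_mul_inv_iff_mul_eq₀ h4]
    linear_combination -(φ:ℂ)^2*I_sq
  have hire : (1-φ*I : ℂ)⁻¹.re = (1+φ^2)⁻¹ := by
    rw [hinv, re_ofReal_mul]; simp
  have hiim : (1-φ*I : ℂ)⁻¹.im = φ*(1+φ^2)⁻¹ := by
    rw [hinv, im_ofReal_mul]; simp; ring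
  have hpos : 0 < (1+φ^2)⁻¹ := by positivity
  have him : ∀ r : ℂ, ((1-φ*I)*r).im = r.im - φ*r.re := by
    intro r; simp; ring
  -- lassos
  have L1 : IsLasso x 1 (-(starRingEnd ℂ) (zf x)) ((-1)*(1-φ*I)⁻¹) g2 := by
    obtain ⟨θ, a1, a2, a3⟩ := h1 _ (hF4 x) (by simpa using hmm)
    apply (hF4 x).dir2 hx hs a3 a1
    rw [neg_one_mul, neg_re, neg_re, conj_re, hire]; nlinarith
  have L2 : IsLasso x 1 (zf x) (1*(1-φ*I)⁻¹) g2 := by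
    obtain ⟨θ, a1, a2, a3⟩ := h1 _ (hF1 x) (by simpa using hmm)
    apply (hF1 x).dir2 hx hs a3 a1
    rw [one_mul, hire]; positivity
  have L3 : IsLasso x 1 (τ*I) (1*(1-φ*I)⁻¹) g2 := by
    obtain ⟨θ, a1, a2, a3⟩ := h1' τ hτ (by linarith)
    apply tau_dir hx hs hτ hφ0.le (by rw [abs_of_pos hτ0]; exact hφ) a3 a1 a2
    · rw [one_mul, hire]; exact hpos
    · rw [one_mul, hire, hiim]
  have L4 : IsLasso x 1 (((-τ:ℝ):ℂ)*I) (1*(1-φ*I)⁻¹) g2 := by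
    have hτ' : (-τ)^2 = -vR x := by rw [neg_sq, hτ]
    obtain ⟨θ, a1, a2, a3⟩ := h2' (-τ) hτ' (by linarith)
    apply tau_dir hx hs hτ' hφ0.le (by rw [abs_neg, abs_of_pos hτ0]; exact hφ) a3 a1 a2
    · rw [one_mul, hire]; exact hpos
    · rw [one_mul, hire, hiim]
  have L5 : IsLasso x 1 (-zf x) ((-1)*(1-φ*I)⁻¹) g2 := by
    obtain ⟨θ, a1, a2, a3⟩ := h2 _ (hF2 x) (by simpa using hmm)
    apply (hF2 x).dir2 hx hs a3 a1
    rw [neg_one_mul, neg_re, neg_re, hire]; nlinarith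
  have L6 : IsLasso x 1 ((starRingEnd ℂ) (zf x)) (1*(1-φ*I)⁻¹) g2 := by
    obtain ⟨θ, a1, a2, a3⟩ := h2 _ (hF3 x) (by simpa using hmm)
    apply (hF3 x).dir2 hx hs a3 a1
    rw [one_mul, conj_re, hire]; positivity
  have e1 := tilt_lasso L1 hk
  have e2 := tilt_lasso L2 hk
  have e3 := tilt_lasso L3 hk
  have e4 := tilt_lasso L4 hk
  have e5 := tilt_lasso L5 hk
  have e6 := tilt_lasso L6 hk
  have b1 := him (-(starRingEnd ℂ) (zf x))
  have b2 := him (zf x)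
  have b3 := him (τ*I)
  have b4 := him (((-τ:ℝ):ℂ)*I)
  have b5 := him (-zf x)
  have b6 := him ((starRingEnd ℂ) (zf x))
  simp only [neg_im, neg_re, conj_im, conj_re] at b1 b5 b6
  simp only [re_ofReal_mul, im_ofReal_mul, I_re, I_im, mul_zero, mul_one, sub_zero] at b3 b4
  have hroot : ∀ r, G x r 1 = 0 → G ((1-φ*I)*x) ((1-φ*I)*r) (1-φ*I) = 0 := by
    intro r hr
    have := G_hom (1-φ*I) x r 1
    rw [hr, mul_one, mul_zero] at this
    exact this
  have hroot' : ∀ y, G ((1-φ*I)*x) y (1-φ*I) = 0 → ∃ r, y = (1-φ*I)*r ∧ G x r 1 = 0 := by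
    intro y hy
    refine ⟨(1-φ*I)⁻¹*y, by rw [mul_inv_cancel_left₀ hk], ?_⟩
    have := G_hom (1-φ*I) x ((1-φ*I)⁻¹*y) 1
    rw [mul_inv_cancel_left₀ hk, mul_one, hy] at this
    exact (mul_eq_zero.1 this.symm).resolve_left (pow_ne_zero _ hk)
  have hpφ := mul_pos hφ0 hp
  have hsix := six (X := (1-φ*I)*x) (Z := 1-φ*I) (g := g2)
    ![(1-φ*I)*(-(starRingEnd ℂ) (zf x)), (1-φ*I)*(zf x), (1-φ*I)*(τ*I), (1-φ*I)*(((-τ:ℝ):ℂ)*I),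
      (1-φ*I)*(-zf x), (1-φ*I)*((starRingEnd ℂ) (zf x))]
    (by
      have hst : ∀ i : Fin 5, ((![(1-φ*I)*(-(starRingEnd ℂ) (zf x)), (1-φ*I)*(zf x), (1-φ*I)*(τ*I),
          (1-φ*I)*(((-τ:ℝ):ℂ)*I), (1-φ*I)*(-zf x), (1-φ*I)*((starRingEnd ℂ) (zf x))] : Fin 6 → ℂ) i.succ).im
         < ((![(1-φ*I)*(-(starRingEnd ℂ) (zf x)), (1-φ*I)*(zf x), (1-φ*I)*(τ*I),
          (1-φ*I)*(((-τ:ℝ):ℂ)*I), (1-φ*I)*(-zf x), (1-φ*I)*((starRingEnd ℂ) (zf x))] : Fin 6 → ℂ) i.castSucc).im := by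
        intro i
        fin_cases i
        · change ((1-φ*I)*(zf x)).im < ((1-φ*I)*(-(starRingEnd ℂ) (zf x))).im
          rw [b1, b2]; linarith
        · change ((1-φ*I)*(τ*I)).im < ((1-φ*I)*(zf x)).im
          rw [b3, b2]; linarith
        · change ((1-φ*I)*(((-τ:ℝ):ℂ)*I)).im < ((1-φ*I)*(τ*I)).im
          rw [b3, b4]; linarith
        · change ((1-φ*I)*(-zf x)).im < ((1-φ*I)*(((-τ:ℝ):ℂ)*I)).im
          rw [b5, b4]; linarith
        · change ((1-φ*I)*((starRingEnd ℂ) (zf x))).im < ((1-φ*I)*(-zf x)).im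
          rw [b5, b6]; linarith
      have := (Fin.strictAnti_iff_succ_lt (f := fun i => ((![(1-φ*I)*(-(starRingEnd ℂ) (zf x)), (1-φ*I)*(zf x), (1-φ*I)*(τ*I),
          (1-φ*I)*(((-τ:ℝ):ℂ)*I), (1-φ*I)*(-zf x), (1-φ*I)*((starRingEnd ℂ) (zf x))] : Fin 6 → ℂ) i).im)).2 hst
      exact fun i j hij => this hij)
    (by
      intro i
      fin_cases i
      · exact hroot _ ((hF4 x).root hx)
      · exact hroot _ ((hF1 x).root hx)
      · exact hroot _ (tau_root hx hτ)
      · exact hroot _ (tau_root hx (by rw [neg_sq, hτ]))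
      · exact hroot _ ((hF2 x).root hx)
      · exact hroot _ ((hF3 x).root hx))
    (by
      intro y hy
      obtain ⟨r, rfl, hr⟩ := hroot' y hy
      rcases root_re hx hs hr with ⟨c1, c2⟩ | (rfl | rfl) | (rfl | rfl)
      · have c3 : r = r.im*I := by
          apply Complex.ext <;> simp [c1]
        rw [← hτ] at c2
        rcases sq_eq_sq_iff_eq_or_eq_neg.1 c2 with c4 | c4
        · rw [c4] at c3
          exact ⟨2, by rw [c3]; rfl⟩
        · rw [c4] at c3
          exact ⟨3, by rw [c3]; rfl⟩
      · exact ⟨1, rfl⟩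
      · exact ⟨4, rfl⟩
      · exact ⟨5, rfl⟩
      · exact ⟨0, rfl⟩)
    (by
      intro i
      fin_cases i
      · exact Or.inr e1
      · exact Or.inl e2
      · exact Or.inl e3
      · exact Or.inl e4
      · exact Or.inr e5
      · exact Or.inl e6)
  refine ⟨g2, ?_, hsix.1⟩
  have hgen := (gen_real hx hs).scale hk
  rw [mul_one] at hgen
  exact top_of_fib hgen hsix.2

theorem mainU : Nonempty (FundamentalGroup U P ≃* Multiplicative (ZMod 6)) := by
  obtain ⟨g, h1, h2⟩ := exists_gen
  exact conclude g h1 h2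

lemma transfer {Q : P2C → Prop} (hQ : (fun p : P2C => G (p.rep 0) (p.rep 1) (p.rep 2) ≠ 0) = Q)
    (u : {p : P2C // Q p}) :
    Nonempty (FundamentalGroup {p : P2C // Q p} u ≃* Multiplicative (ZMod 6)) := by
  subst hQ
  obtain ⟨e⟩ := mainU
  have e2 : FundamentalGroup U u ≃* FundamentalGroup U P :=
    FundamentalGroup.fundamentalGroupMulEquivOfPathConnected u P
  exact ⟨e2.trans e⟩

end Oka

theorem pi1_complement_isomorphic_Z6
    (F : MvPolynomial (Fin 3) ℂ) (hF : F.IsHomogeneous 6)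
    (hFf6 : ∀ a b : ℂ, eval ![a, b, 1] F = eval ![a, b] f6)
    (u : {p : P2C // eval p.rep F ≠ 0}) :
    Nonempty (FundamentalGroup {p : P2C // eval p.rep F ≠ 0} u ≃* Multiplicative (ZMod 6)) := by
  refine Oka.transfer (Q := fun p => eval p.rep F ≠ 0) ?_ u
  funext p
  have h := Oka.evalF F hF hFf6 (p.rep 0) (p.rep 1) (p.rep 2)
  have e : (![p.rep 0, p.rep 1, p.rep 2] : Fin 3 → ℂ) = p.rep := by
    funext i; fin_cases i <;> rfl
  rw [e] at h
  rw [h]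
  simp

end
end
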